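/- Let (X, d, m) be a Lipschitz differentiability space which is locally bi-Lipschitz embeddable into Euclidean spaces. Then there exists a countable collection {R_j}_{j∈ℕ} of Borel subsets of X with m(X \ ∪_j R_j) = 0 and positive integers n_j such that for each j: (i) there is a map Φ_j : R_j → ℝ^{n_j} which is bi-Lipschitz onto its image, and (ii) the restricted measure m⌞R_j is absolutely continuous with respect to the n_j-dimensional Hausdorff measure H^{n_j} on X. In other words, X is rectifiable as a metric measure space. -/

import Mathlib

open MeasureTheory Filter Set Metric Real
open scoped RealInnerProductSpace ENNReal Topology

noncomputable section

/-- A map is bi-Lipschitz onto its image on `E`: there is `L ≥ 1` with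
`L⁻¹ d(x,y) ≤ d(F x, F y) ≤ L d(x,y)` for all `x, y ∈ E`. -/
def BiLipschitzOn {X Y : Type*} [MetricSpace X] [MetricSpace Y]
    (F : X → Y) (E : Set X) : Prop :=
  ∃ L : ℝ, 1 ≤ L ∧ ∀ x ∈ E, ∀ y ∈ E,
    L⁻¹ * dist x y ≤ dist (F x) (F y) ∧ dist (F x) (F y) ≤ L * dist x y

/-- `f` is Lipschitz on the set `S` (with some constant). -/
def IsLipschitzOn {X Y : Type*} [MetricSpace X] [MetricSpace Y]
    (f : X → Y) (S : Set X) : Prop :=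
  ∃ K : NNReal, LipschitzOnWith K f S

/-- `df` is the (Cheeger/Lipschitz) differential of `f` at `x` with respect to the chart map
`φ`, relative to the ambient set `S`:
`lim_{y → x, y ∈ S} |f y - f x - df ⬝ (φ y - φ x)| / d(y,x) = 0`. -/
def HasChartDerivAt {X : Type*} [MetricSpace X] (S : Set X) {n : ℕ}
    (φ : X → EuclideanSpace ℝ (Fin n)) (f : X → ℝ) (x : X)
    (df : EuclideanSpace ℝ (Fin n)) : Prop :=
  Tendsto (fun y => |f y - f x - ⟪df, φ y - φ x⟫| / dist y x)
    (𝓝[S \ {x}] x) (𝓝 0)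

/-- The data `(U i, φ i)` (with dimensions `n i`) is a Lipschitz-differentiability chart
structure for the metric measure space `(S, d, m)`. -/
structure LDSCharts {X : Type*} [MetricSpace X] [MeasurableSpace X]
    (m : Measure X) (S : Set X) (n : ℕ → ℕ) (U : ℕ → Set X)
    (φ : ∀ i, X → EuclideanSpace ℝ (Fin (n i))) : Prop where
  subset : ∀ i, U i ⊆ S
  borel : ∀ i, MeasurableSet (U i)
  pos : ∀ i, 0 < m (U i)
  dimpos : ∀ i, 0 < n i
  cover : m (S \ ⋃ i, U i) = 0
  lip : ∀ i, IsLipschitzOn (φ i) (U i)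
  diff : ∀ f : X → ℝ, IsLipschitzOn f S → ∀ i,
    ∀ᵐ x ∂(m.restrict (U i)), ∃! df, HasChartDerivAt S (φ i) f x df

/-- `(S, d, m)` is a Lipschitz differentiability space. -/
def IsLDS {X : Type*} [MetricSpace X] [MeasurableSpace X]
    (m : Measure X) (S : Set X) : Prop :=
  ∃ (n : ℕ → ℕ) (U : ℕ → Set X) (φ : ∀ i, X → EuclideanSpace ℝ (Fin (n i))),
    LDSCharts m S n U φ

/-- `(X, d, m)` is locally bi-Lipschitz embeddable into Euclidean spaces. -/
def LocEuclEmbeddable {X : Type*} [MetricSpace X] [MeasurableSpace X]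
    (m : Measure X) : Prop :=
  ∃ (N : ℕ → ℕ) (E : ℕ → Set X) (F : ∀ k, X → EuclideanSpace ℝ (Fin (N k))),
    (∀ k, MeasurableSet (E k)) ∧ m (Set.univ \ ⋃ k, E k) = 0 ∧
    ∀ k, BiLipschitzOn (F k) (E k)

/-- The closed cone of width `θ` around the linear subspace `V`:
the union of the cones `C(w, θ) = {v | v ⬝ w ≥ cos θ ‖v‖}` over unit vectors `w ∈ V`. -/
def cone {N : ℕ} (V : Submodule ℝ (EuclideanSpace ℝ (Fin N))) (θ : ℝ) :
    Set (EuclideanSpace ℝ (Fin N)) :=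
  {v | ∃ w ∈ V, ‖w‖ = 1 ∧ Real.cos θ * ‖v‖ ≤ ⟪w, v⟫}

/-- The (topological) support of a measure: the set of points all of whose open
neighbourhoods have positive measure. -/
def msupport {X : Type*} [TopologicalSpace X] [MeasurableSpace X]
    (μ : Measure X) : Set X :=
  {x | ∀ U : Set X, IsOpen U → x ∈ U → 0 < μ U}


/-- Finite transport problem: optimality. -/
theorem c1_transport {E : Type*} [NormedAddCommGroup E] [InnerProductSpace ℝ E]
    {ι κ : Type*} [Fintype ι] [Fintype κ] [DecidableEq ι] [DecidableEq κ]
    (z : ι → E) (m : ι → ℝ) (hm : ∀ i, 0 < m i) (p : κ → E) (w : κ → ℝ) (hw : ∀ k, 0 ≤ w k)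
    (hmw : ∑ i, m i ≤ ∑ k, w k) :
    ∃ l : ι → κ → ℝ, (∀ i k, 0 ≤ l i k) ∧ (∀ i, ∑ k, l i k = 1) ∧
      (∀ k, ∑ i, m i * l i k ≤ w k) ∧
      ∀ i i' k k', 0 < l i k → 0 < l i' k' →
        0 ≤ ⟪(z i - ∑ b, l i b • p b) - (z i' - ∑ b, l i' b • p b), p k - p k'⟫ := by
  classical
  set K : Set (ι → κ → ℝ) := {l | (∀ i k, 0 ≤ l i k) ∧ (∀ i, ∑ k, l i k = 1) ∧
      (∀ k, ∑ i, m i * l i k ≤ w k)} with hK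
  have hKc : IsCompact K := by
    have hsub : K ⊆ Set.pi Set.univ (fun _ : ι => Set.pi Set.univ (fun _ : κ => Set.Icc (0:ℝ) 1)) := by
      rintro l ⟨h0, h1, -⟩ i - k -
      refine ⟨h0 i k, ?_⟩
      rw [← h1 i]
      exact Finset.single_le_sum (fun k _ => h0 i k) (Finset.mem_univ k)
    refine IsCompact.of_isClosed_subset
      (isCompact_univ_pi fun _ => isCompact_univ_pi fun _ => isCompact_Icc) ?_ hsub
    have : K = (⋂ i, ⋂ k, {l | 0 ≤ l i k}) ∩ (⋂ i, {l | ∑ k, l i k = 1}) ∩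
        (⋂ k, {l | ∑ i, m i * l i k ≤ w k}) := by
      ext l; simp [hK, and_assoc]
    rw [this]
    refine ((isClosed_iInter fun i => isClosed_iInter fun k => ?_).inter
      (isClosed_iInter fun i => ?_)).inter (isClosed_iInter fun k => ?_)
    · exact isClosed_le (by fun_prop) (by fun_prop)
    · exact isClosed_eq (by fun_prop) (by fun_prop)
    · exact isClosed_le (by fun_prop) (by fun_prop)
  have hKne : K.Nonempty := by
    refine ⟨fun _ k => w k / ∑ k, w k, fun i k => by
      have := Finset.sum_nonneg (fun k (_ : k ∈ Finset.univ) => hw k); have := hw k; positivity, fun i => ?_, fun k => ?_⟩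
    · rw [← Finset.sum_div]
      refine div_self (ne_of_gt (lt_of_lt_of_le ?_ hmw))
      exact Finset.sum_pos (fun i _ => hm i) ⟨i, Finset.mem_univ i⟩
    · rw [← Finset.sum_mul]
      have h0 := Finset.sum_nonneg (fun k (_ : k ∈ Finset.univ) => hw k)
      rcases h0.eq_or_lt with h | h
      · rw [← h]; simpa using hw k
      · rw [mul_div_assoc', div_le_iff₀ h, mul_comm]
        exact mul_le_mul_of_nonneg_left hmw (hw k)
  obtain ⟨l, hlK, hmin⟩ := hKc.exists_isMinOn hKne
    (f := fun l => ∑ i, m i * ‖z i - ∑ b, l i b • p b‖ ^ 2) (by fun_prop)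
  refine ⟨l, hlK.1, hlK.2.1, hlK.2.2, ?_⟩
  intro i i' k k' hik hik'
  by_cases hii : i = i'
  · subst hii; simp
  by_cases hkk : k = k'
  · subst hkk; simp
  set y : ι → E := fun i => z i - ∑ b, l i b • p b with hy
  set q := p k - p k' with hq
  set u : ι → ℝ := fun a => (if a = i then 1 / m i else 0) - (if a = i' then 1 / m i' else 0) with hu
  set v : κ → ℝ := fun b => (if b = k' then 1 else 0) - (if b = k then 1 else 0) with hv
  have hvsum : ∑ b, v b = 0 := by simp [hv, Finset.sum_sub_distrib]
  have hvp : ∑ b, v b • p b = -q := by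
    simp [hv, sub_smul, Finset.sum_sub_distrib, hq]
  have husum : ∑ a, m a * u a = 0 := by
    simp [hu, mul_sub, Finset.sum_sub_distrib, (hm i).ne', (hm i').ne']
  have huy : ∑ a, m a * u a * ⟪y a, q⟫ = ⟪y i - y i', q⟫ := by
    have : ∀ a, m a * u a * ⟪y a, q⟫ = (if a = i then ⟪y i, q⟫ else 0) - (if a = i' then ⟪y i', q⟫ else 0) := by
      intro a
      simp only [hu]
      by_cases h1 : a = i
      · subst h1; simp [hii, (hm a).ne']
      · by_cases h2 : a = i'
        · subst h2; simp [h1, (hm a).ne']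
        · simp [h1, h2]
    simp [this, Finset.sum_sub_distrib, inner_sub_left]
  set t0 := min (l i k * m i) (l i' k' * m i') with ht0
  have ht0pos : 0 < t0 := lt_min (mul_pos hik (hm i)) (mul_pos hik' (hm i'))
  have key : ∀ t : ℝ, 0 < t → t ≤ t0 → 0 ≤ 2 * t * ⟪y i - y i', q⟫ +
      t ^ 2 * ∑ a, m a * u a ^ 2 * ‖q‖ ^ 2 := by
    intro t ht htt
    have hmem : (fun a b => l a b + t * (u a * v b)) ∈ K := by
      refine ⟨fun a b => ?_, fun a => ?_, fun b => ?_⟩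
      · have hl := hlK.1 a b
        have e1 : t / m i ≤ l i k := by
          rw [div_le_iff₀ (hm i)]; exact htt.trans (min_le_left _ _)
        have e2 : t / m i' ≤ l i' k' := by
          rw [div_le_iff₀ (hm i')]; exact htt.trans (min_le_right _ _)
        have p1 : 0 ≤ t / m i := by have := hm i; positivity
        have p2 : 0 ≤ t / m i' := by have := hm i'; positivity
        simp only [hu, hv]
        have q1 : t * (1 / m i) = t / m i := by ring
        have q2 : t * (1 / m i') = t / m i' := by ring
        by_cases h1 : a = i
        · subst h1
          have hii' : ¬ (a = i') := hii
          by_cases h3 : b = k'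
          · subst h3
            have hkk' : ¬ (b = k) := fun h => hkk h.symm
            simp only [hii', hkk', if_true, if_false]; nlinarith
          · by_cases h4 : b = k
            · subst h4; simp only [hii', h3, if_true, if_false]; nlinarith
            · simp only [h3, h4, if_false]; nlinarith
        · by_cases h2 : a = i'
          · subst h2
            by_cases h3 : b = k'
            · subst h3
              have hkk' : ¬ (b = k) := fun h => hkk h.symm
              simp only [h1, hkk', if_true, if_false]; nlinarith
            · by_cases h4 : b = k
              · subst h4; simp only [h1, h3, if_true, if_false]; nlinarith
              · simp only [h3, h4, if_false]; nlinarith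
          · simp only [h1, h2, if_false]; nlinarith
      · rw [Finset.sum_add_distrib, hlK.2.1 a, ← Finset.mul_sum, ← Finset.mul_sum, hvsum]; ring
      · have : ∑ a, m a * (l a b + t * (u a * v b)) = ∑ a, m a * l a b + t * v b * ∑ a, m a * u a := by
          rw [Finset.mul_sum, ← Finset.sum_add_distrib]
          refine Finset.sum_congr rfl fun a _ => by ring
        rw [this, husum]; simpa using hlK.2.2 b
    have hle := hmin hmem
    simp only [Set.mem_ofPred_eq] at hle
    have hP : ∀ a, z a - ∑ b, (l a b + t * (u a * v b)) • p b = y a + (t * u a) • q := by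
      intro a
      have : ∑ b, (l a b + t * (u a * v b)) • p b = ∑ b, l a b • p b + (t * u a) • ∑ b, v b • p b := by
        rw [Finset.smul_sum, ← Finset.sum_add_distrib]
        refine Finset.sum_congr rfl fun b _ => ?_
        rw [add_smul, smul_smul]; ring_nf
      rw [this, hvp, smul_neg]
      change _ = (z a - ∑ b, l a b • p b) + _
      abel
    simp only [hP] at hle
    have hexp : ∑ a, m a * ‖y a + (t * u a) • q‖ ^ 2 = ∑ a, m a * ‖y a‖ ^ 2 +
        (2 * t * ∑ a, m a * u a * ⟪y a, q⟫ + t ^ 2 * ∑ a, m a * u a ^ 2 * ‖q‖ ^ 2) := by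
      rw [Finset.mul_sum, Finset.mul_sum, ← Finset.sum_add_distrib, ← Finset.sum_add_distrib]
      refine Finset.sum_congr rfl fun a _ => ?_
      rw [norm_add_sq_real, inner_smul_right, norm_smul, mul_pow, Real.norm_eq_abs, sq_abs]; ring
    rw [hexp, huy] at hle
    change ∑ a, m a * ‖y a‖ ^ 2 ≤ _ at hle
    linarith
  by_contra hneg
  push Not at hneg
  set S := ∑ a, m a * u a ^ 2 * ‖q‖ ^ 2 with hS
  have hS0 : 0 ≤ S := Finset.sum_nonneg fun a _ => by have := hm a; positivity
  set d := ⟪y i - y i', q⟫ with hd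
  set t := min t0 (-d / (S + 1)) with htdef
  have htpos : 0 < t := lt_min ht0pos (div_pos (by linarith) (by linarith))
  have h := key t htpos (min_le_left _ _)
  have ht2 : t * (S + 1) ≤ -d := by
    rw [← le_div_iff₀ (by linarith)]; exact min_le_right _ _
  nlinarith [mul_pos htpos htpos]


theorem c1_avg {E : Type*} [NormedAddCommGroup E] [InnerProductSpace ℝ E]
    {κ : Type*} [Fintype κ] (p : κ → E) (l l' : κ → ℝ)
    (h0 : ∀ k, 0 ≤ l k) (h0' : ∀ k, 0 ≤ l' k) (h1 : ∑ k, l k = 1) (h1' : ∑ k, l' k = 1) (u : E)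
    (h : ∀ k k', 0 < l k → 0 < l' k' → 0 ≤ ⟪u, p k - p k'⟫) :
    (∀ k, 0 < l k → 0 ≤ ⟪u, p k - ∑ b, l' b • p b⟫) ∧
      0 ≤ ⟪u, ∑ b, l b • p b - ∑ b, l' b • p b⟫ := by
  have A : ∀ k, 0 < l k → 0 ≤ ⟪u, p k - ∑ b, l' b • p b⟫ := by
    intro k hk
    have e : p k - ∑ b, l' b • p b = ∑ b, l' b • (p k - p b) := by
      simp_rw [smul_sub, Finset.sum_sub_distrib, ← Finset.sum_smul, h1', one_smul]
    rw [e, inner_sum]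
    refine Finset.sum_nonneg fun b _ => ?_
    rw [inner_smul_right]
    rcases (h0' b).eq_or_lt with hb | hb
    · rw [← hb]; simp
    · exact mul_nonneg (h0' b) (h k b hk hb)
  refine ⟨A, ?_⟩
  have e : ∑ b, l b • p b - ∑ b, l' b • p b = ∑ k, l k • (p k - ∑ b, l' b • p b) := by
    simp_rw [smul_sub, Finset.sum_sub_distrib, ← Finset.sum_smul, h1, one_smul]
  rw [e, inner_sum]
  refine Finset.sum_nonneg fun b _ => ?_
  rw [inner_smul_right]
  rcases (h0 b).eq_or_lt with hb | hb
  · rw [← hb]; simp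
  · exact mul_nonneg (h0 b) (A b hb)

/-- The constant `1/(16 n²)`. -/
def cc (n : ℕ) : ℝ := (1 / (4 * (n : ℝ))) ^ 2

theorem norm_le_sum_abs_inner {n : ℕ} (q : EuclideanSpace ℝ (Fin n)) :
    ‖q‖ ≤ ∑ i, |⟪EuclideanSpace.single i (1:ℝ), q⟫| := by
  have : q = ∑ i, q i • EuclideanSpace.single i (1:ℝ) := by
    ext j
    simp [Finset.sum_apply, Pi.single_apply]
  calc ‖q‖ = ‖∑ i, q i • EuclideanSpace.single i (1:ℝ)‖ := by rw [← this]
    _ ≤ ∑ i, ‖q i • EuclideanSpace.single i (1:ℝ)‖ := norm_sum_le _ _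
    _ = _ := by
      refine Finset.sum_congr rfl fun i _ => ?_
      simp [norm_smul, EuclideanSpace.inner_single_left]

theorem c2_local {n : ℕ} (hn : 0 < n) {κ : Type*} [Fintype κ] (p : κ → EuclideanSpace ℝ (Fin n))
    (l : κ → ℝ) (h0 : ∀ k, 0 ≤ l k) (h1 : ∑ k, l k = 1) (h4 : ∀ k, l k ≤ 1 / 4)
    (δ : ℝ) (hδ : 0 < δ) (hsep : ∀ k k', k ≠ k' → δ ≤ ‖p k - p k'‖)
    (Δ : Fin n → EuclideanSpace ℝ (Fin n))
    (hF : ∀ i, ‖Δ i‖ ^ 2 ≤ δ * ⟪Δ i, EuclideanSpace.single i (1:ℝ)⟫)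
    (hk : ∀ i k, 0 < l k → 0 ≤ ⟪Δ i - δ • EuclideanSpace.single i (1:ℝ),
      p k - ∑ b, l b • p b - Δ i⟫) :
    cc n * δ ≤ ∑ i, ⟪Δ i, EuclideanSpace.single i (1:ℝ)⟫ := by
  classical
  by_contra hcon
  push Not at hcon
  have hn' : (0:ℝ) < n := by exact_mod_cast hn
  set a : ℝ := 1 / (4 * (n:ℝ)) with ha
  have ha0 : 0 < a := by positivity
  have hna : n * a = 1 / 4 := by rw [ha]; field_simp
  have hcc : cc n = a ^ 2 := rfl
  rw [hcc] at hcon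
  set e : Fin n → EuclideanSpace ℝ (Fin n) := fun i => EuclideanSpace.single i (1:ℝ) with he
  set q : κ → EuclideanSpace ℝ (Fin n) := fun k => p k - ∑ b, l b • p b with hq
  have hqmean : ∑ k, l k • q k = 0 := by
    simp_rw [hq, smul_sub, Finset.sum_sub_distrib, ← Finset.sum_smul, h1, one_smul, sub_self]
  have hpos : ∀ i, 0 ≤ ⟪Δ i, e i⟫ := by
    intro i
    have := hF i
    have h2 : 0 ≤ δ * ⟪Δ i, e i⟫ := le_trans (by positivity) this
    exact nonneg_of_mul_nonneg_right h2 hδ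
  have hsm : ∀ i, ⟪Δ i, e i⟫ ≤ a ^ 2 * δ := by
    intro i
    refine le_trans ?_ hcon.le
    exact Finset.single_le_sum (f := fun i => ⟪Δ i, e i⟫) (fun i _ => hpos i) (Finset.mem_univ i)
  have hΔ : ∀ i, ‖Δ i‖ ≤ a * δ := by
    intro i
    have := hF i
    have h3 := hsm i
    refine abs_le_of_sq_le_sq' ?_ (by positivity) |>.2
    have : δ * ⟪Δ i, e i⟫ ≤ δ * (a ^ 2 * δ) := by gcongr
    have h5 := hF i
    change ‖Δ i‖ ^ 2 ≤ δ * ⟪Δ i, e i⟫ at h5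
    nlinarith
  set h : Fin n → κ → ℝ := fun i k => ⟪δ • e i - Δ i, q k⟫ with hh
  have hub : ∀ i k, 0 < l k → h i k ≤ a ^ 2 * δ ^ 2 := by
    intro i k hl
    have h5 := hk i k hl
    have e1 : Δ i - δ • EuclideanSpace.single i (1:ℝ) = -(δ • e i - Δ i) := by simp [he]
    have e2 : p k - ∑ b, l b • p b - Δ i = q k - Δ i := rfl
    rw [e1, e2, inner_neg_left, inner_sub_right] at h5
    have h6 : ⟪δ • e i - Δ i, Δ i⟫ ≤ δ * (a ^ 2 * δ) := by
      rw [inner_sub_left, real_inner_smul_left, real_inner_self_eq_norm_sq, real_inner_comm]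
      have : δ * ⟪Δ i, e i⟫ ≤ δ * (a ^ 2 * δ) := by gcongr; exact hsm i
      nlinarith [sq_nonneg ‖Δ i‖]
    simp only [hh]
    nlinarith
  have hmean : ∀ i, ∑ k, l k * h i k = 0 := by
    intro i
    have : ∑ k, l k * h i k = ⟪δ • e i - Δ i, ∑ k, l k • q k⟫ := by
      rw [inner_sum]; refine Finset.sum_congr rfl fun k _ => ?_
      rw [inner_smul_right]
    rw [this, hqmean, inner_zero_right]
  have habs : ∀ i, ∑ k, l k * |h i k| ≤ 2 * (a ^ 2 * δ ^ 2) := by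
    intro i
    calc ∑ k, l k * |h i k| ≤ ∑ k, (l k * (2 * (a ^ 2 * δ ^ 2)) - l k * h i k) := by
          refine Finset.sum_le_sum fun k _ => ?_
          rw [← mul_sub]
          rcases (h0 k).eq_or_lt with hb | hb
          · rw [← hb]; simp
          · have h7 := hub i k hb
            have : 0 ≤ a ^ 2 * δ ^ 2 := by positivity
            refine mul_le_mul_of_nonneg_left ?_ (h0 k)
            rw [abs_le]; constructor <;> linarith
      _ = _ := by
          rw [Finset.sum_sub_distrib, hmean, ← Finset.sum_mul, h1]; ring
  have hqk : ∀ k, 3 / 4 * (δ * ‖q k‖) ≤ ∑ i, |h i k| := by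
    intro k
    have h8 := norm_le_sum_abs_inner (q k)
    have h9 : ∀ i, δ * |⟪e i, q k⟫| ≤ |h i k| + a * δ * ‖q k‖ := by
      intro i
      have e3 : δ * ⟪e i, q k⟫ = h i k + ⟪Δ i, q k⟫ := by
        simp only [hh]; rw [inner_sub_left, real_inner_smul_left]; ring
      have e4 : δ * |⟪e i, q k⟫| = |h i k + ⟪Δ i, q k⟫| := by
        rw [← e3, abs_mul, abs_of_pos hδ]
      rw [e4]
      refine (abs_add_le _ _).trans ?_
      gcongr
      exact (abs_real_inner_le_norm _ _).trans (by gcongr; exact hΔ i)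
    have h10 : δ * ‖q k‖ ≤ ∑ i, |h i k| + n * (a * δ * ‖q k‖) := by
      calc δ * ‖q k‖ ≤ δ * ∑ i, |⟪e i, q k⟫| := by gcongr
        _ = ∑ i, δ * |⟪e i, q k⟫| := Finset.mul_sum _ _ _
        _ ≤ ∑ i, (|h i k| + a * δ * ‖q k‖) := Finset.sum_le_sum fun i _ => h9 i
        _ = _ := by rw [Finset.sum_add_distrib]; simp
    have : n * (a * δ * ‖q k‖) = 1 / 4 * (δ * ‖q k‖) := by rw [← hna]; ring
    linarith
  have hE : 3 / 4 * δ * ∑ k, l k * ‖q k‖ ≤ n * (2 * (a ^ 2 * δ ^ 2)) := by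
    calc 3 / 4 * δ * ∑ k, l k * ‖q k‖ = ∑ k, l k * (3 / 4 * (δ * ‖q k‖)) := by
          rw [Finset.mul_sum]; exact Finset.sum_congr rfl fun k _ => by ring
      _ ≤ ∑ k, l k * ∑ i, |h i k| := Finset.sum_le_sum fun k _ => mul_le_mul_of_nonneg_left (hqk k) (h0 k)
      _ = ∑ i, ∑ k, l k * |h i k| := by
          simp_rw [Finset.mul_sum]; exact Finset.sum_comm
      _ ≤ ∑ i : Fin n, 2 * (a ^ 2 * δ ^ 2) := Finset.sum_le_sum fun i _ => habs i
      _ = _ := by simp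
  have hlow : δ / 2 * (3 / 4) ≤ ∑ k, l k * ‖q k‖ := by
    by_cases hex : ∃ k0, ‖q k0‖ < δ / 2
    · obtain ⟨k0, hk0⟩ := hex
      have hoth : ∀ k, k ≠ k0 → δ / 2 ≤ ‖q k‖ := by
        intro k hne
        have s := hsep k k0 hne
        have : p k - p k0 = q k - q k0 := by simp [hq]
        rw [this] at s
        have := norm_sub_le (q k) (q k0)
        linarith
      have hsplit : ∑ k, l k = l k0 + ∑ k ∈ Finset.univ.erase k0, l k :=
        (Finset.add_sum_erase _ _ (Finset.mem_univ k0)).symm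
      have hsplit2 : ∑ k, l k * ‖q k‖ = l k0 * ‖q k0‖ + ∑ k ∈ Finset.univ.erase k0, l k * ‖q k‖ :=
        (Finset.add_sum_erase _ (fun k => l k * ‖q k‖) (Finset.mem_univ k0)).symm
      have : (∑ k ∈ Finset.univ.erase k0, l k) * (δ / 2) ≤ ∑ k ∈ Finset.univ.erase k0, l k * ‖q k‖ := by
        rw [Finset.sum_mul]
        refine Finset.sum_le_sum fun k hk => mul_le_mul_of_nonneg_left (hoth k ?_) (h0 k)
        exact Finset.ne_of_mem_erase hk
      have h11 := h4 k0
      have h12 : 0 ≤ l k0 * ‖q k0‖ := mul_nonneg (h0 k0) (norm_nonneg _)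
      have h13 : 3 / 4 ≤ ∑ k ∈ Finset.univ.erase k0, l k := by rw [h1] at hsplit; linarith
      nlinarith
    · push Not at hex
      have : ∑ k, l k * (δ / 2) ≤ ∑ k, l k * ‖q k‖ :=
        Finset.sum_le_sum fun k _ => mul_le_mul_of_nonneg_left (hex k) (h0 k)
      rw [← Finset.sum_mul, h1] at this
      linarith
  have ha4 : a ≤ 1 / 4 := by
    rw [ha]; apply one_div_le_one_div_of_le (by norm_num)
    have : (1:ℝ) ≤ n := by exact_mod_cast hn
    linarith
  have e5 : n * (2 * (a ^ 2 * δ ^ 2)) = 1 / 2 * (a * δ ^ 2) := by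
    calc n * (2 * (a ^ 2 * δ ^ 2)) = (n * a) * (2 * (a * δ ^ 2)) := by ring
      _ = _ := by rw [hna]; ring
  have h14 : 3 / 4 * δ * (δ / 2 * (3 / 4)) ≤ 3 / 4 * δ * ∑ k, l k * ‖q k‖ := by gcongr
  have h15 : a * δ ^ 2 ≤ 1 / 4 * δ ^ 2 := by gcongr
  nlinarith [sq_pos_of_pos hδ]


/-- cast an integer vector to Euclidean space -/
def toE {n : ℕ} (a : Fin n → ℤ) : EuclideanSpace ℝ (Fin n) := WithLp.toLp 2 (fun i => (a i : ℝ))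

theorem abs_coord_le {n : ℕ} (x : EuclideanSpace ℝ (Fin n)) (i : Fin n) : |x i| ≤ ‖x‖ := by
  simpa using PiLp.norm_apply_le x i

theorem norm_le_sqrt_mul {n : ℕ} (x : EuclideanSpace ℝ (Fin n)) (c : ℝ) (hc : 0 ≤ c)
    (h : ∀ i, |x i| ≤ c) : ‖x‖ ≤ √n * c := by
  rw [EuclideanSpace.norm_eq]
  have : √n * c = √(n * c ^ 2) := by
    rw [Real.sqrt_mul (by positivity), Real.sqrt_sq hc]
  rw [this]
  apply Real.sqrt_le_sqrt
  calc ∑ i, ‖x i‖ ^ 2 ≤ ∑ _i : Fin n, c ^ 2 := by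
        refine Finset.sum_le_sum fun i _ => ?_
        rw [Real.norm_eq_abs]
        exact pow_le_pow_left₀ (abs_nonneg _) (h i) 2
    _ = _ := by simp

theorem c3_discrete {n : ℕ} (hn : 0 < n) (Z H : Finset (Fin n → ℤ)) (hHZ : H ⊆ Z) (j : ℕ)
    (hcard : 4 * H.card < j ^ n) (δ : ℝ) (hδ : 0 < δ) :
    ∃ G : (Fin n → ℤ) → EuclideanSpace ℝ (Fin n), (∀ a, ‖G a‖ ≤ √n * (δ * j)) ∧
      (∀ a ∈ Z, ∀ a' ∈ Z, ‖G a - G a'‖ ^ 2 ≤ ⟪G a - G a', δ • toE a - δ • toE a'⟫) ∧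
      (∀ a ∈ H, (∀ i, a + Pi.single i 1 ∈ Z) → cc n * δ ≤
        ∑ i, ⟪G (a + Pi.single i 1) - G a, EuclideanSpace.single i (1:ℝ)⟫) := by
  classical
  have hc : (4:ℝ) * H.card < (j:ℝ) ^ n := by exact_mod_cast hcard
  set θ : ℝ := ((j:ℝ) ^ n / 4 - H.card) / (Z.card + 1) with hθ
  have hθ0 : 0 < θ := div_pos (by linarith) (by positivity)
  set m : Z → ℝ := fun a => if (a : Fin n → ℤ) ∈ H then 1 else θ with hm
  have hm0 : ∀ a, 0 < m a := by
    intro a; simp only [hm]; split_ifs <;> [norm_num; exact hθ0]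
  set p : (Fin n → Fin j) → EuclideanSpace ℝ (Fin n) := fun b => δ • toE (fun i => ((b i : ℕ) : ℤ)) with hp
  have hsum : ∑ a, m a ≤ ∑ _b : (Fin n → Fin j), (1/4 : ℝ) := by
    have e1 : ∑ a, m a = ∑ a ∈ Z, (if a ∈ H then (1:ℝ) else θ) :=
      Finset.sum_coe_sort Z (fun a => if a ∈ H then (1:ℝ) else θ)
    have e2 : ∑ a ∈ Z, (if a ∈ H then (1:ℝ) else θ) ≤ ∑ a ∈ Z, ((if a ∈ H then (1:ℝ) else 0) + θ) := by
      refine Finset.sum_le_sum fun a _ => ?_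
      split_ifs <;> linarith
    have e3 : ∑ a ∈ Z, ((if a ∈ H then (1:ℝ) else 0) + θ) = H.card + Z.card * θ := by
      rw [Finset.sum_add_distrib, Finset.sum_ite_mem, Finset.inter_eq_right.2 hHZ]
      simp
    have e4 : Z.card * θ ≤ (j:ℝ) ^ n / 4 - H.card := by
      have : θ * (Z.card + 1) = (j:ℝ) ^ n / 4 - H.card := by
        rw [hθ]; field_simp
      nlinarith
    have e5 : ∑ _b : (Fin n → Fin j), (1/4 : ℝ) = (j:ℝ) ^ n / 4 := by
      simp; ring
    rw [e1, e5]; linarith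
  obtain ⟨l, hl0, hl1, hlw, hopt⟩ := c1_transport (fun a : Z => δ • toE (a : Fin n → ℤ)) m hm0 p
    (fun _ => 1/4) (fun _ => by norm_num) hsum
  set P : Z → EuclideanSpace ℝ (Fin n) := fun a => ∑ b, l a b • p b with hP
  have havg := fun a a' : Z => c1_avg p (l a) (l a') (hl0 a) (hl0 a') (hl1 a) (hl1 a')
    ((δ • toE (a : Fin n → ℤ) - P a) - (δ • toE (a' : Fin n → ℤ) - P a')) (fun k k' => hopt a a' k k')
  have hpn : ∀ b, ‖p b‖ ≤ √n * (δ * j) := by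
    intro b
    refine norm_le_sqrt_mul _ _ (by positivity) fun i => ?_
    have : p b i = δ * ((b i : ℕ) : ℝ) := by simp [hp, toE]
    rw [this, abs_of_nonneg (by positivity)]
    gcongr
    exact (b i).2.le
  have hPn : ∀ a, ‖P a‖ ≤ √n * (δ * j) := by
    intro a
    calc ‖P a‖ ≤ ∑ b, ‖l a b • p b‖ := norm_sum_le _ _
      _ ≤ ∑ b, l a b * (√n * (δ * j)) := by
          refine Finset.sum_le_sum fun b _ => ?_
          rw [norm_smul, Real.norm_eq_abs, abs_of_nonneg (hl0 a b)]
          exact mul_le_mul_of_nonneg_left (hpn b) (hl0 a b)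
      _ = _ := by rw [← Finset.sum_mul, hl1, one_mul]
  have hFNE : ∀ a a' : Z, ‖P a - P a'‖ ^ 2 ≤ ⟪P a - P a', δ • toE (a : Fin n → ℤ) - δ • toE (a' : Fin n → ℤ)⟫ := by
    intro a a'
    have h := (havg a a').2
    change 0 ≤ ⟪(δ • toE (a : Fin n → ℤ) - P a) - (δ • toE (a' : Fin n → ℤ) - P a'), P a - P a'⟫ at h
    have e : (δ • toE (a : Fin n → ℤ) - P a) - (δ • toE (a' : Fin n → ℤ) - P a') =
      (δ • toE (a : Fin n → ℤ) - δ • toE (a' : Fin n → ℤ)) - (P a - P a') := by abel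
    rw [e, inner_sub_left, real_inner_self_eq_norm_sq, real_inner_comm] at h
    linarith
  refine ⟨fun a => if h : a ∈ Z then P ⟨a, h⟩ else 0, ?_, ?_, ?_⟩
  · intro a
    dsimp only
    split_ifs with h
    · exact hPn _
    · rw [norm_zero]; positivity
  · intro a ha a' ha'
    simp only [ha, ha', dif_pos]
    exact hFNE ⟨a, ha⟩ ⟨a', ha'⟩
  · intro a haH hai
    have ha := hHZ haH
    simp only [ha, hai, dif_pos]
    have hdiff : ∀ i, δ • toE (a + Pi.single i 1) - δ • toE a = δ • EuclideanSpace.single i (1:ℝ) := by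
      intro i
      rw [← smul_sub]; congr 1
      ext k
      by_cases hk : k = i
      · subst hk; simp [toE]
      · simp [toE, hk]
    refine c2_local hn p (l ⟨a, ha⟩) (hl0 _) (hl1 _) ?_ δ hδ ?_
      (fun i => P ⟨a + Pi.single i 1, hai i⟩ - P ⟨a, ha⟩) ?_ ?_
    · intro k
      have h1 := hlw k
      have h2 : m ⟨a, ha⟩ * l ⟨a, ha⟩ k ≤ ∑ i, m i * l i k :=
        Finset.single_le_sum (f := fun i => m i * l i k)
          (fun i _ => mul_nonneg (hm0 i).le (hl0 i k)) (Finset.mem_univ _)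
      have h3 : m ⟨a, ha⟩ = 1 := by simp [hm, haH]
      rw [h3, one_mul] at h2
      linarith
    · intro k k' hkk
      obtain ⟨i, hi⟩ : ∃ i, k i ≠ k' i := by
        by_contra hcon; push Not at hcon; exact hkk (funext hcon)
      have h1 := abs_coord_le (p k - p k') i
      refine le_trans ?_ h1
      have h2 : (p k - p k') i = δ * (((k i : ℕ) : ℤ) - ((k' i : ℕ) : ℤ) : ℤ) := by
        simp [hp, toE]; ring
      rw [h2, abs_mul, abs_of_pos hδ]
      have h3 : (1:ℤ) ≤ |((k i : ℕ) : ℤ) - ((k' i : ℕ) : ℤ)| := by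
        apply Int.one_le_abs
        intro h
        apply hi
        ext
        omega
      have h4 : (1:ℝ) ≤ |((((k i : ℕ) : ℤ) - ((k' i : ℕ) : ℤ) : ℤ) : ℝ)| := by exact_mod_cast h3
      nlinarith
    · intro i
      have h := hFNE ⟨a + Pi.single i 1, hai i⟩ ⟨a, ha⟩
      simp only [hdiff, inner_smul_right] at h
      exact h
    · intro i k hk
      have h := (havg ⟨a, ha⟩ ⟨a + Pi.single i 1, hai i⟩).1 k hk
      change 0 ≤ ⟪(δ • toE a - P ⟨a, ha⟩) - (δ • toE (a + Pi.single i 1) - P ⟨a + Pi.single i 1, hai i⟩),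
        p k - P ⟨a + Pi.single i 1, hai i⟩⟫ at h
      change 0 ≤ ⟪P ⟨a + Pi.single i 1, hai i⟩ - P ⟨a, ha⟩ - δ • EuclideanSpace.single i (1:ℝ),
        p k - P ⟨a, ha⟩ - (P ⟨a + Pi.single i 1, hai i⟩ - P ⟨a, ha⟩)⟫
      rw [← hdiff i]
      convert h using 2 <;> abel


/-- coordinatewise floor at scale `δ` -/
def fl {n : ℕ} (δ : ℝ) (x : EuclideanSpace ℝ (Fin n)) : Fin n → ℤ := fun i => ⌊x i / δ⌋

theorem fl_meas {n : ℕ} (δ : ℝ) : Measurable (fl δ : EuclideanSpace ℝ (Fin n) → Fin n → ℤ) := by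
  refine measurable_pi_lambda _ fun i => ?_
  refine Int.measurable_floor.comp ?_
  refine Measurable.div_const ?_ _
  exact (by fun_prop : Continuous fun x : EuclideanSpace ℝ (Fin n) => x i).measurable

theorem fl_near {n : ℕ} (δ : ℝ) (hδ : 0 < δ) (x y : EuclideanSpace ℝ (Fin n)) (h : fl δ x = fl δ y) :
    ‖x - y‖ ≤ √n * δ := by
  refine norm_le_sqrt_mul _ _ hδ.le fun i => ?_
  have h1 := congrFun h i
  simp only [fl] at h1
  have h2 := Int.floor_le (x i / δ)
  have h3 := Int.lt_floor_add_one (x i / δ)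
  have h4 := Int.floor_le (y i / δ)
  have h5 := Int.lt_floor_add_one (y i / δ)
  rw [h1] at h2 h3
  have h6 : x i = δ * (x i / δ) := by field_simp
  have h7 : y i = δ * (y i / δ) := by field_simp
  rw [PiLp.sub_apply, h6, h7, ← mul_sub, abs_mul, abs_of_pos hδ]
  have : |x i / δ - y i / δ| ≤ 1 := by rw [abs_le]; constructor <;> linarith
  nlinarith

theorem fl_toE_near {n : ℕ} (δ : ℝ) (hδ : 0 < δ) (x : EuclideanSpace ℝ (Fin n)) :
    ‖δ • toE (fl δ x) - x‖ ≤ √n * δ := by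
  refine norm_le_sqrt_mul _ _ hδ.le fun i => ?_
  have h2 := Int.floor_le (x i / δ)
  have h3 := Int.lt_floor_add_one (x i / δ)
  have h6 : x i = δ * (x i / δ) := by field_simp
  have h7 : (δ • toE (fl δ x)) i = δ * (⌊x i / δ⌋ : ℝ) := by simp [toE, fl]
  rw [PiLp.sub_apply, h7]
  nth_rewrite 2 [h6]
  rw [← mul_sub, abs_mul, abs_of_pos hδ]
  have : |(⌊x i / δ⌋ : ℝ) - x i / δ| ≤ 1 := by rw [abs_le]; constructor <;> linarith
  nlinarith

theorem fl_add {n : ℕ} (δ : ℝ) (hδ : 0 < δ) (x : EuclideanSpace ℝ (Fin n)) (i : Fin n) :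
    fl δ (x + δ • EuclideanSpace.single i (1:ℝ)) = fl δ x + Pi.single i 1 := by
  ext k
  by_cases hk : k = i
  · subst hk
    simp only [fl, PiLp.add_apply, PiLp.smul_apply, PiLp.single_apply, Pi.add_apply,
      Pi.single_eq_same, if_true, smul_eq_mul, mul_one]
    rw [add_div, div_self hδ.ne', Int.floor_add_one]
  · simp [fl, hk]

theorem fl_cell_vol {n : ℕ} (δ : ℝ) (hδ : 0 < δ) (a : Fin n → ℤ) :
    volume {x : EuclideanSpace ℝ (Fin n) | fl δ x = a} = ENNReal.ofReal (δ ^ n) := by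
  have e : {x : EuclideanSpace ℝ (Fin n) | fl δ x = a} =
      (MeasurableEquiv.toLp 2 (Fin n → ℝ)).symm ⁻¹'
        (Set.pi Set.univ fun i => Set.Ico (δ * a i) (δ * a i + δ)) := by
    ext x
    simp only [fl, Set.mem_ofPred_eq, Set.mem_preimage, Set.mem_pi, Set.mem_univ, true_imp_iff,
      funext_iff, Int.floor_eq_iff, Set.mem_Ico]
    refine forall_congr' fun i => ?_
    rw [le_div_iff₀ hδ, div_lt_iff₀ hδ]
    change _ ↔ δ * a i ≤ x i ∧ x i < δ * a i + δ
    constructor <;> rintro ⟨h1, h2⟩ <;> constructor <;> nlinarith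
  rw [e, (EuclideanSpace.volume_preserving_symm_measurableEquiv_toLp (Fin n)).measure_preimage_equiv,
    Real.volume_pi_Ico]
  simp [ENNReal.ofReal_pow hδ.le]

theorem c4_grid {n : ℕ} (hn : 0 < n) (O : Set (EuclideanSpace ℝ (Fin n)))
    (ε : ℝ) (hε : 0 < ε) (hvol : volume O < ENNReal.ofReal (ε ^ n / 4)) (j : ℕ) (hj : 0 < j) :
    ∃ g : EuclideanSpace ℝ (Fin n) → EuclideanSpace ℝ (Fin n), Measurable g ∧
      (∀ x, ‖g x‖ ≤ √n * ε) ∧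
      (∀ x y, ‖x‖ ≤ ε * (j - 1) → ‖y‖ ≤ ε * (j - 1) →
        ‖g x - g y‖ ^ 2 ≤ ⟪g x - g y, x - y⟫ + 4 * n * ε * (ε / j)) ∧
      (∀ x, ‖x‖ ≤ ε * (j - 1) → closedBall x (√n * (ε / j)) ⊆ O →
        cc n * (ε / j) ≤ ∑ i, ⟪g (x + (ε / j) • EuclideanSpace.single i (1:ℝ)) - g x,
          EuclideanSpace.single i (1:ℝ)⟫) := by
  classical
  have hj' : (0:ℝ) < j := by exact_mod_cast hj
  set δ := ε / j with hδdef
  have hδ : 0 < δ := by positivity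
  have hδj : δ * j = ε := by rw [hδdef]; field_simp
  set Z : Finset (Fin n → ℤ) := Fintype.piFinset fun _ => Finset.Icc (-((j:ℤ) ^ 2)) ((j:ℤ) ^ 2) with hZ
  set H : Finset (Fin n → ℤ) := Z.filter fun a => {x | fl δ x = a} ⊆ O with hH
  have hcard : 4 * H.card < j ^ n := by
    have h1 : volume (⋃ a ∈ H, {x : EuclideanSpace ℝ (Fin n) | fl δ x = a}) ≤ volume O := by
      refine measure_mono (Set.iUnion₂_subset fun a ha => ?_)
      exact (Finset.mem_filter.1 ha).2
    rw [measure_biUnion_finset] at h1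
    · simp_rw [fl_cell_vol δ hδ] at h1
      rw [Finset.sum_const, nsmul_eq_mul] at h1
      have h2 := h1.trans_lt hvol
      have h3 : (H.card : ℝ≥0∞) * ENNReal.ofReal (δ ^ n) = ENNReal.ofReal (H.card * δ ^ n) := by
        rw [ENNReal.ofReal_mul (by positivity), ENNReal.ofReal_natCast]
      rw [h3, ENNReal.ofReal_lt_ofReal_iff (by positivity), ← hδj, mul_pow] at h2
      have h4 : (4 * H.card : ℝ) < (j:ℝ) ^ n := by
        have : (0:ℝ) < δ ^ n := by positivity
        by_contra hcon
        push Not at hcon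
        nlinarith
      exact_mod_cast h4
    · intro a _ b _ hab
      rw [Function.onFun, Set.disjoint_left]
      intro x hx hx'
      simp only [Set.mem_ofPred_eq] at hx hx'
      exact hab (hx.symm.trans hx')
    · intro a _
      exact fl_meas δ (measurableSet_singleton a)
  obtain ⟨G, hG1, hG2, hG3⟩ := c3_discrete hn Z H (Finset.filter_subset _ _) j hcard δ hδ
  have hbox : ∀ x : EuclideanSpace ℝ (Fin n), ‖x‖ ≤ ε * (j - 1) → ∀ i,
      -((j:ℤ) ^ 2) ≤ fl δ x i ∧ fl δ x i + 1 ≤ (j:ℤ) ^ 2 := by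
    intro x hx i
    have h1 := (abs_coord_le x i).trans hx
    rw [abs_le] at h1
    have hj1 : (1:ℝ) ≤ j := by exact_mod_cast hj
    have e1 : ε * (j - 1) = δ * (j * (j - 1)) := by rw [← hδj]; ring
    have h2 : x i / δ ≤ j * (j - 1) := by
      rw [div_le_iff₀ hδ]; linarith [h1.2]
    have h3 : -(j * (j - 1) : ℝ) ≤ x i / δ := by
      rw [le_div_iff₀ hδ]; linarith [h1.1]
    simp only [fl]
    constructor
    · rw [Int.le_floor]; push_cast; nlinarith
    · have := Int.floor_le (x i / δ)
      have h5 : ((⌊x i / δ⌋ + 1 : ℤ) : ℝ) ≤ ((j ^ 2 : ℤ) : ℝ) := by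
        push_cast; nlinarith
      exact_mod_cast h5
  have hZm : ∀ x : EuclideanSpace ℝ (Fin n), ‖x‖ ≤ ε * (j - 1) → fl δ x ∈ Z := by
    intro x hx
    rw [hZ, Fintype.mem_piFinset]
    intro i
    have := hbox x hx i
    rw [Finset.mem_Icc]; omega
  refine ⟨fun x => G (fl δ x), ?_, ?_, ?_, ?_⟩
  · exact (measurable_of_countable G).comp (fl_meas δ)
  · intro x; rw [← hδj]; exact hG1 _
  · intro x y hx hy
    have h1 := hG2 _ (hZm x hx) _ (hZm y hy)
    have h2 := fl_toE_near δ hδ x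
    have h3 := fl_toE_near δ hδ y
    set w := G (fl δ x) - G (fl δ y) with hw
    have h4 : ‖w‖ ≤ 2 * (√n * ε) := by
      have a1 := hG1 (fl δ x)
      have a2 := hG1 (fl δ y)
      rw [hδj] at a1 a2
      exact (norm_sub_le _ _).trans (by linarith)
    have e2 : δ • toE (fl δ x) - δ • toE (fl δ y) = (x - y) +
      ((δ • toE (fl δ x) - x) - (δ • toE (fl δ y) - y)) := by abel
    rw [e2, inner_add_right] at h1
    have h5 : ⟪w, (δ • toE (fl δ x) - x) - (δ • toE (fl δ y) - y)⟫ ≤ 2 * (√n * ε) * (2 * (√n * δ)) := by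
      refine (real_inner_le_norm _ _).trans ?_
      gcongr
      exact (norm_sub_le _ _).trans (by linarith)
    have h6 : 2 * (√n * ε) * (2 * (√n * δ)) = 4 * n * ε * δ := by
      have : √(n:ℝ) * √n = n := Real.mul_self_sqrt (by positivity)
      calc _ = 4 * (√(n:ℝ) * √n) * ε * δ := by ring
        _ = _ := by rw [this]
    linarith
  · intro x hx hO
    simp_rw [fl_add δ hδ]
    refine hG3 _ ?_ ?_
    · rw [hH, Finset.mem_filter]
      refine ⟨hZm x hx, fun y hy => hO ?_⟩
      rw [mem_closedBall, dist_eq_norm]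
      exact fl_near δ hδ y x hy
    · intro i
      rw [hZ, Fintype.mem_piFinset]
      intro k
      have := hbox x hx k
      rw [Finset.mem_Icc]
      by_cases hk : k = i
      · subst hk; simp only [Pi.add_apply, Pi.single_eq_same]; omega
      · simp only [Pi.add_apply, Pi.single_eq_of_ne hk]; omega


theorem c5_subseq {E : Type*} [NormedAddCommGroup E] [InnerProductSpace ℝ E] [FiniteDimensional ℝ E]
    (g : ℕ → E → E) (M : ℝ) (hM : ∀ j x, ‖g j x‖ ≤ M) (C : ℕ → ℝ) (hC : Tendsto C atTop (𝓝 0))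
    (h : ∀ x y, ∀ᶠ j in atTop, ‖g j x - g j y‖ ^ 2 ≤ ⟪g j x - g j y, x - y⟫ + C j) :
    ∃ (φ : ℕ → ℕ) (G : E → E), StrictMono φ ∧ (∀ x, Tendsto (fun k => g (φ k) x) atTop (𝓝 (G x))) ∧
      (∀ x, ‖G x‖ ≤ M) ∧ ∀ x y, ‖G x - G y‖ ^ 2 ≤ ⟪G x - G y, x - y⟫ := by
  have : ProperSpace E := FiniteDimensional.proper_real E
  set D := TopologicalSpace.denseSeq E with hD
  obtain ⟨a, -, φ, hφ, ha⟩ := (isCompact_univ_pi (fun _ : ℕ => isCompact_closedBall (0:E) M)).tendsto_subseq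
    (x := fun j m => g j (D m)) (fun j m _ => by simpa using hM j (D m))
  rw [tendsto_pi_nhds] at ha
  have hcau : ∀ x, CauchySeq fun k => g (φ k) x := by
    intro x
    rw [Metric.cauchySeq_iff']
    intro e he
    obtain ⟨m, hm⟩ := (TopologicalSpace.denseRange_denseSeq E).exists_dist_lt x (ε := e / 8) (by positivity)
    have h1 := hφ.tendsto_atTop.eventually (h x (D m))
    have h2 := hφ.tendsto_atTop.eventually (hC.eventually (gt_mem_nhds (show (0:ℝ) < (e / 8) ^ 2 by positivity)))
    have h3 : ∀ᶠ k in atTop, ‖g (φ k) x - g (φ k) (D m)‖ ≤ e / 4 := by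
      filter_upwards [h1, h2] with k hk1 hk2
      have h4 := real_inner_le_norm (g (φ k) x - g (φ k) (D m)) (x - D m)
      rw [dist_eq_norm] at hm
      have h5 : ‖g (φ k) x - g (φ k) (D m)‖ * ‖x - D m‖ ≤ ‖g (φ k) x - g (φ k) (D m)‖ * (e / 8) := by
        gcongr
      by_contra hcon
      push Not at hcon
      nlinarith
    have h6 : ∀ᶠ k in atTop, ‖g (φ k) (D m) - a m‖ < e / 8 := by
      have := (Metric.tendsto_nhds.1 (ha m)) (e / 8) (by positivity)
      simpa [dist_eq_norm] using this
    obtain ⟨N, hN⟩ := Filter.eventually_atTop.1 (h3.and h6)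
    refine ⟨N, fun k hk => ?_⟩
    obtain ⟨p1, p2⟩ := hN k hk
    obtain ⟨q1, q2⟩ := hN N le_rfl
    rw [dist_eq_norm]
    have e1 : g (φ k) x - g (φ N) x = (g (φ k) x - g (φ k) (D m)) + (g (φ k) (D m) - a m) -
      (g (φ N) (D m) - a m) - (g (φ N) x - g (φ N) (D m)) := by abel
    rw [e1]
    have n1 := norm_sub_le ((g (φ k) x - g (φ k) (D m)) + (g (φ k) (D m) - a m) -
      (g (φ N) (D m) - a m)) (g (φ N) x - g (φ N) (D m))
    have n2 := norm_sub_le ((g (φ k) x - g (φ k) (D m)) + (g (φ k) (D m) - a m))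
      (g (φ N) (D m) - a m)
    have n3 := norm_add_le (g (φ k) x - g (φ k) (D m)) (g (φ k) (D m) - a m)
    linarith
  choose G hG using fun x => cauchySeq_tendsto_of_complete (hcau x)
  refine ⟨φ, G, hφ, hG, fun x => ?_, fun x y => ?_⟩
  · exact le_of_tendsto (hG x).norm (Eventually.of_forall fun k => hM _ _)
  · have h1 := hφ.tendsto_atTop.eventually (h x y)
    have hs := (hG x).sub (hG y)
    have h2 : Tendsto (fun k => ⟪g (φ k) x - g (φ k) y, x - y⟫ + C (φ k)) atTop
        (𝓝 (⟪G x - G y, x - y⟫ + 0)) :=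
      (hs.inner tendsto_const_nhds).add (hC.comp hφ.tendsto_atTop)
    rw [add_zero] at h2
    exact le_of_tendsto_of_tendsto (hs.norm.pow 2) h2 h1

theorem c5_main {n : ℕ} (hn : 0 < n) (O : Set (EuclideanSpace ℝ (Fin n))) (hO : IsOpen O)
    (ε : ℝ) (hε : 0 < ε) (hvol : volume O < ENNReal.ofReal (ε ^ n / 4)) :
    ∃ g : EuclideanSpace ℝ (Fin n) → EuclideanSpace ℝ (Fin n),
      (∀ x, ‖g x‖ ≤ √n * ε) ∧ (∀ x y, ‖g x - g y‖ ^ 2 ≤ ⟪g x - g y, x - y⟫) ∧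
      ∀ (η : EuclideanSpace ℝ (Fin n) → ℝ) (r : ℝ) (x : EuclideanSpace ℝ (Fin n)),
        ContDiff ℝ 1 η → HasCompactSupport η → (∀ t, 0 ≤ η t) → (∫ t, η t = 1) →
        Function.support η ⊆ closedBall 0 r → closedBall x r ⊆ O →
        cc n ≤ ∫ t, ∑ i, fderiv ℝ η t (EuclideanSpace.single i 1) *
          ⟪g (x - t), EuclideanSpace.single i (1:ℝ)⟫ := by
  choose g hgm hg1 hg2 hg3 using fun j : ℕ => c4_grid hn O ε hε hvol (j + 1) (Nat.succ_pos j)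
  have hlarge : ∀ R : ℝ, ∀ᶠ j : ℕ in atTop, R ≤ ε * (((j + 1 : ℕ) : ℝ) - 1) := by
    intro R
    have : Tendsto (fun j : ℕ => ε * (j:ℝ)) atTop atTop :=
      tendsto_natCast_atTop_atTop.const_mul_atTop hε
    filter_upwards [this.eventually_ge_atTop R] with j hj
    push_cast; linarith
  have hδ : Tendsto (fun j : ℕ => ε / ((j + 1 : ℕ) : ℝ)) atTop (𝓝 0) := by
    have h := (tendsto_const_div_atTop_nhds_zero_nat ε).comp (tendsto_add_atTop_nat 1)
    exact h
  obtain ⟨φ, G, hφ, hG, hG1, hG2⟩ := c5_subseq g (√n * ε) hg1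
    (fun j => 4 * n * ε * (ε / ((j + 1 : ℕ) : ℝ))) (by simpa using hδ.const_mul (4 * n * ε)) (by
      intro x y
      filter_upwards [hlarge ‖x‖, hlarge ‖y‖] with j hx hy
      exact hg2 j x y hx hy)
  refine ⟨G, hG1, hG2, ?_⟩
  intro η r x hη hηc hη0 hη1 hsupp hxO
  set e : Fin n → EuclideanSpace ℝ (Fin n) := fun i => EuclideanSpace.single i (1:ℝ) with he
  have hen : ∀ i, ‖e i‖ = 1 := by intro i; simp [he]
  set d : ℕ → ℝ := fun k => ε / ((φ k + 1 : ℕ) : ℝ) with hd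
  have hd0 : ∀ k, 0 < d k := fun k => by positivity
  have hdt : Tendsto d atTop (𝓝 0) := hδ.comp hφ.tendsto_atTop
  obtain ⟨K, hK⟩ := hη.lipschitzWith_of_hasCompactSupport hηc (by norm_num)
  have hηcont : Continuous η := hη.continuous
  set F : ℕ → EuclideanSpace ℝ (Fin n) → ℝ := fun k t =>
    ∑ i, ((η (t + d k • e i) - η t) / d k) * ⟪g (φ k) (x - t), e i⟫ with hF
  have hgm' : ∀ k, Measurable fun t => g (φ k) (x - t) := fun k =>
    (hgm (φ k)).comp (measurable_const.sub measurable_id)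
  have hmeas : ∀ k, Measurable (F k) := by
    intro k
    refine Finset.measurable_sum _ fun i _ => Measurable.mul ?_ ?_
    · exact (by fun_prop : Continuous fun t => (η (t + d k • e i) - η t) / d k).measurable
    · exact (hgm' k).inner measurable_const
  have hsupp0 : ∀ t, η t ≠ 0 → ‖t‖ ≤ r := by
    intro t ht
    simpa using hsupp ht
  have hlim : Tendsto (fun k => ∫ t, F k t) atTop (𝓝 (∫ t, ∑ i, fderiv ℝ η t (e i) * ⟪G (x - t), e i⟫)) := by
    refine tendsto_integral_filter_of_dominated_convergence
      (fun t => (closedBall (0 : EuclideanSpace ℝ (Fin n)) (r + 1)).indicator (fun _ => n * (K * (√n * ε))) t) ?_ ?_ ?_ ?_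
    · exact Eventually.of_forall fun k => (hmeas k).aestronglyMeasurable
    · have h1 : ∀ᶠ k in atTop, d k < 1 := hdt.eventually (gt_mem_nhds one_pos)
      filter_upwards [h1] with k hk
      refine Eventually.of_forall fun t => ?_
      by_cases ht : t ∈ closedBall (0 : EuclideanSpace ℝ (Fin n)) (r + 1)
      · rw [Set.indicator_of_mem ht]
        refine (norm_sum_le _ _).trans ?_
        calc ∑ i, ‖((η (t + d k • e i) - η t) / d k) * ⟪g (φ k) (x - t), e i⟫‖
            ≤ ∑ _i : Fin n, K * (√n * ε) := by
              refine Finset.sum_le_sum fun i _ => ?_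
              rw [norm_mul]
              gcongr
              · rw [norm_div, div_le_iff₀ (by rw [Real.norm_eq_abs, abs_of_pos (hd0 k)]; exact hd0 k)]
                have := hK.dist_le_mul (t + d k • e i) t
                rw [dist_eq_norm, dist_eq_norm, add_sub_cancel_left, norm_smul, hen, mul_one] at this
                exact this
              · refine (abs_real_inner_le_norm _ _).trans ?_
                rw [hen, mul_one]; exact hg1 _ _
          _ = _ := by simp
      · rw [Set.indicator_of_notMem ht]
        have ht' : r + 1 < ‖t‖ := by simpa using ht
        have z1 : η t = 0 := by
          by_contra h; have := hsupp0 t h; linarith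
        have z2 : ∀ i, η (t + d k • e i) = 0 := by
          intro i
          by_contra h
          have h5 := hsupp0 _ h
          have h6 : ‖t‖ ≤ ‖t + d k • e i‖ + ‖d k • e i‖ := by
            calc ‖t‖ = ‖(t + d k • e i) - d k • e i‖ := by rw [add_sub_cancel_right]
              _ ≤ _ := norm_sub_le _ _
          rw [norm_smul, hen, mul_one, Real.norm_eq_abs, abs_of_pos (hd0 k)] at h6
          linarith
        simp [hF, z1, z2]
    · refine (integrable_indicator_iff measurableSet_closedBall).2 ?_
      refine integrableOn_const ?_ ?_
      · exact (isCompact_closedBall _ _).measure_lt_top.ne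
      · exact enorm_ne_top
    · refine Eventually.of_forall fun t => ?_
      refine tendsto_finsetSum _ fun i _ => Tendsto.mul ?_ ?_
      · have h1 : HasLineDerivAt ℝ η (fderiv ℝ η t (e i)) t (e i) :=
          ((hη.differentiable (by norm_num)) t).hasFDerivAt.hasLineDerivAt (e i)
        have h2 := HasDerivAt.tendsto_slope_zero h1
        have h3 : Tendsto d atTop (𝓝[≠] 0) := by
          rw [tendsto_nhdsWithin_iff]
          exact ⟨hdt, Eventually.of_forall fun k => (hd0 k).ne'⟩
        have h4 := h2.comp h3
        refine h4.congr fun k => ?_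
        simp [div_eq_inv_mul]
      · exact (hG (x - t)).inner tendsto_const_nhds
  refine ge_of_tendsto hlim ?_
  obtain ⟨r1, hr1, hr1O⟩ := (isCompact_closedBall x r).exists_cthickening_subset_open hO hxO
  have hsd : ∀ᶠ k in atTop, √n * d k < r1 := by
    have : Tendsto (fun k => √n * d k) atTop (𝓝 (√n * 0)) := hdt.const_mul _
    rw [mul_zero] at this
    exact this.eventually (gt_mem_nhds hr1)
  filter_upwards [hsd, hφ.tendsto_atTop.eventually (hlarge (‖x‖ + r))] with k hk1 hk2
  have hint : ∀ (y : EuclideanSpace ℝ (Fin n)) (i : Fin n) , Integrable fun t => η t * ⟪g (φ k) (y - t), e i⟫ := by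
    intro y i
    have hb : Integrable η := hηcont.integrable_of_hasCompactSupport hηc
    refine Integrable.mul_bdd (c := √n * ε) hb ?_ ?_
    · exact (((hgm (φ k)).comp (measurable_const.sub measurable_id)).inner measurable_const).aestronglyMeasurable
    · refine Eventually.of_forall fun t => ?_
      refine (abs_real_inner_le_norm _ _).trans ?_
      rw [hen, mul_one]; exact hg1 _ _
  have hint2 : ∀ i, Integrable fun t => η (t + d k • e i) * ⟪g (φ k) (x - t), e i⟫ := by
    intro i
    have := (hint (x + d k • e i) i).comp_add_right (d k • e i)
    refine this.congr (Eventually.of_forall fun t => ?_)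
    have e1 : x + d k • e i - (t + d k • e i) = x - t := by abel
    simp only [e1]
  have heq : ∫ t, F k t = (d k)⁻¹ * ∫ t, η t * ∑ i, ⟪g (φ k) (x - t + d k • e i) - g (φ k) (x - t), e i⟫ := by
    have s1 : ∀ i, ∫ t, η (t + d k • e i) * ⟪g (φ k) (x - t), e i⟫ =
        ∫ t, η t * ⟪g (φ k) (x - t + d k • e i), e i⟫ := by
      intro i
      rw [← integral_add_right_eq_self (fun t => η t * ⟪g (φ k) (x - t + d k • e i), e i⟫) (d k • e i)]
      refine integral_congr_ae (Eventually.of_forall fun t => ?_)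
      simp only []
      congr 4; abel
    have hint3 : ∀ i, Integrable fun t => η t * ⟪g (φ k) (x - t + d k • e i), e i⟫ := by
      intro i
      refine (hint (x + d k • e i) i).congr (Eventually.of_forall fun t => ?_)
      simp only []
      congr 4; abel
    have s2 : ∀ t, F k t = (d k)⁻¹ * ∑ i, (η (t + d k • e i) * ⟪g (φ k) (x - t), e i⟫ - η t * ⟪g (φ k) (x - t), e i⟫) := by
      intro t
      rw [Finset.mul_sum]
      refine Finset.sum_congr rfl fun i _ => ?_
      rw [div_eq_inv_mul]; ring
    simp_rw [s2]
    rw [integral_const_mul]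
    congr 1
    have t1 := integral_finsetSum (μ := volume) Finset.univ (fun i _ => (hint2 i).sub (hint x i))
    have t2 := integral_finsetSum (μ := volume) Finset.univ (fun i _ => (hint3 i).sub (hint x i))
    simp only [Pi.sub_apply] at t1 t2
    simp_rw [inner_sub_left, Finset.mul_sum, mul_sub]
    rw [t1, t2]
    refine Finset.sum_congr rfl fun i _ => ?_
    rw [integral_sub (hint2 i) (hint x i), integral_sub (hint3 i) (hint x i), s1]
  rw [heq]
  have hlow : cc n * d k ≤ ∫ t, η t * ∑ i, ⟪g (φ k) (x - t + d k • e i) - g (φ k) (x - t), e i⟫ := by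
    have h1 : cc n * d k = ∫ t, η t * (cc n * d k) := by
      rw [integral_mul_const, hη1, one_mul]
    rw [h1]
    refine integral_mono_ae ?_ ?_ ?_
    · exact (hηcont.integrable_of_hasCompactSupport hηc).mul_const _
    · have : Integrable fun t => ∑ i, (η t * ⟪g (φ k) (x + d k • e i - t), e i⟫ - η t * ⟪g (φ k) (x - t), e i⟫) :=
        integrable_finsetSum _ fun i _ => (hint (x + d k • e i) i).sub (hint x i)
      refine this.congr (Eventually.of_forall fun t => ?_)
      simp only [inner_sub_left, Finset.mul_sum, mul_sub]
      refine Finset.sum_congr rfl fun i _ => ?_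
      congr 5; abel
    · refine Eventually.of_forall fun t => ?_
      by_cases ht : η t = 0
      · simp [ht]
      · refine mul_le_mul_of_nonneg_left ?_ (hη0 t)
        have htr := hsupp0 t ht
        refine hg3 (φ k) (x - t) ?_ ?_
        · exact ((norm_sub_le _ _).trans (by linarith)).trans hk2
        · refine Set.Subset.trans ?_ hr1O
          intro y hy
          refine Metric.mem_cthickening_of_dist_le y (x - t) r1 _ ?_ ?_
          · simpa [dist_eq_norm] using htr
          · exact (mem_closedBall.1 hy).trans hk1.le
  rw [inv_mul_eq_div, le_div_iff₀ (hd0 k)]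
  exact hlow


/-- `g - id/2` is `c`-Lipschitz. -/
def HLip {E : Type*} [NormedAddCommGroup E] [NormedSpace ℝ E] (c : ℝ) (g : E → E) : Prop :=
  ∀ x y, ‖(g x - g y) - (1/2 : ℝ) • (x - y)‖ ≤ c * ‖x - y‖

/-- coordinate trace -/
def ctr {n : ℕ} (A : EuclideanSpace ℝ (Fin n) →L[ℝ] EuclideanSpace ℝ (Fin n)) : ℝ :=
  ∑ i, ⟪A (EuclideanSpace.single i 1), EuclideanSpace.single i (1:ℝ)⟫

theorem HLip.lip {E : Type*} [NormedAddCommGroup E] [NormedSpace ℝ E] {c : ℝ} {g : E → E}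
    (h : HLip c g) (x y : E) : ‖g x - g y‖ ≤ (c + 1/2) * ‖x - y‖ := by
  have h1 := h x y
  have h2 : g x - g y = ((g x - g y) - (1/2 : ℝ) • (x - y)) + (1/2 : ℝ) • (x - y) := by abel
  have h3 := norm_add_le ((g x - g y) - (1/2 : ℝ) • (x - y)) ((1/2 : ℝ) • (x - y))
  rw [← h2, norm_smul] at h3
  norm_num at h3 ⊢
  norm_num at h1
  linarith

theorem HLip.continuous {E : Type*} [NormedAddCommGroup E] [NormedSpace ℝ E] {c : ℝ} {g : E → E}
    (h : HLip c g) : Continuous g := by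
  refine (LipschitzWith.of_dist_le_mul (K := Real.toNNReal (c + 1/2)) fun x y => ?_).continuous
  rw [dist_eq_norm, dist_eq_norm]
  exact (h.lip x y).trans (by gcongr; exact Real.le_coe_toNNReal _)

theorem HLip.of_fne {E : Type*} [NormedAddCommGroup E] [InnerProductSpace ℝ E] {g : E → E}
    (h : ∀ x y, ‖g x - g y‖ ^ 2 ≤ ⟪g x - g y, x - y⟫) : HLip (1/2) g := by
  intro x y
  refine abs_le_of_sq_le_sq' ?_ (by positivity) |>.2
  have := h x y
  rw [norm_sub_sq_real, inner_smul_right, norm_smul]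
  norm_num
  nlinarith

theorem c6_main {n : ℕ} (hn : 0 < n) (O : Set (EuclideanSpace ℝ (Fin n))) (hO : IsOpen O)
    (ε : ℝ) (hε : 0 < ε) (hvol : volume O < ENNReal.ofReal (ε ^ n / 4)) :
    ∃ g : EuclideanSpace ℝ (Fin n) → EuclideanSpace ℝ (Fin n),
      (∀ x, ‖g x‖ ≤ √n * ε) ∧ HLip (1/2) g ∧
      ∀ r : ℝ, 0 < r → ∃ u : EuclideanSpace ℝ (Fin n) → EuclideanSpace ℝ (Fin n),
        ContDiff ℝ (⊤ : ℕ∞) u ∧ (∀ x, ‖u x - g x‖ ≤ r) ∧ HLip (1/2) u ∧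
        ∀ x, closedBall x r ⊆ O → cc n ≤ ctr (fderiv ℝ u x) := by
  obtain ⟨g, hg1, hg2, hg3⟩ := c5_main hn O hO ε hε hvol
  have hH : HLip (1/2) g := HLip.of_fne hg2
  refine ⟨g, hg1, hH, ?_⟩
  intro r hr
  set b : ContDiffBump (0 : EuclideanSpace ℝ (Fin n)) := ⟨r / 2, r, by positivity, by linarith⟩ with hb
  set η := b.normed volume with hη
  have hgc : Continuous g := hH.continuous
  have hηC : ContDiff ℝ (⊤ : ℕ∞) η := b.contDiff_normed
  have hηNaC : ContDiff ℝ 1 η := b.contDiff_normed (n := 1)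
  have hηcs : HasCompactSupport η := b.hasCompactSupport_normed
  have hηs : Function.support η ⊆ closedBall 0 r := by
    rw [hη, b.support_normed_eq]; exact ball_subset_closedBall
  have hηi : ∫ t, η t = 1 := b.integral_normed
  have hη0 : ∀ t, 0 ≤ η t := fun t => b.nonneg_normed t
  set u := MeasureTheory.convolution η g (ContinuousLinearMap.lsmul ℝ ℝ) volume with hu
  have hint : ∀ x, Integrable fun t => η t • g (x - t) := by
    intro x
    refine Continuous.integrable_of_hasCompactSupport ?_ (hηcs.smul_right)
    have := hηNaC.continuous
    fun_prop
  have huv : ∀ x, u x = ∫ t, η t • g (x - t) := fun x => rfl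
  refine ⟨u, ?_, ?_, ?_, ?_⟩
  · exact hηcs.contDiff_convolution_left _ hηC hgc.locallyIntegrable
  · intro x
    rw [← dist_eq_norm]
    refine b.dist_normed_convolution_le hgc.aestronglyMeasurable fun y hy => ?_
    rw [dist_eq_norm]
    have := hH.lip y x
    rw [mem_ball, dist_eq_norm] at hy
    have e : b.rOut = r := rfl
    rw [e] at hy
    norm_num at this
    linarith
  · intro x y
    have e1 : (u x - u y) - (1/2 : ℝ) • (x - y) =
        ∫ t, η t • ((g (x - t) - g (y - t)) - (1/2 : ℝ) • (x - y)) := by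
      have hc : Integrable fun t => η t • ((1/2 : ℝ) • (x - y)) :=
        (hηNaC.continuous.integrable_of_hasCompactSupport hηcs).smul_const _
      simp_rw [smul_sub (η _) (g _ - g _) _, smul_sub (η _) (g _) (g _)]
      have t1 := integral_sub ((hint x).sub (hint y)) hc
      simp only [Pi.sub_apply] at t1
      rw [t1, integral_sub (hint x) (hint y), integral_smul_const,
        hηi, one_smul, huv, huv]
    rw [e1]
    refine (norm_integral_le_of_norm_le (g := fun t => η t * (1/2 * ‖x - y‖)) ?_ ?_).trans ?_
    · exact (hηNaC.continuous.integrable_of_hasCompactSupport hηcs).mul_const _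
    · refine Eventually.of_forall fun t => ?_
      rw [norm_smul, Real.norm_eq_abs, abs_of_nonneg (hη0 t)]
      refine mul_le_mul_of_nonneg_left ?_ (hη0 t)
      have := hH (x - t) (y - t)
      rwa [sub_sub_sub_cancel_right] at this
    · rw [integral_mul_const, hηi, one_mul]
  · intro x hx
    have h1 := hg3 η r x hηNaC hηcs hη0 hηi hηs hx
    have h2 := hηcs.hasFDerivAt_convolution_left (ContinuousLinearMap.lsmul ℝ ℝ : ℝ →L[ℝ] EuclideanSpace ℝ (Fin n) →L[ℝ] EuclideanSpace ℝ (Fin n)) hηNaC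
      (hgc.locallyIntegrable (μ := volume)) x
    have h3 : fderiv ℝ u x = _ := h2.fderiv
    rw [ctr, h3]
    have hcf : Continuous (fderiv ℝ η) := hηNaC.continuous_fderiv (by norm_num)
    have hcsf : HasCompactSupport (fderiv ℝ η) := hηcs.fderiv (𝕜 := ℝ)
    have hint2 : Integrable fun t => ((ContinuousLinearMap.lsmul ℝ ℝ : ℝ →L[ℝ] EuclideanSpace ℝ (Fin n) →L[ℝ] EuclideanSpace ℝ (Fin n)).precompL (EuclideanSpace ℝ (Fin n)))
        (fderiv ℝ η t) (g (x - t)) := by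
      refine Continuous.integrable_of_hasCompactSupport ?_ ?_
      · exact ((ContinuousLinearMap.continuous _).comp hcf).clm_apply (by fun_prop)
      · refine hcsf.mono ?_
        intro t ht h0
        apply ht
        simp only [h0, map_zero, zero_apply]
    have e2 : ∀ i : Fin n, ⟪(MeasureTheory.convolution (fderiv ℝ η) g ((ContinuousLinearMap.lsmul ℝ ℝ : ℝ →L[ℝ] EuclideanSpace ℝ (Fin n) →L[ℝ] EuclideanSpace ℝ (Fin n)).precompL (EuclideanSpace ℝ (Fin n))) volume x)
        (EuclideanSpace.single i 1), EuclideanSpace.single i (1:ℝ)⟫ =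
        ∫ t, fderiv ℝ η t (EuclideanSpace.single i 1) * ⟪g (x - t), EuclideanSpace.single i (1:ℝ)⟫ := by
      intro i
      rw [MeasureTheory.convolution, ContinuousLinearMap.integral_apply hint2, real_inner_comm,
        ← integral_inner (hint2.apply_continuousLinearMap _)]
      refine integral_congr_ae (Eventually.of_forall fun t => ?_)
      simp only [ContinuousLinearMap.precompL_apply, ContinuousLinearMap.lsmul_apply]
      rw [inner_smul_right, real_inner_comm]
    simp_rw [e2]
    rw [← integral_finsetSum]
    · exact h1
    · intro i _
      have h5 := (hint2.apply_continuousLinearMap (EuclideanSpace.single i (1:ℝ))).inner_const (𝕜 := ℝ) (EuclideanSpace.single i (1:ℝ))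
      refine h5.congr (Eventually.of_forall fun t => ?_)
      simp only [ContinuousLinearMap.precompL_apply, ContinuousLinearMap.lsmul_apply]
      rw [real_inner_smul_left]


theorem ml_lip {E F : Type*} [NormedAddCommGroup E] [NormedSpace ℝ E] [NormedAddCommGroup F]
    [NormedSpace ℝ F] (h : E → F) (C : ℝ)
    (hloc : ∀ x, ∀ᶠ y in 𝓝 x, ‖h y - h x‖ ≤ C * ‖y - x‖) (x y : E) :
    ‖h y - h x‖ ≤ C * ‖y - x‖ := by
  have hcont : Continuous h := by
    rw [continuous_iff_continuousAt]
    intro x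
    rw [ContinuousAt, tendsto_iff_norm_sub_tendsto_zero]
    refine squeeze_zero' (g := fun y => C * ‖y - x‖) (Eventually.of_forall fun y => norm_nonneg _) (hloc x) ?_
    have : Tendsto (fun y => C * ‖y - x‖) (𝓝 x) (𝓝 (C * ‖x - x‖)) :=
      (by fun_prop : Continuous fun y => C * ‖y - x‖).tendsto x
    simpa using this
  set p : ℝ → E := fun t => x + t • (y - x) with hp
  have hpc : Continuous p := by fun_prop
  set S : Set ℝ := {t | ‖h (p t) - h x‖ ≤ C * (t * ‖y - x‖)} with hS
  have hsub : Icc (0:ℝ) 1 ⊆ S := by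
    refine IsClosed.Icc_subset_of_forall_mem_nhdsWithin ?_ ?_ ?_
    · refine IsClosed.inter (isClosed_le ?_ ?_) isClosed_Icc <;> fun_prop
    · simp [hS, hp]
    · rintro t ⟨ht, ht0, ht1⟩
      have h1 : ∀ᶠ s in 𝓝 t, ‖h (p s) - h (p t)‖ ≤ C * ‖p s - p t‖ :=
        hpc.continuousAt.eventually (hloc (p t))
      filter_upwards [nhdsWithin_le_nhds h1, self_mem_nhdsWithin] with s hs hst
      have e : p s - p t = (s - t) • (y - x) := by simp only [hp]; rw [sub_smul]; abel
      have hst' : t < s := hst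
      rw [e, norm_smul, Real.norm_eq_abs, abs_of_pos (by linarith)] at hs
      simp only [hS, Set.mem_ofPred_eq] at ht ⊢
      have : h (p s) - h x = (h (p s) - h (p t)) + (h (p t) - h x) := by abel
      rw [this]
      refine (norm_add_le _ _).trans ?_
      nlinarith
  have := hsub (right_mem_Icc.2 zero_le_one)
  simpa [hS, hp] using this

theorem d_tol {E : Type*} [NormedAddCommGroup E] [InnerProductSpace ℝ E] [FiniteDimensional ℝ E]
    (T : Set E) (s : E → ℝ) (hs0 : ∀ z ∈ T, 0 < s z) (hs1 : ∀ z ∈ T, s z ≤ 1) (κ : ℝ) (hκ : 0 < κ)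
    (hκ1 : κ ≤ 1) :
    ∃ τ : E → ℝ, ContDiff ℝ (⊤ : ℕ∞) τ ∧ (∀ x, 0 ≤ τ x) ∧ (∀ x, τ x ≤ 1) ∧
      (∀ x y, |τ x - τ y| ≤ κ * ‖x - y‖) ∧ (∀ x ∈ T, 0 < τ x) ∧
      ∀ x, 0 < τ x → ∃ z ∈ T, ‖x - z‖ < s z ∧ τ x ≤ κ * s z := by
  rcases T.eq_empty_or_nonempty with rfl | hTne
  · refine ⟨fun _ => 0, contDiff_const, by simp, by simp, fun x y => by simp; positivity, by simp, by simp⟩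
  have hcov : ∃ z : ℕ → E, (∀ i, z i ∈ T) ∧ T ⊆ ⋃ i, ball (z i) (s (z i)) := by
    obtain ⟨I, hI, hIu⟩ := TopologicalSpace.isOpen_iUnion_countable (fun z : T => ball (z : E) (s z)) (fun z => isOpen_ball)
    have hTsub : T ⊆ ⋃ i ∈ I, ball (i : E) (s i) := by
      rw [hIu]
      intro x hx
      exact mem_iUnion.2 ⟨⟨x, hx⟩, mem_ball_self (hs0 x hx)⟩
    have hIne : I.Nonempty := by
      obtain ⟨x, hx⟩ := hTne
      obtain ⟨i, hi, -⟩ := mem_iUnion₂.1 (hTsub hx)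
      exact ⟨i, hi⟩
    obtain ⟨f, hf⟩ := hI.exists_eq_range hIne
    refine ⟨fun i => f i, fun i => (f i).2, hTsub.trans ?_⟩
    intro x hx
    obtain ⟨i, hi, hxi⟩ := mem_iUnion₂.1 hx
    rw [hf] at hi
    obtain ⟨k, rfl⟩ := hi
    exact mem_iUnion.2 ⟨k, hxi⟩
  obtain ⟨z, hzT, hzc⟩ := hcov
  have hs0' : ∀ i, 0 < s (z i) := fun i => hs0 _ (hzT i)
  set b : ∀ i, ContDiffBump (z i) := fun i => ⟨s (z i) / 2, s (z i), by have := hs0' i; positivity, by have := hs0' i; linarith⟩ with hb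
  set d : ℕ → ℝ := fun i => κ * s (z i) * (1/2) ^ (i + 2) with hd
  have hd0 : ∀ i, 0 < d i := fun i => by have := hs0' i; positivity
  have hdle : ∀ i, d i ≤ κ * (1/2) ^ (i + 2) := by
    intro i
    have : κ * s (z i) * (1/2) ^ (i + 2) ≤ κ * 1 * (1/2) ^ (i + 2) := by
      gcongr; exact hs1 _ (hzT i)
    exact this.trans_eq (by ring)
  have hgeo : HasSum (fun i : ℕ => κ * (1/2 : ℝ) ^ (i + 2)) (κ * (1/2)) := by
    have := (hasSum_geometric_two.mul_left (κ / 4))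
    have e : (fun i : ℕ => κ * (1/2 : ℝ) ^ (i + 2)) = fun i : ℕ => κ / 4 * (1/2 : ℝ) ^ i := by
      funext i; rw [pow_add]; ring
    have e2 : κ * (1/2) = κ / 4 * 2 := by ring
    rw [e, e2]; exact this
  have hdsum : Summable d := Summable.of_nonneg_of_le (fun i => (hd0 i).le) hdle hgeo.summable
  have hdtot : ∑' i, d i ≤ κ * (1/2) := by
    rw [← hgeo.tsum_eq]; exact hdsum.tsum_le_tsum hdle hgeo.summable
  have hr : ∀ i : ℕ, ∃ r : ℝ, 0 < r ∧ ∀ k ≤ i + 1, ∀ x, ‖iteratedFDeriv ℝ k (r • (b i : E → ℝ)) x‖ ≤ d i := by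
    intro i
    have hR : ∀ k : ℕ, ∃ R, ∀ x, ‖iteratedFDeriv ℝ k (b i : E → ℝ) x‖ ≤ R := by
      intro k
      have : BddAbove (range fun x => ‖iteratedFDeriv ℝ k (b i : E → ℝ) x‖) := by
        apply (((b i).contDiff (n := k)).continuous_iteratedFDeriv le_rfl).norm.bddAbove_range_of_hasCompactSupport
        apply HasCompactSupport.comp_left _ norm_zero
        exact (b i).hasCompactSupport.iteratedFDeriv k
      rcases this with ⟨R, hR⟩
      exact ⟨R, fun x => hR (mem_range_self _)⟩
    choose R hR using hR
    have hR0 : ∀ k, 0 ≤ R k := fun k => (norm_nonneg _).trans (hR k 0)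
    set M := ∑ k ∈ Finset.range (i + 2), R k + 1 with hM
    have hMp : 0 < M := by
      have := Finset.sum_nonneg (fun k (_ : k ∈ Finset.range (i + 2)) => hR0 k); linarith
    have IR : ∀ k ≤ i + 1, R k ≤ M := by
      intro k hk
      have := Finset.single_le_sum (f := R) (fun k _ => hR0 k) (Finset.mem_range.2 (by omega : k < i + 2))
      linarith
    refine ⟨M⁻¹ * d i, mul_pos (inv_pos.2 hMp) (hd0 i), fun k hk x => ?_⟩
    have h0 : 0 ≤ M⁻¹ * d i := (mul_pos (inv_pos.2 hMp) (hd0 i)).le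
    calc
      ‖iteratedFDeriv ℝ k ((M⁻¹ * d i) • (b i : E → ℝ)) x‖ = ‖(M⁻¹ * d i) • iteratedFDeriv ℝ k (b i : E → ℝ) x‖ := by
        rw [iteratedFDeriv_const_smul_apply]
        exact ((b i).contDiff (n := k)).contDiffAt
      _ = M⁻¹ * d i * ‖iteratedFDeriv ℝ k (b i : E → ℝ) x‖ := by
        rw [norm_smul, Real.norm_of_nonneg h0]
      _ ≤ M⁻¹ * d i * M := mul_le_mul_of_nonneg_left ((hR k x).trans (IR k hk)) h0
      _ = d i := by field_simp
  choose r rpos hr using hr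
  set f : ℕ → E → ℝ := fun i x => r i * b i x with hf
  have hf0 : ∀ i x, 0 ≤ f i x := fun i x => mul_nonneg (rpos i).le (b i).nonneg
  have hfle : ∀ i x, f i x ≤ d i := by
    intro i x
    have := hr i 0 (by omega) x
    rw [norm_iteratedFDeriv_zero] at this
    exact (le_abs_self _).trans this
  have hfsum : ∀ x, Summable fun i => f i x := fun x =>
    Summable.of_nonneg_of_le (fun i => hf0 i x) (fun i => hfle i x) hdsum
  have hflip : ∀ i x y, |f i x - f i y| ≤ d i * ‖x - y‖ := by
    intro i x y
    have hdiff : Differentiable ℝ (f i) := ((b i).contDiff (n := 1)).differentiable (by norm_num) |>.const_mul (r i)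
    have := Convex.norm_image_sub_le_of_norm_fderiv_le (f := f i) (s := univ) (C := d i) (x := y) (y := x)
      (fun w _ => hdiff w) (fun w _ => ?_) convex_univ (mem_univ _) (mem_univ _)
    · exact this
    · have h1 := hr i 1 (by omega) w
      rw [norm_iteratedFDeriv_one] at h1
      exact h1
  refine ⟨fun x => ∑' i, f i x, ?_, fun x => tsum_nonneg fun i => hf0 i x, ?_, ?_, ?_, ?_⟩
  · refine contDiff_tsum_of_eventually (v := fun _ => d) (fun i => contDiff_const.mul (b i).contDiff) (fun k _ => hdsum) ?_
    intro k _
    rw [Nat.cofinite_eq_atTop, Filter.eventually_atTop]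
    exact ⟨k, fun i hi x => hr i k (by omega) x⟩
  · intro x
    have h1 := (hfsum x).tsum_le_tsum (fun i => hfle i x) hdsum
    linarith
  · intro x y
    rw [← (hfsum x).tsum_sub (hfsum y)]
    have hs2 : Summable fun i => d i * ‖x - y‖ := hdsum.mul_right _
    have h1 : ‖∑' i, (f i x - f i y)‖ ≤ ∑' i, d i * ‖x - y‖ :=
      tsum_of_norm_bounded hs2.hasSum (fun i => hflip i x y)
    rw [tsum_mul_right] at h1
    refine h1.trans ?_
    gcongr
    linarith
  · intro x hx
    obtain ⟨i, hi⟩ := mem_iUnion.1 (hzc hx)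
    refine (hfsum x).tsum_pos (fun i => hf0 i x) i ?_
    exact mul_pos (rpos i) ((b i).pos_of_mem_ball hi)
  · intro x hx
    set I := {i | x ∈ ball (z i) (s (z i))} with hI
    have hout : ∀ i, i ∉ I → f i x = 0 := by
      intro i hi
      have : b i x = 0 := by
        by_contra h
        have h2 : x ∈ Function.support (b i) := h
        rw [(b i).support_eq] at h2
        exact hi h2
      simp [hf, this]
    have hIne : I.Nonempty := by
      by_contra h
      rw [Set.not_nonempty_iff_eq_empty] at h
      have : ∀ i, f i x = 0 := fun i => hout i (by rw [h]; simp)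
      simp [this] at hx
    set σ := sSup ((fun i => s (z i)) '' I) with hσ
    have hbdd : BddAbove ((fun i => s (z i)) '' I) := ⟨1, by rintro - ⟨i, -, rfl⟩; exact hs1 _ (hzT i)⟩
    have hle : ∀ i ∈ I, s (z i) ≤ σ := fun i hi => le_csSup hbdd ⟨i, hi, rfl⟩
    obtain ⟨i0, hi0⟩ := hIne
    have hσ0 : 0 < σ := (hs0' i0).trans_le (hle i0 hi0)
    obtain ⟨-, ⟨i, hi, rfl⟩, hlt⟩ := exists_lt_of_lt_csSup (s := (fun i => s (z i)) '' I) (b := σ / 2) ⟨_, ⟨i0, hi0, rfl⟩⟩ (by linarith : σ / 2 < σ)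
    refine ⟨z i, hzT i, by rw [← dist_eq_norm]; exact hi, ?_⟩
    have h2 : ∀ i, f i x ≤ σ * (κ * (1/2) ^ (i + 2)) := by
      intro i
      by_cases hiI : i ∈ I
      · refine (hfle i x).trans ?_
        have : d i = s (z i) * (κ * (1/2) ^ (i + 2)) := by simp only [hd]; ring
        rw [this]
        exact mul_le_mul_of_nonneg_right (hle i hiI) (by positivity)
      · rw [hout i hiI]; positivity
    have h3 := (hfsum x).tsum_le_tsum h2 (hgeo.summable.mul_left σ)
    rw [tsum_mul_left, hgeo.tsum_eq] at h3
    refine h3.trans ?_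
    dsimp only at hlt
    nlinarith


theorem smoothTransition_lip : ∃ K : ℝ, 1 ≤ K ∧ ∀ x y : ℝ,
    |Real.smoothTransition x - Real.smoothTransition y| ≤ K * |x - y| := by
  have hC : ContDiff ℝ 1 Real.smoothTransition := Real.smoothTransition.contDiff
  obtain ⟨M, hM⟩ := isCompact_Icc.exists_bound_of_continuousOn (s := Icc (0:ℝ) 1)
    (f := deriv Real.smoothTransition) (hC.continuous_deriv (by norm_num)).continuousOn
  refine ⟨max M 1, le_max_right _ _, fun x y => ?_⟩
  have h := Convex.norm_image_sub_le_of_norm_deriv_le (f := Real.smoothTransition) (s := Icc (0:ℝ) 1)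
    (C := max M 1) (x := (projIcc 0 1 zero_le_one y : ℝ)) (y := (projIcc 0 1 zero_le_one x : ℝ))
    (fun w _ => hC.differentiable (by norm_num) w) (fun w hw => (hM w hw).trans (le_max_left _ _))
    (convex_Icc 0 1) (projIcc 0 1 zero_le_one y).2 (projIcc 0 1 zero_le_one x).2
  rw [Real.smoothTransition.projIcc, Real.smoothTransition.projIcc] at h
  refine h.trans ?_
  have h2 : |(projIcc 0 1 zero_le_one x : ℝ) - (projIcc 0 1 zero_le_one y : ℝ)| ≤ |x - y| :=
    abs_projIcc_sub_projIcc zero_le_one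
  have h3 : (0:ℝ) ≤ max M 1 := le_trans zero_le_one (le_max_right _ _)
  exact mul_le_mul_of_nonneg_left h2 h3

theorem glue_weights : ∃ (K : ℝ) (w : ℕ → ℝ → ℝ), 1 ≤ K ∧ (∀ j, ContDiff ℝ (⊤ : ℕ∞) (w j)) ∧
    (∀ j t, 0 ≤ t → 0 ≤ w j t) ∧ (∀ N t, ∑ j ∈ Finset.range N, w j t ≤ 1) ∧
    (∀ j t, 0 ≤ t → w j t ≠ 0 → (1/2 : ℝ) ^ (j + 1) < t) ∧
    (∀ j t t', |w j t - w j t'| ≤ K * 2 ^ j * |t - t'|) ∧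
    (∀ N t, (1/2 : ℝ) ^ N ≤ t → ∑ j ∈ Finset.range (N + 1), w j t = 1) := by
  obtain ⟨K, hK1, hK⟩ := smoothTransition_lip
  set ψ : ℕ → ℝ → ℝ := fun j t => Real.smoothTransition (2 ^ (j + 1) * t - 1) with hψ
  have hψmono : ∀ j t, 0 ≤ t → ψ j t ≤ ψ (j + 1) t := by
    intro j t ht
    have h2 : (2:ℝ) ^ (j + 1) * t - 1 ≤ 2 ^ (j + 1 + 1) * t - 1 := by
      rw [pow_succ (2:ℝ) (j + 1)]
      have : 0 ≤ (2:ℝ) ^ (j + 1) * t := by positivity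
      nlinarith
    exact Real.smoothTransition.monotone h2
  have hψlip : ∀ j t t', |ψ j t - ψ j t'| ≤ K * 2 ^ (j + 1) * |t - t'| := by
    intro j t t'
    refine (hK _ _).trans (le_of_eq ?_)
    rw [sub_sub_sub_cancel_right, ← mul_sub, abs_mul, abs_of_pos (by positivity : (0:ℝ) < 2 ^ (j + 1))]
    ring
  have hψ0 : ∀ j t, t ≤ (1/2 : ℝ) ^ (j + 1) → ψ j t = 0 := by
    intro j t ht
    refine Real.smoothTransition.zero_of_nonpos ?_
    have : (2:ℝ) ^ (j + 1) * t ≤ 2 ^ (j + 1) * (1/2 : ℝ) ^ (j + 1) := by gcongr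
    rw [← mul_pow] at this
    norm_num at this
    linarith
  set w : ℕ → ℝ → ℝ := fun j t => Nat.casesOn j (ψ 0 t) (fun i => ψ (i + 1) t - ψ i t) with hw
  have hw0 : ∀ t, w 0 t = ψ 0 t := fun t => rfl
  have hws : ∀ i t, w (i + 1) t = ψ (i + 1) t - ψ i t := fun i t => rfl
  have hsum : ∀ N t, ∑ j ∈ Finset.range (N + 1), w j t = ψ N t := by
    intro N t
    induction N with
    | zero => simp [hw0]
    | succ N ih => rw [Finset.sum_range_succ, ih, hws]; ring
  have hψC : ∀ j, ContDiff ℝ (⊤ : ℕ∞) (ψ j) := by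
    intro j
    exact Real.smoothTransition.contDiff.comp (by fun_prop)
  refine ⟨4 * K, w, by linarith, ?_, ?_, ?_, ?_, ?_, ?_⟩
  · intro j
    cases j with
    | zero => exact hψC 0
    | succ i => exact (hψC (i + 1)).sub (hψC i)
  · intro j t ht
    cases j with
    | zero => exact Real.smoothTransition.nonneg _
    | succ i => rw [hws]; linarith [hψmono i t ht]
  · intro N t
    cases N with
    | zero => simp
    | succ N => rw [hsum]; exact Real.smoothTransition.le_one _
  · intro j t _ h
    by_contra hcon
    push Not at hcon
    apply h
    cases j with
    | zero => exact hψ0 0 t hcon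
    | succ i =>
      rw [hws, hψ0 (i + 1) t hcon, hψ0 i t]
      · ring
      · refine hcon.trans ?_
        exact pow_le_pow_of_le_one (by norm_num) (by norm_num) (by omega)
  · intro j t t'
    cases j with
    | zero =>
      refine (hψlip 0 t t').trans ?_
      have := abs_nonneg (t - t')
      norm_num
      nlinarith [mul_nonneg (by linarith : (0:ℝ) ≤ K) this]
    | succ i =>
      have e : w (i + 1) t - w (i + 1) t' = (ψ (i + 1) t - ψ (i + 1) t') - (ψ i t - ψ i t') := by
        rw [hws, hws]; ring
      rw [e]
      refine (abs_sub _ _).trans ?_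
      have h1 := hψlip (i + 1) t t'
      have h2 := hψlip i t t'
      have h3 : 0 ≤ K * 2 ^ (i + 1) * |t - t'| := by positivity
      have h4 : K * 2 ^ (i + 1 + 1) * |t - t'| = 2 * (K * 2 ^ (i + 1) * |t - t'|) := by ring
      have h5 : 4 * K * 2 ^ (i + 1) * |t - t'| = 4 * (K * 2 ^ (i + 1) * |t - t'|) := by ring
      linarith
  · intro N t ht
    rw [hsum]
    refine Real.smoothTransition.one_of_one_le ?_
    have : (2:ℝ) ^ (N + 1) * (1/2 : ℝ) ^ N ≤ 2 ^ (N + 1) * t := by gcongr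
    rw [pow_succ, mul_right_comm, ← mul_pow] at this
    norm_num at this
    rw [pow_succ]
    linarith

theorem glue (E : Type*) [NormedAddCommGroup E] [NormedSpace ℝ E] :
    ∃ K : ℝ, 1 ≤ K ∧ ∀ (τ : E → ℝ) (g0 : E → E) (G : ℕ → E → E) (C η : ℝ), 0 ≤ C → 0 ≤ η →
    ContDiff ℝ (⊤ : ℕ∞) τ → (∀ x, 0 ≤ τ x) → (∀ x, τ x ≤ 1) → (∀ x y, |τ x - τ y| ≤ ‖x - y‖) →
    HLip C g0 → (∀ j, HLip C (G j)) → (∀ j x, ‖G j x - g0 x‖ ≤ η * (1/4) ^ j) →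
    ∃ g : E → E, HLip (C + K * η) g ∧ (∀ x, ‖g x - g0 x‖ ≤ K * η * τ x) ∧
      ∀ x, 0 < τ x → (∀ j, ContDiffAt ℝ (⊤ : ℕ∞) (G j) x) → ContDiffAt ℝ (⊤ : ℕ∞) g x ∧
        ∃ (N : ℕ) (a : ℕ → ℝ), (∀ j, 0 ≤ a j) ∧ (∑ j ∈ Finset.range N, a j = 1) ∧
          (∀ j, a j ≠ 0 → (1/2 : ℝ) ^ (j + 1) < τ x) ∧
          ‖fderiv ℝ g x - ∑ j ∈ Finset.range N, a j • fderiv ℝ (G j) x‖ ≤ K * η := by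
  obtain ⟨K, w, hK1, hwC, hw0, hwsum, hwlt, hwlip, hw1⟩ := glue_weights
  refine ⟨4 * K, by linarith, ?_⟩
  intro τ g0 G C η hC hη hτ hτ0 hτ1 hτl hg0 hG hclose
  -- partial sums
  set P : ℕ → E → E := fun N x => g0 x + ∑ j ∈ Finset.range N, w j (τ x) • (G j x - g0 x) with hP
  have hPstab : ∀ (x : E) (N M : ℕ), (τ x = 0 ∨ (1/2 : ℝ) ^ N < τ x) → N ≤ M → P (N + 1) x = P (M + 1) x := by
    intro x N M h hNM
    simp only [hP]
    congr 1
    refine Finset.sum_subset (Finset.range_subset_range.2 (by omega)) fun j _ hj => ?_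
    have hjN : N + 1 ≤ j := by simpa using hj
    have : w j (τ x) = 0 := by
      rcases h with h | h
      · by_contra h3
        have h2 := hwlt j _ (hτ0 x) h3
        rw [h] at h2
        have : (0:ℝ) < (1/2) ^ (j + 1) := by positivity
        linarith
      · -- the tail weights vanish since the partial sums are already `1`
        by_contra h3
        have s1 := hw1 N (τ x) h.le
        have s2 := hwsum (j + 1) (τ x)
        have s3 : ∑ i ∈ Finset.range (N + 1), w i (τ x) ≤ ∑ i ∈ Finset.range j, w i (τ x) :=
          Finset.sum_le_sum_of_subset_of_nonneg (Finset.range_subset_range.2 hjN) fun i _ _ => hw0 i _ (hτ0 x)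
        rw [Finset.sum_range_succ] at s2
        have s4 := hw0 j (τ x) (hτ0 x)
        exact h3 (le_antisymm (by linarith) s4)
    rw [this, zero_smul]
  have hNex : ∀ x, ∃ N : ℕ, τ x = 0 ∨ (1/2 : ℝ) ^ N < τ x := by
    intro x
    rcases (hτ0 x).eq_or_lt with h | h
    · exact ⟨0, Or.inl h.symm⟩
    · obtain ⟨N, hN⟩ := exists_pow_lt_of_lt_one h (by norm_num : (1/2 : ℝ) < 1)
      exact ⟨N, Or.inr hN⟩
  choose Nx hNx using hNex
  set g : E → E := fun x => P (Nx x + 1) x with hg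
  have hgP : ∀ x N, (τ x = 0 ∨ (1/2 : ℝ) ^ N < τ x) → g x = P (N + 1) x := by
    intro x N h
    change P (Nx x + 1) x = _
    rw [hPstab x (Nx x) (max (Nx x) N) (hNx x) (le_max_left _ _),
      hPstab x N (max (Nx x) N) h (le_max_right _ _)]
  have hgM : ∀ x M, Nx x ≤ M → g x = P (M + 1) x := fun x M h => hPstab x _ _ (hNx x) h
  have hpow : ∀ N, ∑ j ∈ Finset.range N, (2:ℝ) ^ j * (1/4) ^ j ≤ 2 := by
    intro N
    have : ∀ j, (2:ℝ) ^ j * (1/4) ^ j = (1/2) ^ j := by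
      intro j; rw [← mul_pow]; norm_num
    simp_rw [this]
    have := Summable.sum_le_tsum (Finset.range N) (fun i _ => by positivity) summable_geometric_two
    rwa [tsum_geometric_two] at this
  -- key variation estimate
  have hvar : ∀ N x y, ‖∑ j ∈ Finset.range N, (w j (τ x) - w j (τ y)) • (G j y - g0 y)‖ ≤ 4 * K * η * ‖x - y‖ := by
    intro N x y
    calc ‖∑ j ∈ Finset.range N, (w j (τ x) - w j (τ y)) • (G j y - g0 y)‖
        ≤ ∑ j ∈ Finset.range N, ‖(w j (τ x) - w j (τ y)) • (G j y - g0 y)‖ := norm_sum_le _ _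
      _ ≤ ∑ j ∈ Finset.range N, (K * ‖x - y‖ * η) * (2 ^ j * (1/4) ^ j) := by
          refine Finset.sum_le_sum fun j _ => ?_
          rw [norm_smul, Real.norm_eq_abs]
          have h1 := (hwlip j (τ x) (τ y)).trans (mul_le_mul_of_nonneg_left (hτl x y) (by positivity))
          have h2 := hclose j y
          calc _ ≤ (K * 2 ^ j * ‖x - y‖) * (η * (1/4) ^ j) := by gcongr
            _ = _ := by ring
      _ = (K * ‖x - y‖ * η) * ∑ j ∈ Finset.range N, (2 ^ j * (1/4) ^ j) := by rw [Finset.mul_sum]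
      _ ≤ (K * ‖x - y‖ * η) * 2 := by
          refine mul_le_mul_of_nonneg_left (hpow N) (by positivity)
      _ ≤ _ := by
          have : 0 ≤ K * ‖x - y‖ * η := by positivity
          nlinarith
  refine ⟨g, ?_, ?_, ?_⟩
  · intro x y
    set M := max (Nx x) (Nx y) + 1 with hM
    rw [hgM x _ (le_max_left _ (Nx y)), hgM y _ (le_max_right (Nx x) _), ← hM]
    set A : E := (g0 x - g0 y) - (1/2 : ℝ) • (x - y) with hA
    have e : P M x - P M y - (1/2 : ℝ) • (x - y) =
        ((1 - ∑ j ∈ Finset.range M, w j (τ x)) • A +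
          ∑ j ∈ Finset.range M, w j (τ x) • ((G j x - G j y) - (1/2 : ℝ) • (x - y))) +
        ∑ j ∈ Finset.range M, (w j (τ x) - w j (τ y)) • (G j y - g0 y) := by
      have this : ∀ j, (w j (τ x) • ((G j x - G j y) - (1/2 : ℝ) • (x - y)) +
        (w j (τ x) - w j (τ y)) • (G j y - g0 y)) - w j (τ x) • A = w j (τ x) • (G j x - g0 x) - w j (τ y) • (G j y - g0 y) := by
        intro j
        rw [hA]
        module
      have t2 := Finset.sum_congr (rfl : Finset.range M = Finset.range M) (fun j _ => this j)
      rw [Finset.sum_sub_distrib, Finset.sum_add_distrib, Finset.sum_sub_distrib (f := fun j => w j (τ x) • (G j x - g0 x)), ← Finset.sum_smul] at t2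
      rw [sub_smul, one_smul]
      simp only [hP]
      have t3 : g0 x + ∑ j ∈ Finset.range M, w j (τ x) • (G j x - g0 x) -
          (g0 y + ∑ j ∈ Finset.range M, w j (τ y) • (G j y - g0 y)) - (1/2 : ℝ) • (x - y) =
          A + (∑ j ∈ Finset.range M, w j (τ x) • (G j x - g0 x) - ∑ j ∈ Finset.range M, w j (τ y) • (G j y - g0 y)) := by
        rw [hA]; abel
      rw [t3, ← t2]
      abel
    rw [e]
    refine (norm_add_le _ _).trans ?_
    rw [add_mul]
    refine add_le_add ?_ (hvar M x y)
    refine (norm_add_le _ _).trans ?_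
    have h1 : 0 ≤ 1 - ∑ j ∈ Finset.range M, w j (τ x) := by linarith [hwsum M (τ x)]
    have h2 : ‖(1 - ∑ j ∈ Finset.range M, w j (τ x)) • A‖ ≤ (1 - ∑ j ∈ Finset.range M, w j (τ x)) * (C * ‖x - y‖) := by
      rw [norm_smul, Real.norm_of_nonneg h1]
      exact mul_le_mul_of_nonneg_left (hg0 x y) h1
    have h3 : ‖∑ j ∈ Finset.range M, w j (τ x) • ((G j x - G j y) - (1/2 : ℝ) • (x - y))‖ ≤
        (∑ j ∈ Finset.range M, w j (τ x)) * (C * ‖x - y‖) := by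
      rw [Finset.sum_mul]
      refine (norm_sum_le _ _).trans (Finset.sum_le_sum fun j _ => ?_)
      rw [norm_smul, Real.norm_of_nonneg (hw0 j _ (hτ0 x))]
      exact mul_le_mul_of_nonneg_left (hG j x y) (hw0 j _ (hτ0 x))
    linarith
  · intro x
    have e : g x - g0 x = ∑ j ∈ Finset.range (Nx x + 1), w j (τ x) • (G j x - g0 x) := by
      simp only [hg, hP]; abel
    rw [e]
    calc _ ≤ ∑ j ∈ Finset.range (Nx x + 1), ‖w j (τ x) • (G j x - g0 x)‖ := norm_sum_le _ _
      _ ≤ ∑ j ∈ Finset.range (Nx x + 1), w j (τ x) * (4 * η * τ x) := by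
          refine Finset.sum_le_sum fun j _ => ?_
          have h0 := hw0 j _ (hτ0 x)
          rw [norm_smul, Real.norm_of_nonneg h0]
          by_cases hz : w j (τ x) = 0
          · rw [hz]; simp
          · refine mul_le_mul_of_nonneg_left ((hclose j x).trans ?_) h0
            have h1 := hwlt j _ (hτ0 x) hz
            have h2 : ((1:ℝ)/4) ^ j = 4 * ((1/2) ^ (j + 1)) ^ 2 := by
              rw [← pow_mul, mul_comm (j + 1) 2, pow_mul]; norm_num [pow_succ]
              ring
            have h3 : ((1/2 : ℝ) ^ (j + 1)) ^ 2 ≤ τ x := by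
              have : (0:ℝ) < (1/2) ^ (j + 1) := by positivity
              nlinarith [hτ1 x]
            rw [h2]
            nlinarith
      _ = (∑ j ∈ Finset.range (Nx x + 1), w j (τ x)) * (4 * η * τ x) := by rw [Finset.sum_mul]
      _ ≤ 1 * (4 * η * τ x) := by
          refine mul_le_mul_of_nonneg_right (hwsum _ _) ?_
          have := hτ0 x; positivity
      _ ≤ _ := by
          have : 0 ≤ η * τ x := mul_nonneg hη (hτ0 x)
          nlinarith
  · intro x hx hGx
    obtain ⟨N, hN⟩ := exists_pow_lt_of_lt_one hx (by norm_num : (1/2 : ℝ) < 1)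
    have hev : ∀ᶠ y in 𝓝 x, (1/2 : ℝ) ^ N < τ y :=
      hτ.continuous.continuousAt.eventually (lt_mem_nhds hN)
    have hgev : ∀ y, (1/2 : ℝ) ^ N < τ y → g y = ∑ j ∈ Finset.range (N + 1), w j (τ y) • G j y := by
      intro y hy
      rw [hgP y N (Or.inr hy)]
      simp only [hP, smul_sub, Finset.sum_sub_distrib]
      rw [← Finset.sum_smul, hw1 N (τ y) hy.le, one_smul]; abel
    have hgeq : g =ᶠ[𝓝 x] fun y => ∑ j ∈ Finset.range (N + 1), w j (τ y) • G j y :=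
      hev.mono hgev
    have hgC : ContDiffAt ℝ (⊤ : ℕ∞) g x := by
      refine ContDiffAt.congr_of_eventuallyEq ?_ hgeq
      refine ContDiffAt.sum fun j _ => ?_
      exact ((hwC j).contDiffAt.comp x hτ.contDiffAt).smul (hGx j)
    refine ⟨hgC, N + 1, fun j => w j (τ x), fun j => hw0 j _ (hτ0 x), hw1 N _ hN.le, fun j hj => hwlt j _ (hτ0 x) hj, ?_⟩
    have hd : HasFDerivAt (fun y => g y - ∑ j ∈ Finset.range (N + 1), w j (τ x) • G j y)
        (fderiv ℝ g x - ∑ j ∈ Finset.range (N + 1), w j (τ x) • fderiv ℝ (G j) x) x := by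
      refine HasFDerivAt.sub (hgC.differentiableAt (by simp)).hasFDerivAt ?_
      refine HasFDerivAt.fun_sum fun j _ => ?_
      exact ((hGx j).differentiableAt (by simp)).hasFDerivAt.const_smul _
    refine hd.le_of_lip' (by positivity) ?_
    filter_upwards [hev] with y hy
    rw [hgev y hy, hgev x hN, sub_self, sub_zero, ← Finset.sum_sub_distrib]
    have h5 := hvar (N + 1) y x
    have h6 : ∑ j ∈ Finset.range (N + 1), (w j (τ y) • G j y - w j (τ x) • G j y) =
        ∑ j ∈ Finset.range (N + 1), (w j (τ y) - w j (τ x)) • (G j y - g0 y) := by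
      have : ∀ j, (w j (τ y) - w j (τ x)) • (G j y - g0 y) = (w j (τ y) • G j y - w j (τ x) • G j y) -
        (w j (τ y) • g0 y - w j (τ x) • g0 y) := by intro j; module
      simp_rw [this]
      rw [Finset.sum_sub_distrib (f := fun j => w j (τ y) • G j y - w j (τ x) • G j y), Finset.sum_sub_distrib (f := fun j => w j (τ y) • g0 y),
        ← Finset.sum_smul, ← Finset.sum_smul, hw1 N _ hy.le, hw1 N _ hN.le, sub_self, sub_zero]
    rw [h6]
    have h7 := hvar (N + 1) x y
    have h8 : ∑ j ∈ Finset.range (N + 1), (w j (τ y) - w j (τ x)) • (G j y - g0 y) =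
       -∑ j ∈ Finset.range (N + 1), (w j (τ x) - w j (τ y)) • (G j y - g0 y) := by
      rw [← Finset.sum_neg_distrib]
      refine Finset.sum_congr rfl fun j _ => by module
    rw [h8, norm_neg, norm_sub_rev y x]
    exact h7

theorem ctr_sub {n : ℕ} (A B : EuclideanSpace ℝ (Fin n) →L[ℝ] EuclideanSpace ℝ (Fin n)) :
    ctr (A - B) = ctr A - ctr B := by
  simp only [ctr, sub_apply, inner_sub_left, Finset.sum_sub_distrib]

theorem ctr_sum {n : ℕ} (N : ℕ) (a : ℕ → ℝ) (A : ℕ → EuclideanSpace ℝ (Fin n) →L[ℝ] EuclideanSpace ℝ (Fin n)) :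
    ctr (∑ j ∈ Finset.range N, a j • A j) = ∑ j ∈ Finset.range N, a j * ctr (A j) := by
  simp only [ctr, sum_apply, smul_apply, sum_inner, real_inner_smul_left,
    Finset.mul_sum]
  rw [Finset.sum_comm]

theorem abs_ctr_le {n : ℕ} (A : EuclideanSpace ℝ (Fin n) →L[ℝ] EuclideanSpace ℝ (Fin n)) :
    |ctr A| ≤ n * ‖A‖ := by
  unfold ctr
  refine (Finset.abs_sum_le_sum_abs _ _).trans ?_
  have : ∀ i ∈ (Finset.univ : Finset (Fin n)), |⟪A (EuclideanSpace.single i 1), EuclideanSpace.single i (1:ℝ)⟫| ≤ ‖A‖ := by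
    intro i _
    refine (abs_real_inner_le_norm _ _).trans ?_
    have h := A.le_opNorm (EuclideanSpace.single i (1:ℝ))
    simp only [PiLp.norm_single, norm_one, mul_one] at h ⊢
    exact h
  refine (Finset.sum_le_sum this).trans ?_
  simp

theorem ctr_avg_ge {n : ℕ} (N : ℕ) (a : ℕ → ℝ) (A : ℕ → EuclideanSpace ℝ (Fin n) →L[ℝ] EuclideanSpace ℝ (Fin n))
    (D : EuclideanSpace ℝ (Fin n) →L[ℝ] EuclideanSpace ℝ (Fin n)) (c e : ℝ)
    (ha : ∀ j, 0 ≤ a j) (hs : ∑ j ∈ Finset.range N, a j = 1) (hA : ∀ j, a j ≠ 0 → c ≤ ctr (A j))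
    (hD : ‖D - ∑ j ∈ Finset.range N, a j • A j‖ ≤ e) : c - n * e ≤ ctr D := by
  have h1 := (abs_ctr_le (D - ∑ j ∈ Finset.range N, a j • A j)).trans (mul_le_mul_of_nonneg_left hD (Nat.cast_nonneg n))
  rw [ctr_sub, ctr_sum] at h1
  have h2 : c ≤ ∑ j ∈ Finset.range N, a j * ctr (A j) := by
    calc c = ∑ j ∈ Finset.range N, a j * c := by rw [← Finset.sum_mul, hs, one_mul]
      _ ≤ _ := by
        refine Finset.sum_le_sum fun j _ => ?_
        by_cases h : a j = 0
        · simp [h]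
        · exact mul_le_mul_of_nonneg_left (hA j h) (ha j)
  have := (abs_le.1 h1).1
  linarith

theorem d3_open {n : ℕ} (hn : 0 < n) (O : Set (EuclideanSpace ℝ (Fin n))) (hO : IsOpen O) (ε δ : ℝ) (hε : 0 < ε)
    (hδ : 0 < δ) (hvol : volume O < ENNReal.ofReal (ε ^ n / 4)) :
    ∃ p : EuclideanSpace ℝ (Fin n) → EuclideanSpace ℝ (Fin n), HLip (1/2 + δ) p ∧ (∀ x, ‖p x‖ ≤ √n * ε + δ) ∧
      ∀ x ∈ O, ContDiffAt ℝ (⊤ : ℕ∞) p x ∧ cc n - δ ≤ ctr (fderiv ℝ p x) := by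
  obtain ⟨K, hK, hglue⟩ := glue (EuclideanSpace ℝ (Fin n))
  obtain ⟨g, hg1, hg2, hg3⟩ := c6_main hn O hO ε hε hvol
  have hs : ∀ z : EuclideanSpace ℝ (Fin n), ∃ s : ℝ, z ∈ O → 0 < s ∧ s ≤ 1 ∧ ball z (2 * s) ⊆ O := by
    intro z
    by_cases hz : z ∈ O
    · obtain ⟨r, hr, hb⟩ := Metric.isOpen_iff.1 hO z hz
      refine ⟨min (r/2) 1, fun _ => ⟨by positivity, min_le_right _ _, (ball_subset_ball ?_).trans hb⟩⟩
      linarith [min_le_left (r/2) 1]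
    · exact ⟨0, fun h => absurd h hz⟩
  choose s hs using hs
  obtain ⟨σ, hσC, hσ0, hσ1, hσl, hσpos, hσz⟩ := d_tol O s (fun z hz => (hs z hz).1) (fun z hz => (hs z hz).2.1) 1
    one_pos le_rfl
  set η : ℝ := δ / (K * (n + 1)) with hη
  have hn1 : (1:ℝ) ≤ n + 1 := by have : (0:ℝ) ≤ n := Nat.cast_nonneg n; linarith
  have hK0 : 0 < K := by linarith
  have hη0 : 0 < η := by positivity
  have hKη : K * η = δ / (n + 1) := by rw [hη]; field_simp
  have hKη1 : K * η ≤ δ := by rw [hKη]; exact div_le_self hδ.le hn1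
  have hKη2 : n * (K * η) ≤ δ := by
    rw [hKη, mul_div_assoc', div_le_iff₀ (by linarith)]; nlinarith
  have hr : ∀ j : ℕ, 0 < min (η * (1/4) ^ j) ((1/2 : ℝ) ^ (j + 2)) := fun j => by positivity
  choose u huC hu1 hu2 hu3 using fun j : ℕ => hg3 _ (hr j)
  obtain ⟨p, hp1, hp2, hp3⟩ := hglue σ g u (1/2) η (by norm_num) hη0.le hσC hσ0 hσ1 (by simpa using hσl) hg2 hu2
    (fun j x => (hu1 j x).trans (min_le_left _ _))
  refine ⟨p, ?_, ?_, ?_⟩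
  · intro x y
    refine (hp1 x y).trans ?_
    gcongr
  · intro x
    have h1 := hp2 x
    have h2 : K * η * σ x ≤ δ := by
      have := mul_le_mul hKη1 (hσ1 x) (hσ0 x) hδ.le
      linarith
    have h3 := norm_add_le (g x) (p x - g x)
    rw [add_sub_cancel] at h3
    linarith [hg1 x]
  · intro x hx
    obtain ⟨hpC, N, a, ha0, ha1, ha2, ha3⟩ := hp3 x (hσpos x hx) (fun j => (huC j).contDiffAt)
    refine ⟨hpC, ?_⟩
    have := ctr_avg_ge N a _ _ (cc n) _ ha0 ha1 (fun j hj => ?_) ha3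
    · linarith
    · refine hu3 j x ?_
      obtain ⟨z, hz, hxz, hσz⟩ := hσz x (hσpos x hx)
      refine Subset.trans ?_ (hs z hz).2.2
      intro y hy
      have h1 := ha2 j hj
      have h2 : dist y x ≤ (1/2 : ℝ) ^ (j + 2) := (mem_closedBall.1 hy).trans (min_le_right _ _)
      have h3 : (1/2 : ℝ) ^ (j + 2) ≤ (1/2 : ℝ) ^ (j + 1) := pow_le_pow_of_le_one (by norm_num) (by norm_num) (by omega)
      rw [mem_ball]
      have := dist_triangle y x z
      rw [dist_eq_norm x z] at this
      linarith

theorem lemG {n : ℕ} (hn : 0 < n) (T : Set (EuclideanSpace ℝ (Fin n))) (hT : volume T = 0)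
    (τ : EuclideanSpace ℝ (Fin n) → ℝ) (hτC : ContDiff ℝ (⊤ : ℕ∞) τ) (hτ0 : ∀ x, 0 ≤ τ x) (hτ1 : ∀ x, τ x ≤ 1)
    (hτl : ∀ x y, |τ x - τ y| ≤ ‖x - y‖) (η : ℝ) (hη : 0 < η) :
    ∃ g : EuclideanSpace ℝ (Fin n) → EuclideanSpace ℝ (Fin n), (∀ x, ‖g x‖ ≤ τ x) ∧ HLip (1/2 + η) g ∧
      ∀ x ∈ T, 0 < τ x → ContDiffAt ℝ (⊤ : ℕ∞) g x ∧ cc n / 2 ≤ ctr (fderiv ℝ g x) := by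
  obtain ⟨K, hK, hglue⟩ := glue (EuclideanSpace ℝ (Fin n))
  have hn0 : (0:ℝ) < n := by exact_mod_cast hn
  have hcc : 0 < cc n := by unfold cc; positivity
  set c : ℝ := cc n with hc
  set e : ℝ := min (min (η / (2 * K)) (1 / K)) (c / (4 * (n * K))) with he
  have he0 : 0 < e := by positivity
  have e1 : K * e ≤ η / 2 := by
    have : e ≤ η / (2 * K) := (min_le_left _ _).trans (min_le_left _ _)
    rw [le_div_iff₀ (by positivity)] at this; linarith
  have e2 : K * e ≤ 1 := by
    have : e ≤ 1 / K := (min_le_left _ _).trans (min_le_right _ _)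
    rw [le_div_iff₀ (by positivity)] at this; linarith
  have e3 : n * (K * e) ≤ c / 4 := by
    have : e ≤ c / (4 * (n * K)) := (min_le_right _ _)
    rw [le_div_iff₀ (by positivity)] at this; linarith
  set δ : ℕ → ℝ := fun i => min (e * (1/4) ^ i / 2) (min (η / 2) (c / 4)) with hδ
  set ε : ℕ → ℝ := fun i => e * (1/4) ^ i / (2 * √n) with hε
  have hδ0 : ∀ i, 0 < δ i := fun i => by simp only [hδ]; positivity
  have hε0 : ∀ i, 0 < ε i := fun i => by simp only [hε]; positivity
  have hO : ∀ i : ℕ, ∃ O, T ⊆ O ∧ IsOpen O ∧ volume O < ENNReal.ofReal (ε i ^ n / 4) := by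
    intro i
    refine Set.exists_isOpen_lt_of_lt T _ ?_
    rw [hT]
    have := hε0 i
    exact ENNReal.ofReal_pos.2 (by positivity)
  choose O hTO hOo hOv using hO
  choose p hp1 hp2 hp3 using fun i => d3_open hn (O i) (hOo i) (ε i) (δ i) (hε0 i) (hδ0 i) (hOv i)
  have hd1 : ∀ i, δ i ≤ η / 2 := fun i => (min_le_right _ _).trans (min_le_left _ _)
  have hd2 : ∀ i, δ i ≤ c / 4 := fun i => (min_le_right _ _).trans (min_le_right _ _)
  have hgl := hglue τ (fun _ => 0) p (1/2 + η / 2) e (by positivity) he0.le hτC hτ0 hτ1 hτl ?_ ?_ ?_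
  obtain ⟨g, hg1, hg2, hg3⟩ := hgl
  · refine ⟨g, ?_, ?_, ?_⟩
    · intro x
      have h1 := hg2 x
      rw [sub_zero] at h1
      refine h1.trans ?_
      have := mul_le_mul_of_nonneg_right e2 (hτ0 x)
      linarith
    · intro x y
      exact (hg1 x y).trans (mul_le_mul_of_nonneg_right (by linarith) (norm_nonneg _))
    · intro x hx hτx
      obtain ⟨hgC, N, a, ha0, ha1, ha2, ha3⟩ := hg3 x hτx (fun j => (hp3 j x (hTO j hx)).1)
      refine ⟨hgC, ?_⟩
      have := ctr_avg_ge N a _ _ (c - c / 4) _ ha0 ha1 (fun j hj => ?_) ha3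
      · linarith
      · have h1 := (hp3 j x (hTO j hx)).2
        linarith [hd2 j]
  · intro x y
    simp only [sub_self, zero_sub, norm_neg, norm_smul]
    rw [Real.norm_of_nonneg (by norm_num)]
    exact mul_le_mul_of_nonneg_right (by linarith) (norm_nonneg _)
  · intro j x y
    refine (hp1 j x y).trans ?_
    gcongr
    exact hd1 j
  · intro j x
    rw [sub_zero]
    refine (hp2 j x).trans ?_
    have h1 : √n * ε j = e * (1/4) ^ j / 2 := by
      simp only [hε]
      have : (0:ℝ) < √n := by positivity
      field_simp
    have h2 : δ j ≤ e * (1/4) ^ j / 2 := min_le_left _ _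
    linarith

section S1
variable {E F : Type*} [NormedAddCommGroup E] [InnerProductSpace ℝ E] [CompleteSpace E]
  [NormedAddCommGroup F] [InnerProductSpace ℝ F] [CompleteSpace F]

/-- the perturbation direction -/
def bet (ρ : ℝ) (N L : E →L[ℝ] F) : E →L[ℝ] F :=
  -L + ρ • N - ρ⁻¹ • (L ∘L (ContinuousLinearMap.adjoint L ∘L N))

theorem bet_apply (ρ : ℝ) (N L : E →L[ℝ] F) (w : E) :
    bet ρ N L w = -L w + ρ • N w - ρ⁻¹ • L (ContinuousLinearMap.adjoint L (N w)) := rfl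

theorem s1_alg (L N : E →L[ℝ] F) (hL : ‖L‖ ≤ 1) (hN : ‖N‖ ≤ 1) (v w : E) (η : ℝ) (hη : 0 ≤ η)
    (hw : ‖w‖ ^ 2 ≤ ⟪w, v⟫ + η * ‖v‖ ^ 2) :
    ‖L v + (1/8 : ℝ) • bet 1 N L w‖ ≤ (1 + η) * ‖v‖ := by
  set Ls := ContinuousLinearMap.adjoint L with hLs
  have hLv : ∀ u, ‖L u‖ ≤ ‖u‖ := fun u => by simpa using L.le_of_opNorm_le hL u
  have hNv : ∀ u, ‖N u‖ ≤ ‖u‖ := fun u => by simpa using N.le_of_opNorm_le hN u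
  have hLsv : ∀ u, ‖Ls u‖ ≤ ‖u‖ := fun u => by
    have : ‖Ls‖ ≤ 1 := by rw [hLs, LinearIsometryEquiv.norm_map]; exact hL
    simpa using Ls.le_of_opNorm_le this u
  set B : F := bet 1 N L w with hB
  have hBe : B = -L w + N w - L (Ls (N w)) := by rw [hB, bet_apply]; simp [hLs]
  have hBn : ‖B‖ ≤ 3 * ‖w‖ := by
    rw [hBe]
    have h1 := norm_sub_le (-L w + N w) (L (Ls (N w)))
    have h2 := norm_add_le (-L w) (N w)
    rw [norm_neg] at h2
    have := hLv w; have := hNv w; have := hLv (Ls (N w)); have := hLsv (N w)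
    linarith
  set d : E := v - Ls (L v) with hd
  have adj : ∀ (u : E) (z : F), ⟪L u, z⟫ = ⟪u, Ls z⟫ := fun u z => (ContinuousLinearMap.adjoint_inner_right L u z).symm
  have adj' : ∀ (z : F) (u : E), ⟪Ls z, u⟫ = ⟪z, L u⟫ := fun z u => ContinuousLinearMap.adjoint_inner_left L u z
  have hin : ⟪L v, B⟫ = -⟪w, v⟫ + ⟪d, w + Ls (N w)⟫ := by
    rw [hBe, inner_sub_right, inner_add_right, inner_neg_right, hd, inner_sub_left, inner_add_right, inner_add_right,
      adj', adj', adj v (N w), real_inner_comm v w]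
    ring
  have hd2 : ‖d‖ ^ 2 ≤ ‖v‖ ^ 2 - ‖L v‖ ^ 2 := by
    rw [hd, norm_sub_sq_real, ← adj, real_inner_self_eq_norm_sq]
    have := hLsv (L v)
    have : ‖Ls (L v)‖ ^ 2 ≤ ‖L v‖ ^ 2 := by gcongr
    linarith
  have hin2 : ⟪d, w + Ls (N w)⟫ ≤ 2 * (‖d‖ * ‖w‖) := by
    have h1 := real_inner_le_norm d (w + Ls (N w))
    have h2 : ‖w + Ls (N w)‖ ≤ 2 * ‖w‖ := by
      have := norm_add_le w (Ls (N w)); have := hLsv (N w); have := hNv w; linarith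
    have := mul_le_mul_of_nonneg_left h2 (norm_nonneg d)
    linarith
  have hsq : ‖L v + (1/8 : ℝ) • B‖ ^ 2 ≤ (1 + η) * ‖v‖ ^ 2 := by
    rw [norm_add_sq_real, real_inner_smul_right, norm_smul, Real.norm_of_nonneg (by norm_num), hin]
    have hB2 : ‖B‖ ^ 2 ≤ 9 * ‖w‖ ^ 2 := by
      have := norm_nonneg B; nlinarith
    nlinarith [sq_nonneg (‖d‖ - ‖w‖ / 4), sq_nonneg ‖w‖, sq_nonneg ‖d‖, mul_nonneg hη (sq_nonneg ‖v‖)]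
  refine abs_le_of_sq_le_sq' ?_ (by positivity) |>.2
  have : (1 + η) * ‖v‖ ^ 2 ≤ ((1 + η) * ‖v‖) ^ 2 := by
    rw [mul_pow]
    have : 1 + η ≤ (1 + η) ^ 2 := by nlinarith
    gcongr
  linarith

theorem bet_scale (ρ : ℝ) (hρ : 0 < ρ) (N L : E →L[ℝ] F) : bet ρ N L = ρ • bet 1 N (ρ⁻¹ • L) := by
  ext w
  simp only [bet_apply, smul_apply, map_smulₛₗ, LinearIsometryEquiv.map_smulₛₗ, inv_one, one_smul]
  simp only [map_smul, smul_add, smul_sub, smul_neg, smul_smul]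
  have h1 : ρ * ρ⁻¹ = 1 := mul_inv_cancel₀ hρ.ne'
  have h2 : ρ * (ρ⁻¹ * ρ⁻¹) = ρ⁻¹ := by rw [← mul_assoc, h1, one_mul]
  simp [h1, h2]

theorem s1_rho (ρ : ℝ) (hρ : 0 < ρ) (L N : E →L[ℝ] F) (hL : ‖L‖ ≤ ρ) (hN : ‖N‖ ≤ 1) (v w : E) (η : ℝ) (hη : 0 ≤ η)
    (hw : ‖w‖ ^ 2 ≤ ⟪w, v⟫ + η * ‖v‖ ^ 2) :
    ‖L v + (1/8 : ℝ) • bet ρ N L w‖ ≤ ρ * ((1 + η) * ‖v‖) := by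
  have h1 : ‖ρ⁻¹ • L‖ ≤ 1 := by
    rw [norm_smul, Real.norm_of_nonneg (by positivity), inv_mul_le_iff₀ hρ]; simpa using hL
  have h := s1_alg (ρ⁻¹ • L) N h1 hN v w η hη hw
  have e : L v + (1/8 : ℝ) • bet ρ N L w = ρ • ((ρ⁻¹ • L) v + (1/8 : ℝ) • bet 1 N (ρ⁻¹ • L) w) := by
    rw [bet_scale ρ hρ]
    simp only [smul_apply, smul_add, smul_smul, mul_inv_cancel₀ hρ.ne', one_smul]
    rw [mul_comm]
  rw [e, norm_smul, Real.norm_of_nonneg hρ.le]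
  exact mul_le_mul_of_nonneg_left h hρ.le

theorem bet_norm (ρ : ℝ) (hρ : 1 ≤ ρ) (hρ2 : ρ ≤ 2) (L N : E →L[ℝ] F) (hL : ‖L‖ ≤ ρ) (hN : ‖N‖ ≤ 1) :
    ‖bet ρ N L‖ ≤ 6 := by
  unfold bet
  have h1 := norm_sub_le (-L + ρ • N) (ρ⁻¹ • (L ∘L (ContinuousLinearMap.adjoint L ∘L N)))
  have h2 := norm_add_le (-L) (ρ • N)
  rw [norm_neg, norm_smul, Real.norm_of_nonneg (by linarith)] at h2
  have h3 : ‖ρ⁻¹ • (L ∘L (ContinuousLinearMap.adjoint L ∘L N))‖ ≤ ρ := by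
    rw [norm_smul, Real.norm_of_nonneg (by positivity), inv_mul_le_iff₀ (by linarith)]
    refine (ContinuousLinearMap.opNorm_comp_le _ _).trans ?_
    have : ‖ContinuousLinearMap.adjoint L ∘L N‖ ≤ ρ := by
      refine (ContinuousLinearMap.opNorm_comp_le _ _).trans ?_
      rw [LinearIsometryEquiv.norm_map]
      calc _ ≤ ρ * 1 := by gcongr
        _ = ρ := mul_one _
    gcongr
  have h4 : ρ * ‖N‖ ≤ ρ * 1 := by gcongr
  linarith

/-- nondegeneracy -/
theorem bet_lower (ρ : ℝ) (hρ : 1 ≤ ρ) (L N : E →L[ℝ] F) (hN : ‖N‖ ≤ 1)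
    (hNN : ∀ v, ContinuousLinearMap.adjoint N (N v) = v)
    (hNL : ∀ v, ‖ContinuousLinearMap.adjoint N (L v)‖ ≤ 1/4 * ‖v‖) (v : E) :
    1/2 * ‖v‖ ≤ ‖bet ρ N L v‖ := by
  set Ns := ContinuousLinearMap.adjoint N with hNs
  set Ls := ContinuousLinearMap.adjoint L with hLs
  have h1 : ‖Ls (N v)‖ ≤ 1/4 * ‖v‖ := by
    by_cases h0 : ‖Ls (N v)‖ = 0
    · rw [h0]; positivity
    have hpos : 0 < ‖Ls (N v)‖ := lt_of_le_of_ne (norm_nonneg _) (Ne.symm h0)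
    have : ‖Ls (N v)‖ ^ 2 ≤ 1/4 * ‖v‖ * ‖Ls (N v)‖ := by
      rw [← real_inner_self_eq_norm_sq, hLs, ContinuousLinearMap.adjoint_inner_left, ← ContinuousLinearMap.adjoint_inner_right]
      refine (real_inner_le_norm _ _).trans ?_
      rw [← hLs, ← hNs]
      have := hNL (Ls (N v))
      have := mul_le_mul_of_nonneg_left this (norm_nonneg v)
      linarith
    rw [pow_two] at this
    exact le_of_mul_le_mul_right this hpos
  have h2 : Ns (bet ρ N L v) = ρ • v - (Ns (L v) + ρ⁻¹ • Ns (L (Ls (N v)))) := by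
    rw [bet_apply]
    simp only [map_sub, map_add, map_neg, map_smul]
    rw [hNN]; abel
  have h3 : ‖Ns (bet ρ N L v)‖ ≤ ‖bet ρ N L v‖ := by
    have : ‖Ns‖ ≤ 1 := by rw [hNs, LinearIsometryEquiv.norm_map]; exact hN
    simpa using Ns.le_of_opNorm_le this (bet ρ N L v)
  have h4 := norm_sub_norm_le (ρ • v) (Ns (L v) + ρ⁻¹ • Ns (L (Ls (N v))))
  rw [← h2, norm_smul, Real.norm_of_nonneg (by linarith)] at h4
  have h5 := norm_add_le (Ns (L v)) (ρ⁻¹ • Ns (L (Ls (N v))))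
  have h6 : ‖ρ⁻¹ • Ns (L (Ls (N v)))‖ ≤ 1/4 * (1/4 * ‖v‖) := by
    rw [norm_smul, Real.norm_of_nonneg (by positivity)]
    have h7 := hNL (Ls (N v))
    have h8 : ρ⁻¹ ≤ 1 := inv_le_one_of_one_le₀ hρ
    calc _ ≤ 1 * (1/4 * (1/4 * ‖v‖)) := by
          refine mul_le_mul h8 (h7.trans ?_) (norm_nonneg _) zero_le_one
          gcongr
      _ = _ := one_mul _
  have h9 := hNL v
  have h10 : ‖v‖ ≤ ρ * ‖v‖ := by nlinarith [norm_nonneg v]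
  linarith [norm_nonneg v]

theorem HLip.sq {g : E → E} {η : ℝ} (h0 : 0 ≤ η) (h1 : η ≤ 1) (hg : HLip (1/2 + η) g) (x y : E) :
    ‖g y - g x‖ ^ 2 ≤ ⟪g y - g x, y - x⟫ + 2 * η * ‖y - x‖ ^ 2 := by
  have h := hg y x
  have h2 : ‖(g y - g x) - (1/2 : ℝ) • (y - x)‖ ^ 2 ≤ ((1/2 + η) * ‖y - x‖) ^ 2 := by gcongr
  rw [norm_sub_sq_real, real_inner_smul_right, norm_smul, Real.norm_of_nonneg (by norm_num)] at h2
  nlinarith [mul_nonneg (mul_nonneg h0 (sub_nonneg.2 h1)) (sq_nonneg ‖y - x‖)]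

end S1

/-- smoothness of `bet` along a smooth map -/
theorem bet_contDiffAt {n : ℕ} {F : Type*} [NormedAddCommGroup F] [InnerProductSpace ℝ F] [CompleteSpace F]
    (ρ : ℝ) (N : EuclideanSpace ℝ (Fin n) →L[ℝ] F) (L : EuclideanSpace ℝ (Fin n) → EuclideanSpace ℝ (Fin n) →L[ℝ] F)
    (x : EuclideanSpace ℝ (Fin n)) (hL : ContDiffAt ℝ (⊤ : ℕ∞) L x) :
    ContDiffAt ℝ (⊤ : ℕ∞) (fun y => bet ρ N (L y)) x := by
  have key : ContDiff ℝ (⊤ : ℕ∞) (fun M : EuclideanSpace ℝ (Fin n) →L[ℝ] F => bet ρ N M) := by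
    rw [contDiff_clm_apply_iff]
    intro w
    simp only [bet_apply]
    have hLw : ∀ u, ContDiff ℝ (⊤ : ℕ∞) (fun M : EuclideanSpace ℝ (Fin n) →L[ℝ] F => M u) :=
      fun u => contDiff_id.clm_apply contDiff_const
    refine ((hLw w).neg.add contDiff_const).sub (ContDiff.const_smul _ (contDiff_id.clm_apply ?_))
    rw [contDiff_euclidean]
    intro i
    have : (fun M : EuclideanSpace ℝ (Fin n) →L[ℝ] F => (ContinuousLinearMap.adjoint M (N w)) i) =
        fun M => ⟪M (EuclideanSpace.single i 1), N w⟫ := by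
      funext y
      rw [← ContinuousLinearMap.adjoint_inner_right]
      simp [EuclideanSpace.inner_single_left]
    rw [this]
    exact (hLw _).inner ℝ contDiff_const
  exact key.contDiffAt.comp x hL

/-- `x` is `γ`-spanning relative to `R` -/
def Spanning {n : ℕ} (R : Set (EuclideanSpace ℝ (Fin n))) (γ : ℝ) (x : EuclideanSpace ℝ (Fin n)) : Prop :=
  ∀ r : ℝ, 0 < r → ∀ a : EuclideanSpace ℝ (Fin n), ∃ y ∈ R, 0 < ‖y - x‖ ∧ ‖y - x‖ < r ∧
    γ * ‖a‖ * ‖y - x‖ ≤ |⟪a, y - x⟫|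

theorem Spanning.unif {n : ℕ} {R : Set (EuclideanSpace ℝ (Fin n))} {γ : ℝ} {x : EuclideanSpace ℝ (Fin n)}
    (h : Spanning R γ x) (hγ : 0 < γ) (r : ℝ) (hr : 0 < r) :
    ∃ d : ℝ, 0 < d ∧ ∀ a : EuclideanSpace ℝ (Fin n), ∃ y ∈ R, d ≤ ‖y - x‖ ∧ ‖y - x‖ < r ∧
      γ / 2 * ‖a‖ * ‖y - x‖ ≤ |⟪a, y - x⟫| := by
  have key : ∃ d : ℝ, 0 < d ∧ ∀ a ∈ sphere (0 : EuclideanSpace ℝ (Fin n)) 1, ∃ y ∈ R, d ≤ ‖y - x‖ ∧ ‖y - x‖ < r ∧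
      γ / 2 * ‖y - x‖ ≤ |⟪a, y - x⟫| := by
    refine (isCompact_sphere (0 : EuclideanSpace ℝ (Fin n)) 1).induction_on
      (p := fun S => ∃ d : ℝ, 0 < d ∧ ∀ a ∈ S, ∃ y ∈ R, d ≤ ‖y - x‖ ∧ ‖y - x‖ < r ∧
      γ / 2 * ‖y - x‖ ≤ |⟪a, y - x⟫|) ⟨1, one_pos, by simp⟩ ?_ ?_ ?_
    · rintro s t hst ⟨d, hd, h⟩
      exact ⟨d, hd, fun a ha => h a (hst ha)⟩
    · rintro s t ⟨d, hd, h⟩ ⟨d', hd', h'⟩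
      refine ⟨min d d', lt_min hd hd', ?_⟩
      rintro a (ha | ha)
      · obtain ⟨y, hy, h1, h2⟩ := h a ha
        exact ⟨y, hy, (min_le_left _ _).trans h1, h2⟩
      · obtain ⟨y, hy, h1, h2⟩ := h' a ha
        exact ⟨y, hy, (min_le_right _ _).trans h1, h2⟩
    · intro a ha
      have ha1 : ‖a‖ = 1 := by simpa using ha
      obtain ⟨y, hy, h1, h2, h3⟩ := h r hr a
      refine ⟨ball a (γ / 2), mem_nhdsWithin_of_mem_nhds (ball_mem_nhds _ (by positivity)), ‖y - x‖, h1, ?_⟩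
      intro b hb
      refine ⟨y, hy, le_rfl, h2, ?_⟩
      rw [ha1, mul_one] at h3
      have h4 : ⟪a, y - x⟫ = ⟪b, y - x⟫ + ⟪a - b, y - x⟫ := by rw [← inner_add_left]; congr 1; abel
      have h5 := abs_real_inner_le_norm (a - b) (y - x)
      have h6 : ‖a - b‖ < γ / 2 := by rw [← dist_eq_norm, dist_comm]; exact hb
      have h7 := abs_add_le ⟪b, y - x⟫ ⟪a - b, y - x⟫
      rw [← h4] at h7
      have h8 : ‖a - b‖ * ‖y - x‖ ≤ γ / 2 * ‖y - x‖ := by gcongr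
      linarith
  obtain ⟨d, hd, hk⟩ := key
  obtain ⟨y0, hy0, h01, h02, -⟩ := h r hr 0
  refine ⟨min d ‖y0 - x‖, lt_min hd h01, ?_⟩
  intro a
  by_cases ha : a = 0
  · exact ⟨y0, hy0, min_le_right _ _, h02, by simp [ha]⟩
  · have hna : 0 < ‖a‖ := norm_pos_iff.2 ha
    obtain ⟨y, hy, h1, h2, h3⟩ := hk (‖a‖⁻¹ • a) (by simp [norm_smul, hna.ne'])
    refine ⟨y, hy, (min_le_left _ _).trans h1, h2, ?_⟩
    rw [real_inner_smul_left, abs_mul, abs_of_pos (inv_pos.2 hna)] at h3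
    calc _ = ‖a‖ * (γ / 2 * ‖y - x‖) := by ring
      _ ≤ ‖a‖ * (‖a‖⁻¹ * |⟪a, y - x⟫|) := by gcongr
      _ = _ := by rw [← mul_assoc, mul_inv_cancel₀ hna.ne', one_mul]

section S2
variable {n : ℕ} {F : Type*} [NormedAddCommGroup F] [InnerProductSpace ℝ F] [CompleteSpace F]

theorem choose_s (R : Set (EuclideanSpace ℝ (Fin n))) (γ : ℝ) (hγ : 0 < γ) (z : EuclideanSpace ℝ (Fin n))
    (hz : Spanning R γ z) (ρ : ℝ) (N : EuclideanSpace ℝ (Fin n) →L[ℝ] F) (f : EuclideanSpace ℝ (Fin n) → F)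
    (hf : ContDiffAt ℝ (⊤ : ℕ∞) f z) (t κ : ℝ) (ht : 0 < t) (hκ : 0 < κ) :
    ∃ s : ℝ, 0 < s ∧ s ≤ 1 ∧ s ≤ t ∧ (∀ x ∈ ball z s, DifferentiableAt ℝ f x) ∧
      (∀ x ∈ ball z s, ∀ y ∈ ball z s, ‖bet ρ N (fderiv ℝ f x) - bet ρ N (fderiv ℝ f y)‖ ≤ s⁻¹ * ‖x - y‖) ∧
      (∀ x ∈ ball z s, ‖fderiv ℝ f x - fderiv ℝ f z‖ ≤ κ) ∧
      ∀ a : EuclideanSpace ℝ (Fin n), ∃ y ∈ R, 8 * s ≤ κ * γ * ‖y - z‖ ∧ ‖y - z‖ < κ / 2 ∧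
        γ / 2 * ‖a‖ * ‖y - z‖ ≤ |⟪a, y - z⟫| ∧ ‖f y - f z - fderiv ℝ f z (y - z)‖ ≤ κ * ‖y - z‖ := by
  have hf1 : ContDiffAt ℝ (⊤ : ℕ∞) (fderiv ℝ f) z := hf.fderiv_right (by simp)
  have hb : ContDiffAt ℝ (⊤ : ℕ∞) (fun y => bet ρ N (fderiv ℝ f y)) z := bet_contDiffAt ρ N _ z hf1
  obtain ⟨K, U, hU, hK⟩ := (hb.of_le (by simp : (1 : WithTop ℕ∞) ≤ (⊤ : ℕ∞))).exists_lipschitzOnWith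
  have hd : ∀ᶠ x in 𝓝 z, DifferentiableAt ℝ f x := by
    have := (hf.of_le (by simp : (1 : WithTop ℕ∞) ≤ (⊤ : ℕ∞))).eventually (by simp)
    filter_upwards [this] with x hx
    exact hx.differentiableAt (by simp)
  have hc : ∀ᶠ x in 𝓝 z, ‖fderiv ℝ f x - fderiv ℝ f z‖ ≤ κ := by
    have := hf1.continuousAt
    have := Metric.continuousAt_iff'.1 this κ hκ
    filter_upwards [this] with x hx
    rw [← dist_eq_norm]; exact hx.le
  obtain ⟨ε1, hε1, hball⟩ := Metric.eventually_nhds_iff_ball.1 (hd.and (hc.and hU))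
  have hdz := (hf.differentiableAt (by simp)).hasFDerivAt
  have hlo := hdz.isLittleO.def hκ
  obtain ⟨ε2, hε2, hball2⟩ := Metric.eventually_nhds_iff_ball.1 hlo
  obtain ⟨d, hd0, hd⟩ := hz.unif hγ (min ε2 (κ / 2)) (lt_min hε2 (by positivity))
  set s : ℝ := min (min (min 1 t) (min ε1 (K + 1)⁻¹)) (κ * γ * d / 8) with hs
  have hs0 : 0 < s := by
    have : (0:ℝ) < K + 1 := by positivity
    positivity
  have s1 : s ≤ 1 := (min_le_left _ _).trans ((min_le_left _ _).trans (min_le_left _ _))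
  have s2 : s ≤ t := (min_le_left _ _).trans ((min_le_left _ _).trans (min_le_right _ _))
  have s3 : s ≤ ε1 := (min_le_left _ _).trans ((min_le_right _ _).trans (min_le_left _ _))
  have s4 : s ≤ ((K:ℝ) + 1)⁻¹ := (min_le_left _ _).trans ((min_le_right _ _).trans (min_le_right _ _))
  have s5 : s ≤ κ * γ * d / 8 := min_le_right _ _
  refine ⟨s, hs0, s1, s2, fun x hx => (hball x (ball_subset_ball s3 hx)).1, ?_,
    fun x hx => (hball x (ball_subset_ball s3 hx)).2.1, ?_⟩
  · intro x hx y hy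
    have := hK.norm_sub_le (hball x (ball_subset_ball s3 hx)).2.2 (hball y (ball_subset_ball s3 hy)).2.2
    refine this.trans ?_
    gcongr
    have h1 : (K:ℝ) + 1 ≤ s⁻¹ := by
      rw [le_inv_comm₀ (by positivity) hs0]; exact s4
    linarith
  · intro a
    obtain ⟨y, hy, h1, h2, h3⟩ := hd a
    refine ⟨y, hy, ?_, h2.trans_le (min_le_right _ _), h3, ?_⟩
    · have : κ * γ * d ≤ κ * γ * ‖y - z‖ := by gcongr
      linarith
    · exact hball2 y (by rw [mem_ball, dist_eq_norm]; exact h2.trans_le (min_le_left _ _))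

end S2

section S3
variable {n : ℕ} {F : Type*} [NormedAddCommGroup F] [InnerProductSpace ℝ F] [CompleteSpace F]

set_option maxHeartbeats 1600000 in
theorem step (hn : 0 < n) (T R : Set (EuclideanSpace ℝ (Fin n))) (hT : volume T = 0) (γ : ℝ) (hγ : 0 < γ) (hγ1 : γ ≤ 1)
    (hspan : ∀ x ∈ T, Spanning R γ x) (N : EuclideanSpace ℝ (Fin n) →L[ℝ] F) (hN : ‖N‖ ≤ 1)
    (f : EuclideanSpace ℝ (Fin n) → F) (ρ ρ' : ℝ) (hρ1 : 1 ≤ ρ) (hρρ : ρ < ρ') (hρ2 : ρ' ≤ 2)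
    (hfl : ∀ x y, ‖f y - f x‖ ≤ ρ * ‖y - x‖) (hfC : ∀ x ∈ T, ContDiffAt ℝ (⊤ : ℕ∞) f x)
    (τ0 : EuclideanSpace ℝ (Fin n) → ℝ) (hτ00 : ∀ x, 0 ≤ τ0 x) (hτNzl : ∀ x y, |τ0 x - τ0 y| ≤ ‖x - y‖)
    (hτNzT : ∀ x ∈ T, 0 < τ0 x) (κ0 : ℝ) (hκ0 : 0 < κ0) (hκ01 : κ0 ≤ 1) :
    ∃ (f' : EuclideanSpace ℝ (Fin n) → F) (τ : EuclideanSpace ℝ (Fin n) → ℝ),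
      (∀ x y, ‖f' y - f' x‖ ≤ ρ' * ‖y - x‖) ∧ (∀ x ∈ T, ContDiffAt ℝ (⊤ : ℕ∞) f' x) ∧
      (∀ x, 0 ≤ τ x) ∧ (∀ x y, |τ x - τ y| ≤ ‖x - y‖) ∧ (∀ x ∈ T, 0 < τ x) ∧
      (∀ x, ‖f' x - f x‖ ≤ τ x) ∧ (∀ x, τ x ≤ τ0 x / 2) ∧
      (∀ x ∈ T, ∃ A : EuclideanSpace ℝ (Fin n) →L[ℝ] EuclideanSpace ℝ (Fin n), cc n / 2 ≤ ctr A ∧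
        ‖fderiv ℝ f' x - fderiv ℝ f x - (1/8 : ℝ) • (bet ρ N (fderiv ℝ f x) ∘L A)‖ ≤ κ0) ∧
      (∀ x ∈ T, ∀ a : EuclideanSpace ℝ (Fin n), ∃ y ∈ R, 0 < ‖y - x‖ ∧ ‖y - x‖ < κ0 ∧
        γ / 4 * ‖a‖ * ‖y - x‖ ≤ |⟪a, y - x⟫| ∧ ‖f y - f x - fderiv ℝ f x (y - x)‖ ≤ 3 * κ0 * ‖y - x‖ ∧
        τ x ≤ κ0 * ‖y - x‖ ∧ τ y ≤ 2 * κ0 * ‖y - x‖) := by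
  set θ : ℝ := ρ' - ρ with hθ
  have hθ0 : 0 < θ := by linarith
  have hθ1 : θ ≤ 1 := by linarith
  set κ : ℝ := min κ0 (θ / 8) with hκ
  have hκp : 0 < κ := by positivity
  have hκa : κ ≤ κ0 := min_le_left _ _
  have hκb : κ ≤ θ / 8 := min_le_right _ _
  have hκ1 : κ ≤ 1 := hκa.trans hκ01
  set b : EuclideanSpace ℝ (Fin n) → EuclideanSpace ℝ (Fin n) →L[ℝ] F := fun x => bet ρ N (fderiv ℝ f x) with hb
  have hLn : ∀ x, ‖fderiv ℝ f x‖ ≤ ρ := fun x =>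
    norm_fderiv_le_of_lip' ℝ (by linarith) (Eventually.of_forall fun y => hfl x y)
  have hbn : ∀ x, ‖b x‖ ≤ 6 := fun x => bet_norm ρ hρ1 (by linarith) _ N (hLn x) hN
  -- choice of scales
  have hsex : ∀ z, ∃ s : ℝ, z ∈ T → 0 < s ∧ s ≤ 1 ∧ s ≤ τ0 z / 4 ∧ (∀ x ∈ ball z s, DifferentiableAt ℝ f x) ∧
      (∀ x ∈ ball z s, ∀ y ∈ ball z s, ‖b x - b y‖ ≤ s⁻¹ * ‖x - y‖) ∧
      (∀ x ∈ ball z s, ‖fderiv ℝ f x - fderiv ℝ f z‖ ≤ κ0) ∧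
      ∀ a : EuclideanSpace ℝ (Fin n), ∃ y ∈ R, 8 * s ≤ κ0 * γ * ‖y - z‖ ∧ ‖y - z‖ < κ0 / 2 ∧
        γ / 2 * ‖a‖ * ‖y - z‖ ≤ |⟪a, y - z⟫| ∧ ‖f y - f z - fderiv ℝ f z (y - z)‖ ≤ κ0 * ‖y - z‖ := by
    intro z
    by_cases hz : z ∈ T
    · obtain ⟨s, hs⟩ := choose_s R γ hγ z (hspan z hz) ρ N f (hfC z hz) (τ0 z / 4) κ0
        (by have := hτNzT z hz; positivity) hκ0
      exact ⟨s, fun _ => hs⟩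
    · exact ⟨0, fun h => absurd h hz⟩
  choose s hs using hsex
  obtain ⟨τ, hτC, hτn, hτ1, hτl, hτT, hτz⟩ := d_tol T s (fun z hz => (hs z hz).1) (fun z hz => (hs z hz).2.1) κ hκp hκ1
  have hτl1 : ∀ x y, |τ x - τ y| ≤ ‖x - y‖ := fun x y => (hτl x y).trans (by nlinarith [norm_nonneg (x - y)])
  obtain ⟨g, hgτ, hgH, hgT⟩ := lemG hn T hT τ hτC hτn hτ1 hτl1 (θ / 16) (by positivity)
  set f' : EuclideanSpace ℝ (Fin n) → F := fun x => f x + (1/8 : ℝ) • b x (g x) with hf'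
  have hτy : ∀ x y, τ y ≤ τ x + κ * ‖y - x‖ := fun x y => by
    have := (abs_le.1 (hτl y x)).2; linarith
  -- the variation of the coefficient
  have hthird : ∀ x z, z ∈ T → ‖x - z‖ < s z → τ x ≤ κ * s z → ∀ᶠ y in 𝓝 x,
      ‖(1/8 : ℝ) • (b y - b x) (g y)‖ ≤ κ / 4 * ‖y - x‖ := by
    intro x z hz hxz hτx
    have hx : x ∈ ball z (s z) := by rw [mem_ball, dist_eq_norm]; exact hxz
    have hs0 := (hs z hz).1
    filter_upwards [isOpen_ball.mem_nhds hx, ball_mem_nhds x hs0] with y hy hyx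
    have h1 := (hs z hz).2.2.2.2.1 y hy x hx
    rw [mem_ball, dist_eq_norm] at hyx
    have h2 : ‖g y‖ ≤ 2 * κ * s z := by
      have := hgτ y; have := hτy x y
      have : κ * ‖y - x‖ ≤ κ * s z := by gcongr
      linarith
    rw [norm_smul, Real.norm_of_nonneg (by norm_num)]
    have h3 := (b y - b x).le_opNorm (g y)
    calc _ ≤ 1/8 * ((s z)⁻¹ * ‖y - x‖ * (2 * κ * s z)) := by
          refine mul_le_mul_of_nonneg_left (h3.trans ?_) (by norm_num)
          gcongr
      _ = κ / 4 * ‖y - x‖ := by field_simp; ring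
  refine ⟨f', τ, ?_, ?_, hτn, hτl1, hτT, ?_, ?_, ?_, ?_⟩
  · -- Lipschitz
    intro x y
    refine ml_lip f' ρ' ?_ x y
    clear x y
    intro x
    rcases (hτn x).eq_or_lt with h0 | hpos
    · refine Eventually.of_forall fun y => ?_
      have hgx : g x = 0 := by
        have := hgτ x; rw [← h0] at this; exact norm_le_zero_iff.1 this
      have hgy : ‖g y‖ ≤ κ * ‖y - x‖ := by
        have := hgτ y; have := hτy x y; linarith
      have e : f' y - f' x = (f y - f x) + (1/8 : ℝ) • b y (g y) := by
        simp only [hf', hgx, map_zero, smul_zero, add_zero]; abel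
      rw [e]
      refine (norm_add_le _ _).trans ?_
      have h1 := hfl x y
      have h2 : ‖(1/8 : ℝ) • b y (g y)‖ ≤ 1/8 * (6 * (κ * ‖y - x‖)) := by
        rw [norm_smul, Real.norm_of_nonneg (by norm_num)]
        refine mul_le_mul_of_nonneg_left (((b y).le_opNorm _).trans ?_) (by norm_num)
        exact mul_le_mul (hbn y) hgy (norm_nonneg _) (by norm_num)
      have h3 : κ * ‖y - x‖ ≤ θ * ‖y - x‖ := by gcongr; linarith
      have h4 : ρ' * ‖y - x‖ = ρ * ‖y - x‖ + θ * ‖y - x‖ := by rw [hθ]; ring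
      have h5 : 0 ≤ κ * ‖y - x‖ := by positivity
      linarith
    · obtain ⟨z, hz, hxz, hτx⟩ := hτz x hpos
      have hx : x ∈ ball z (s z) := by rw [mem_ball, dist_eq_norm]; exact hxz
      have hd := ((hs z hz).2.2.2.1 x hx).hasFDerivAt.isLittleO.def (show 0 < θ / 4 by positivity)
      filter_upwards [hthird x z hz hxz hτx, hd] with y hy1 hy2
      have e : f' y - f' x = (f y - f x - fderiv ℝ f x (y - x)) +
          (fderiv ℝ f x (y - x) + (1/8 : ℝ) • b x (g y - g x)) + (1/8 : ℝ) • (b y - b x) (g y) := by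
        simp only [hf', sub_apply, map_sub, smul_sub]; abel
      rw [e]
      refine (norm_add_le _ _).trans ?_
      have h1 := norm_add_le (f y - f x - fderiv ℝ f x (y - x)) (fderiv ℝ f x (y - x) + (1/8 : ℝ) • b x (g y - g x))
      have h2 := s1_rho ρ (by linarith) (fderiv ℝ f x) N (hLn x) hN (y - x) (g y - g x) (2 * (θ / 16)) (by positivity)
        (hgH.sq (by positivity) (by linarith) x y)
      have h3 : ρ * ((1 + 2 * (θ / 16)) * ‖y - x‖) ≤ ρ * ‖y - x‖ + θ / 4 * ‖y - x‖ := by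
        have : ρ * (θ * ‖y - x‖) ≤ 2 * (θ * ‖y - x‖) := by
          refine mul_le_mul_of_nonneg_right (by linarith) (by positivity)
        linarith
      have h4 : κ / 4 * ‖y - x‖ ≤ θ / 4 * ‖y - x‖ := by gcongr; linarith
      have h5 : ρ' * ‖y - x‖ = ρ * ‖y - x‖ + θ * ‖y - x‖ := by rw [hθ]; ring
      have h6 : 0 ≤ θ * ‖y - x‖ := by positivity
      have h7 : ‖fderiv ℝ f x (y - x) + (1/8 : ℝ) • b x (g y - g x)‖ ≤ ρ * ((1 + 2 * (θ / 16)) * ‖y - x‖) := h2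
      linarith
  · intro x hx
    refine (hfC x hx).add (ContDiffAt.const_smul _ (ContDiffAt.clm_apply ?_ (hgT x hx (hτT x hx)).1))
    exact bet_contDiffAt ρ N _ x ((hfC x hx).fderiv_right (by simp))
  · intro x
    have e : f' x - f x = (1/8 : ℝ) • b x (g x) := by simp only [hf']; abel
    rw [e, norm_smul, Real.norm_of_nonneg (by norm_num)]
    have h1 := ((b x).le_opNorm (g x)).trans (mul_le_mul (hbn x) (hgτ x) (norm_nonneg _) (by norm_num))
    linarith [hτn x]
  · intro x
    rcases (hτn x).eq_or_lt with h0 | hpos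
    · rw [← h0]; have := hτ00 x; positivity
    · obtain ⟨z, hz, hxz, hτx⟩ := hτz x hpos
      have h1 := (hs z hz).2.2.1
      have h2 := (abs_le.1 (hτNzl x z)).1
      have h3 : κ * s z ≤ s z := by nlinarith [(hs z hz).1]
      linarith
  · intro x hx
    refine ⟨fderiv ℝ g x, (hgT x hx (hτT x hx)).2, ?_⟩
    obtain ⟨z, hz, hxz, hτx⟩ := hτz x (hτT x hx)
    have hgC := (hgT x hx (hτT x hx)).1
    have hbC : ContDiffAt ℝ (⊤ : ℕ∞) b x := bet_contDiffAt ρ N _ x ((hfC x hx).fderiv_right (by simp))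
    have hf'C : ContDiffAt ℝ (⊤ : ℕ∞) f' x := (hfC x hx).add (ContDiffAt.const_smul _ (hbC.clm_apply hgC))
    have hd : HasFDerivAt (fun y => f' y - f y - (1/8 : ℝ) • b x (g y))
        (fderiv ℝ f' x - fderiv ℝ f x - (1/8 : ℝ) • (b x ∘L fderiv ℝ g x)) x := by
      refine ((hf'C.differentiableAt (by simp)).hasFDerivAt.sub ((hfC x hx).differentiableAt (by simp)).hasFDerivAt).sub ?_
      exact ((b x).hasFDerivAt.comp x (hgC.differentiableAt (by simp)).hasFDerivAt).const_smul _
    refine hd.le_of_lip' hκ0.le ?_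
    filter_upwards [hthird x z hz hxz hτx] with y hy
    have e : (f' y - f y - (1/8 : ℝ) • b x (g y)) - (f' x - f x - (1/8 : ℝ) • b x (g x)) =
        (1/8 : ℝ) • (b y - b x) (g y) := by
      simp only [hf', sub_apply, smul_sub]; abel
    rw [e]
    refine hy.trans ?_
    gcongr
    linarith
  · intro x hx a
    obtain ⟨z, hz, hxz, hτx⟩ := hτz x (hτT x hx)
    obtain ⟨s0, -, -, -, -, hc, hsp⟩ := hs z hz
    obtain ⟨y, hy, h1, h2, h3, h4⟩ := hsp a
    have hxb : x ∈ ball z (s z) := by rw [mem_ball, dist_eq_norm]; exact hxz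
    set p : ℝ := ‖y - z‖ with hp
    have hp0 : 0 ≤ p := norm_nonneg _
    have k1 : κ0 * γ * p ≤ κ0 * p := by
      have : γ * p ≤ p := by nlinarith
      nlinarith
    have k2 : κ0 * p ≤ p := by nlinarith
    have k3 : κ0 * γ * p ≤ γ * p := by nlinarith [mul_nonneg hγ.le hp0]
    have hpp : 0 < p := by
      rcases hp0.eq_or_lt with h | h
      · rw [← h] at h1; linarith
      · exact h
    have t1 : ‖y - x‖ ≤ p + ‖x - z‖ := by
      have := norm_sub_le_norm_sub_add_norm_sub y z x
      rw [norm_sub_rev z x] at this; exact this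
    have t2 : p ≤ ‖y - x‖ + ‖x - z‖ := norm_sub_le_norm_sub_add_norm_sub y x z
    have t3 : ‖x - z‖ ≤ p / 8 := by linarith
    have t4 : p ≤ 8/7 * ‖y - x‖ := by linarith
    have t5 : ‖y - x‖ ≤ 9/8 * p := by linarith
    have hκs : κ * s z ≤ s z := by nlinarith
    have t6 : τ x ≤ κ0 * ‖y - x‖ := by
      have : κ0 * p ≤ κ0 * (8/7 * ‖y - x‖) := by gcongr
      have : 0 ≤ κ0 * ‖y - x‖ := by positivity
      linarith
    refine ⟨y, hy, by linarith, by linarith, ?_, ?_, t6, ?_⟩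
    · have e : ⟪a, y - z⟫ = ⟪a, y - x⟫ + ⟪a, x - z⟫ := by rw [← inner_add_right]; congr 1; abel
      have h5 := abs_add_le ⟪a, y - x⟫ ⟪a, x - z⟫
      rw [← e] at h5
      have h6 := abs_real_inner_le_norm a (x - z)
      have h7 : ‖a‖ * ‖x - z‖ ≤ ‖a‖ * (γ * p / 8) := by gcongr; linarith
      have h8 : γ / 4 * ‖a‖ * ‖y - x‖ ≤ γ / 4 * ‖a‖ * (9/8 * p) := by gcongr
      have h9 : 0 ≤ ‖a‖ * (γ * p) := by positivity
      linarith
    · have e : f y - f x - fderiv ℝ f x (y - x) = (f y - f z - fderiv ℝ f z (y - z)) + (f z - f x) -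
          (fderiv ℝ f x - fderiv ℝ f z) (y - z) + fderiv ℝ f x (x - z) := by
        simp only [sub_apply, map_sub]; abel
      rw [e]
      have n1 := norm_add_le ((f y - f z - fderiv ℝ f z (y - z)) + (f z - f x) -
          (fderiv ℝ f x - fderiv ℝ f z) (y - z)) (fderiv ℝ f x (x - z))
      have n2 := norm_sub_le ((f y - f z - fderiv ℝ f z (y - z)) + (f z - f x)) ((fderiv ℝ f x - fderiv ℝ f z) (y - z))
      have n3 := norm_add_le (f y - f z - fderiv ℝ f z (y - z)) (f z - f x)
      have n4 : ‖f z - f x‖ ≤ 2 * ‖x - z‖ := by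
        have := hfl x z; rw [norm_sub_rev z x] at this
        refine this.trans ?_
        gcongr; linarith
      have n5 : ‖(fderiv ℝ f x - fderiv ℝ f z) (y - z)‖ ≤ κ0 * p :=
        (ContinuousLinearMap.le_opNorm _ _).trans (mul_le_mul_of_nonneg_right (hc x hxb) hp0)
      have n6 : ‖fderiv ℝ f x (x - z)‖ ≤ 2 * ‖x - z‖ :=
        (ContinuousLinearMap.le_opNorm _ _).trans (mul_le_mul_of_nonneg_right (by linarith [hLn x]) (norm_nonneg _))
      have n7 : κ0 * p ≤ κ0 * (8/7 * ‖y - x‖) := by gcongr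
      have n8 : 0 ≤ κ0 * ‖y - x‖ := by positivity
      linarith
    · have := hτy x y
      have : κ * ‖y - x‖ ≤ κ0 * ‖y - x‖ := by gcongr
      linarith

end S3

/-- block inclusion -/
def blk (J n : ℕ) (j : Fin J) : EuclideanSpace ℝ (Fin n) →L[ℝ] EuclideanSpace ℝ (Fin J × Fin n) :=
  LinearMap.toContinuousLinearMap
    { toFun := fun v => WithLp.toLp 2 (fun p => if p.1 = j then v p.2 else 0)
      map_add' := by
        intro v w
        ext p
        by_cases h : p.1 = j <;> simp [h]
      map_smul' := by
        intro c v
        ext p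
        by_cases h : p.1 = j <;> simp [h] }

theorem blk_apply (J n : ℕ) (j : Fin J) (v : EuclideanSpace ℝ (Fin n)) (p : Fin J × Fin n) :
    blk J n j v p = if p.1 = j then v p.2 else 0 := rfl

theorem blk_adj (J n : ℕ) (j : Fin J) (w : EuclideanSpace ℝ (Fin J × Fin n)) (b : Fin n) :
    (ContinuousLinearMap.adjoint (blk J n j) w) b = w (j, b) := by
  have h1 : (ContinuousLinearMap.adjoint (blk J n j) w) b =
      ⟪EuclideanSpace.single b (1:ℝ), ContinuousLinearMap.adjoint (blk J n j) w⟫ := by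
    simp [EuclideanSpace.inner_single_left]
  have h2 : blk J n j (EuclideanSpace.single b (1:ℝ)) = EuclideanSpace.single (j, b) (1:ℝ) := by
    ext ⟨p, q⟩
    rw [blk_apply]
    by_cases hp : p = j <;> by_cases hq : q = b <;> simp [hp, hq]
  rw [h1, ContinuousLinearMap.adjoint_inner_right, h2]
  simp [EuclideanSpace.inner_single_left]

theorem blk_adj_blk (J n : ℕ) (j : Fin J) (v : EuclideanSpace ℝ (Fin n)) :
    ContinuousLinearMap.adjoint (blk J n j) (blk J n j v) = v := by
  ext b
  rw [blk_adj, blk_apply]; simp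

theorem blk_norm (J n : ℕ) (j : Fin J) : ‖blk J n j‖ ≤ 1 := by
  refine ContinuousLinearMap.opNorm_le_bound _ zero_le_one fun v => ?_
  rw [one_mul]
  refine abs_le_of_sq_le_sq' ?_ (norm_nonneg _) |>.2
  rw [← real_inner_self_eq_norm_sq, ← ContinuousLinearMap.adjoint_inner_right, blk_adj_blk, real_inner_self_eq_norm_sq]

theorem blk_pigeon (n : ℕ) (hn : 0 < n) (D : EuclideanSpace ℝ (Fin n) →L[ℝ] EuclideanSpace ℝ (Fin (1024 * n) × Fin n))
    (hD : ‖D‖ ≤ 3) : ∃ j, ∀ v, ‖ContinuousLinearMap.adjoint (blk (1024 * n) n j) (D v)‖ ≤ 1/8 * ‖v‖ := by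
  set c : Fin (1024 * n) → Fin n → ℝ := fun j b =>
    ‖ContinuousLinearMap.adjoint (blk (1024 * n) n j) (D (EuclideanSpace.single b 1))‖ ^ 2 with hc
  have hcol : ∀ b, ∑ j, c j b ≤ 9 := by
    intro b
    have h1 : ∑ j, c j b = ‖D (EuclideanSpace.single b 1)‖ ^ 2 := by
      simp only [hc, EuclideanSpace.real_norm_sq_eq, blk_adj]
      rw [Fintype.sum_prod_type]
    rw [h1]
    have h2 := D.le_of_opNorm_le hD (EuclideanSpace.single b (1:ℝ))
    have h3 : ‖(EuclideanSpace.single b (1:ℝ) : EuclideanSpace ℝ (Fin n))‖ = 1 := by simp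
    rw [h3] at h2
    nlinarith [norm_nonneg (D (EuclideanSpace.single b 1))]
  have htot : ∑ j, ∑ b, c j b ≤ ∑ j : Fin (1024 * n), (1/64 : ℝ) := by
    rw [Finset.sum_comm]
    refine (Finset.sum_le_sum fun b _ => hcol b).trans ?_
    simp
    have : (0:ℝ) ≤ n := Nat.cast_nonneg n
    linarith
  have : Nonempty (Fin (1024 * n)) := ⟨⟨0, by omega⟩⟩
  obtain ⟨j, -, hj⟩ := Finset.exists_le_of_sum_le Finset.univ_nonempty htot
  refine ⟨j, fun v => ?_⟩
  set L := (ContinuousLinearMap.adjoint (blk (1024 * n) n j)) ∘L D with hL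
  have hv : L v = ∑ b, v b • L (EuclideanSpace.single b 1) := by
    conv_lhs => rw [← (EuclideanSpace.basisFun (Fin n) ℝ).sum_repr v]
    simp [map_sum]
  have h1 : ‖L v‖ ≤ ∑ b, |v b| * ‖L (EuclideanSpace.single b 1)‖ := by
    rw [hv]
    refine (norm_sum_le _ _).trans (le_of_eq ?_)
    refine Finset.sum_congr rfl fun b _ => ?_
    rw [norm_smul, Real.norm_eq_abs]
  have h2 := Finset.sum_mul_sq_le_sq_mul_sq Finset.univ (fun b => |v b|) (fun b => ‖L (EuclideanSpace.single b 1)‖)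
  have h3 : ∑ b, |v b| ^ 2 = ‖v‖ ^ 2 := by
    rw [EuclideanSpace.real_norm_sq_eq]; simp
  have h4 : ∑ b, ‖L (EuclideanSpace.single b 1)‖ ^ 2 ≤ 1/64 := hj
  change ‖L v‖ ≤ _
  refine abs_le_of_sq_le_sq' ?_ (by positivity) |>.2
  calc ‖L v‖ ^ 2 ≤ (∑ b, |v b| * ‖L (EuclideanSpace.single b 1)‖) ^ 2 := by gcongr
    _ ≤ ‖v‖ ^ 2 * (1/64) := by
        rw [h3] at h2
        exact h2.trans (mul_le_mul_of_nonneg_left h4 (sq_nonneg _))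
    _ = _ := by ring

theorem dep_choice {α : Type*} (P : ℕ → α → Prop) (Rel : ℕ → α → α → Prop) (a0 : α) (h0 : P 0 a0)
    (hs : ∀ k a, P k a → ∃ a', P (k + 1) a' ∧ Rel k a a') :
    ∃ u : ℕ → α, u 0 = a0 ∧ ∀ k, P k (u k) ∧ Rel k (u k) (u (k + 1)) := by
  choose! nx hnx1 hnx2 using hs
  set u : ℕ → α := fun k => Nat.rec a0 (fun k a => nx k a) k with hu
  have hP : ∀ k, P k (u k) := by
    intro k
    induction k with
    | zero => exact h0
    | succ k ih => exact hnx1 k _ ih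
  exact ⟨u, rfl, fun k => ⟨hP k, hnx2 k _ (hP k)⟩⟩

theorem ctr_exists {n : ℕ} (hn : 0 < n) (A : EuclideanSpace ℝ (Fin n) →L[ℝ] EuclideanSpace ℝ (Fin n)) (c : ℝ)
    (h : c ≤ ctr A) : ∃ e : EuclideanSpace ℝ (Fin n), ‖e‖ = 1 ∧ c / n ≤ ‖A e‖ := by
  have hn0 : (0:ℝ) < n := by exact_mod_cast hn
  have : Nonempty (Fin n) := ⟨⟨0, hn⟩⟩
  unfold ctr at h
  have : ∑ i : Fin n, c / n ≤ ∑ i, ⟪A (EuclideanSpace.single i 1), EuclideanSpace.single i (1:ℝ)⟫ := by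
    refine le_trans (le_of_eq ?_) h
    simp; field_simp
  obtain ⟨i, -, hi⟩ := Finset.exists_le_of_sum_le Finset.univ_nonempty this
  have h1 : ‖(EuclideanSpace.single i (1:ℝ) : EuclideanSpace ℝ (Fin n))‖ = 1 := by simp
  refine ⟨_, h1, hi.trans ((real_inner_le_norm _ _).trans ?_)⟩
  rw [h1, mul_one]

set_option maxHeartbeats 1600000 in
theorem thmN {n : ℕ} (hn : 0 < n) (T R : Set (EuclideanSpace ℝ (Fin n))) (hT : volume T = 0) (γ : ℝ) (hγ : 0 < γ)
    (hγ1 : γ ≤ 1) (hspan : ∀ x ∈ T, Spanning R γ x) :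
    ∃ f : EuclideanSpace ℝ (Fin n) → EuclideanSpace ℝ (Fin (1024 * n) × Fin n),
      (∀ x y, ‖f y - f x‖ ≤ 2 * ‖y - x‖) ∧ ∀ x ∈ T, ¬ ∃ D : EuclideanSpace ℝ (Fin n) →L[ℝ] EuclideanSpace ℝ (Fin (1024 * n) × Fin n), HasFDerivWithinAt f D R x := by
  set J := 1024 * n with hJ
  have hJ0 : 0 < J := by omega
  let Nk : ℕ → EuclideanSpace ℝ (Fin n) →L[ℝ] EuclideanSpace ℝ (Fin J × Fin n) := fun k =>
    blk J n ⟨k % J, Nat.mod_lt _ hJ0⟩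
  let ρ : ℕ → ℝ := fun k => 2 - (1/2) ^ k
  have hρ1 : ∀ k, 1 ≤ ρ k := fun k => by
    have : (1/2 : ℝ) ^ k ≤ 1 := pow_le_one₀ (by norm_num) (by norm_num)
    simp only [ρ]; linarith
  have hρ2 : ∀ k, ρ k ≤ 2 := fun k => by
    have : (0 : ℝ) < (1/2) ^ k := by positivity
    simp only [ρ]; linarith
  have hρs : ∀ k, ρ k < ρ (k + 1) := fun k => by
    have : (0 : ℝ) < (1/2) ^ k := by positivity
    simp only [ρ, pow_succ]; linarith
  obtain ⟨u, hu0, hu⟩ := dep_choice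
    (α := (EuclideanSpace ℝ (Fin n) → EuclideanSpace ℝ (Fin J × Fin n)) × (EuclideanSpace ℝ (Fin n) → ℝ))
    (fun k p => (∀ x y, ‖p.1 y - p.1 x‖ ≤ ρ k * ‖y - x‖) ∧ (∀ x ∈ T, ContDiffAt ℝ (⊤ : ℕ∞) p.1 x) ∧
      (∀ x, 0 ≤ p.2 x) ∧ (∀ x y, |p.2 x - p.2 y| ≤ ‖x - y‖) ∧ (∀ x ∈ T, 0 < p.2 x))
    (fun k p p' => (∀ x, ‖p'.1 x - p.1 x‖ ≤ p'.2 x) ∧ (∀ x, p'.2 x ≤ p.2 x / 2) ∧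
      (∀ x ∈ T, ∃ A : EuclideanSpace ℝ (Fin n) →L[ℝ] EuclideanSpace ℝ (Fin n), cc n / 2 ≤ ctr A ∧
        ‖fderiv ℝ p'.1 x - fderiv ℝ p.1 x - (1/8 : ℝ) • (bet (ρ k) (Nk k) (fderiv ℝ p.1 x) ∘L A)‖ ≤ (1/2) ^ k) ∧
      (∀ x ∈ T, ∀ a : EuclideanSpace ℝ (Fin n), ∃ y ∈ R, 0 < ‖y - x‖ ∧ ‖y - x‖ < (1/2) ^ k ∧
        γ / 4 * ‖a‖ * ‖y - x‖ ≤ |⟪a, y - x⟫| ∧ ‖p.1 y - p.1 x - fderiv ℝ p.1 x (y - x)‖ ≤ 3 * (1/2) ^ k * ‖y - x‖ ∧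
        p'.2 x ≤ (1/2) ^ k * ‖y - x‖ ∧ p'.2 y ≤ 2 * (1/2) ^ k * ‖y - x‖))
    (fun _ => 0, fun _ => 1)
    ⟨fun x y => by simp only [sub_self, norm_zero]; have := hρ1 0; positivity, fun x _ => contDiffAt_const,
      fun _ => zero_le_one, fun x y => by simp, fun _ _ => one_pos⟩ (by
      rintro k ⟨f, τ0⟩ ⟨h1, h2, h3, h4, h5⟩
      obtain ⟨f', τ, a1, a2, a3, a4, a5, a6, a7, a8, a9⟩ := step hn T R hT γ hγ hγ1 hspan (Nk k) (blk_norm _ _ _) f (ρ k)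
        (ρ (k + 1)) (hρ1 k) (hρs k) (hρ2 _) h1 h2 τ0 h3 h4 h5 ((1/2) ^ k) (by positivity)
        (pow_le_one₀ (by norm_num) (by norm_num))
      exact ⟨(f', τ), ⟨a1, a2, a3, a4, a5⟩, a6, a7, a8, a9⟩)
  set f : ℕ → EuclideanSpace ℝ (Fin n) → EuclideanSpace ℝ (Fin J × Fin n) := fun k => (u k).1 with hf
  set t : ℕ → EuclideanSpace ℝ (Fin n) → ℝ := fun k => (u k).2 with ht
  have hfl : ∀ k x y, ‖f k y - f k x‖ ≤ ρ k * ‖y - x‖ := fun k => (hu k).1.1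
  have ht0 : ∀ k x, 0 ≤ t k x := fun k => (hu k).1.2.2.1
  have hstep : ∀ k x, ‖f (k + 1) x - f k x‖ ≤ t (k + 1) x := fun k => (hu k).2.1
  have htt : ∀ k x, t (k + 1) x ≤ t k x / 2 := fun k => (hu k).2.2.1
  have hA := fun k => (hu k).2.2.2.1
  have hsp := fun k => (hu k).2.2.2.2
  have htb : ∀ k x, t k x ≤ (1/2) ^ k := by
    intro k x
    induction k with
    | zero => simp [ht, hu0]
    | succ k ih => rw [pow_succ]; linarith [htt k x]
  have hcau : ∀ x, CauchySeq fun k => f k x := by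
    intro x
    refine cauchySeq_of_le_geometric (1/2) 1 (by norm_num) fun k => ?_
    rw [dist_comm, dist_eq_norm]
    have h1 := hstep k x; have h2 := htt k x; have := htb k x; have := ht0 k x
    linarith
  choose fi hfi using fun x => cauchySeq_tendsto_of_complete (hcau x)
  have htel : ∀ k x m, ‖f (k + m) x - f k x‖ ≤ 2 * t (k + 1) x - 2 * t (k + m + 1) x := by
    intro k x m
    induction m with
    | zero => simp
    | succ m ih =>
      have h1 := hstep (k + m) x
      have h2 := htt (k + m + 1) x
      have h3 := norm_sub_le_norm_sub_add_norm_sub (f (k + m + 1) x) (f (k + m) x) (f k x)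
      rw [← add_assoc]
      linarith
  have hlim : ∀ k x, ‖fi x - f k x‖ ≤ 2 * t (k + 1) x := by
    intro k x
    have h1 : Tendsto (fun m => ‖f (m + k) x - f k x‖) atTop (𝓝 ‖fi x - f k x‖) :=
      (((tendsto_add_atTop_iff_nat k).2 (hfi x)).sub tendsto_const_nhds).norm
    refine le_of_tendsto h1 (Eventually.of_forall fun m => ?_)
    rw [add_comm m k]
    have := htel k x m; have := ht0 (k + m + 1) x
    linarith
  refine ⟨fi, ?_, ?_⟩
  · intro x y
    have h1 : Tendsto (fun m => ‖f m y - f m x‖) atTop (𝓝 ‖fi y - fi x‖) := ((hfi y).sub (hfi x)).norm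
    refine le_of_tendsto h1 (Eventually.of_forall fun m => (hfl m x y).trans ?_)
    gcongr; exact hρ2 m
  · rintro x hx ⟨D, hD⟩
    set L : ℕ → EuclideanSpace ℝ (Fin n) →L[ℝ] EuclideanSpace ℝ (Fin J × Fin n) := fun k => fderiv ℝ (f k) x with hL
    have hLn : ∀ k, ‖L k‖ ≤ 2 := fun k =>
      norm_fderiv_le_of_lip' ℝ (by norm_num) (Eventually.of_forall fun y => (hfl k x y).trans (by gcongr; exact hρ2 k))
    -- convergence of the derivatives
    have hconv : ∀ ε : ℝ, 0 < ε → ∃ k0 : ℕ, ∀ k, k0 ≤ k → ‖L k - D‖ ≤ ε := by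
      intro ε hε
      set e : ℝ := γ * ε / 40 with he
      have he0 : 0 < e := by positivity
      have hd := hD.isLittleO.def he0
      obtain ⟨δ, hδ, hball⟩ := Metric.mem_nhdsWithin_iff.1 hd
      obtain ⟨k0, hk0⟩ := exists_pow_lt_of_lt_one (lt_min hδ he0) (by norm_num : (1/2 : ℝ) < 1)
      refine ⟨k0, fun k hk => ?_⟩
      have hkk : (1/2 : ℝ) ^ k < min δ e := lt_of_le_of_lt (pow_le_pow_of_le_one (by norm_num) (by norm_num) hk) hk0
      have hk1 := hkk.trans_le (min_le_left _ _)
      have hk2 := hkk.trans_le (min_le_right _ _)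
      set M := L k - D with hM
      rw [← LinearIsometryEquiv.norm_map ContinuousLinearMap.adjoint M]
      refine ContinuousLinearMap.opNorm_le_bound _ hε.le fun w => ?_
      obtain ⟨y, hyR, y1, y2, y3, y4, y5, y6⟩ := hsp k x hx (ContinuousLinearMap.adjoint M w)
      rw [ContinuousLinearMap.adjoint_inner_left] at y3
      have q1 : ‖fi y - fi x - D (y - x)‖ ≤ e * ‖y - x‖ :=
        hball ⟨by rw [mem_ball, dist_eq_norm]; linarith, hyR⟩
      have q2 : ‖M (y - x)‖ ≤ 10 * e * ‖y - x‖ := by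
        have e1 : M (y - x) = (fi y - fi x - D (y - x)) - (fi y - f k y) + (fi x - f k x) -
            (f k y - f k x - L k (y - x)) := by
          simp only [hM, sub_apply]; abel
        rw [e1]
        have n1 := norm_sub_le ((fi y - fi x - D (y - x)) - (fi y - f k y) + (fi x - f k x))
            (f k y - f k x - L k (y - x))
        have n2 := norm_add_le ((fi y - fi x - D (y - x)) - (fi y - f k y)) (fi x - f k x)
        have n3 := norm_sub_le (fi y - fi x - D (y - x)) (fi y - f k y)
        have n4 := hlim k y
        have n5 := hlim k x
        have n6 : (1/2 : ℝ) ^ k * ‖y - x‖ ≤ e * ‖y - x‖ := by gcongr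
        have y4' : ‖f k y - f k x - L k (y - x)‖ ≤ 3 * (1/2) ^ k * ‖y - x‖ := y4
        have y5' : t (k + 1) x ≤ (1/2) ^ k * ‖y - x‖ := y5
        have y6' : t (k + 1) y ≤ 2 * (1/2) ^ k * ‖y - x‖ := y6
        linarith
      have q3 := abs_real_inner_le_norm w (M (y - x))
      have q4 : γ / 4 * ‖ContinuousLinearMap.adjoint M w‖ * ‖y - x‖ ≤ (‖w‖ * (10 * e)) * ‖y - x‖ := by
        refine y3.trans (q3.trans ?_)
        rw [mul_assoc]
        exact mul_le_mul_of_nonneg_left q2 (norm_nonneg _)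
      have q5 := le_of_mul_le_mul_right q4 y1
      have q6 : ‖w‖ * (10 * e) = γ / 4 * (ε * ‖w‖) := by rw [he]; ring
      rw [q6] at q5
      exact le_of_mul_le_mul_left q5 (by positivity)
    have hn0 : (0:ℝ) < n := by exact_mod_cast hn
    have hcc : 0 < cc n := by unfold cc; positivity
    set ε : ℝ := min (1/8) (cc n / (128 * n)) with hε
    have hε0 : 0 < ε := by positivity
    have hε1 : ε ≤ 1/8 := min_le_left _ _
    have hε2 : ε ≤ cc n / (128 * n) := min_le_right _ _
    obtain ⟨k0, hk0⟩ := hconv ε hε0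
    obtain ⟨k1, hk1⟩ := exists_pow_lt_of_lt_one hε0 (by norm_num : (1/2 : ℝ) < 1)
    have hDn : ‖D‖ ≤ 3 := by
      have h1 := hk0 k0 le_rfl
      have h2 := norm_sub_le (L k0) (L k0 - D)
      rw [sub_sub_cancel] at h2
      linarith [hLn k0]
    obtain ⟨j, hj⟩ := blk_pigeon n hn D hDn
    set k := J * (k0 + k1) + j with hk
    have hkge : k0 + k1 ≤ k := by
      have := Nat.le_mul_of_pos_left (k0 + k1) hJ0
      omega
    have hNk : Nk k = blk J n j := by
      simp only [Nk]
      congr 1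
      ext
      simp only [hk]
      rw [Nat.mul_add_mod]; exact Nat.mod_eq_of_lt j.2
    obtain ⟨A, hA1, hA2⟩ := hA k x hx
    obtain ⟨e, he1, he2⟩ := ctr_exists hn A _ hA1
    have hlow := bet_lower (ρ k) (hρ1 k) (L k) (Nk k) (blk_norm _ _ _) (fun v => blk_adj_blk _ _ _ v) (fun v => by
      have h1 : L k v = D v + (L k - D) v := by simp
      rw [h1, map_add, hNk]
      refine (norm_add_le _ _).trans ?_
      have h2 := hj v
      have h3 : ‖ContinuousLinearMap.adjoint (blk J n j) ((L k - D) v)‖ ≤ 1/8 * ‖v‖ := by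
        have h4 : ‖ContinuousLinearMap.adjoint (blk J n j)‖ ≤ 1 := by
          rw [LinearIsometryEquiv.norm_map]; exact blk_norm _ _ _
        have h5 := (ContinuousLinearMap.adjoint (blk J n j)).le_of_opNorm_le h4 ((L k - D) v)
        have h6 := (L k - D).le_of_opNorm_le ((hk0 k (by omega)).trans hε1) v
        linarith
      linarith) (A e)
    have hfin : ‖((1/8 : ℝ) • (bet (ρ k) (Nk k) (L k) ∘L A)) e‖ ≤ 3 * ε := by
      have h1 : ‖(1/8 : ℝ) • (bet (ρ k) (Nk k) (L k) ∘L A)‖ ≤ 3 * ε := by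
        have e1 : (1/8 : ℝ) • (bet (ρ k) (Nk k) (L k) ∘L A) = (L (k + 1) - D) - (L k - D) -
            (L (k + 1) - L k - (1/8 : ℝ) • (bet (ρ k) (Nk k) (L k) ∘L A)) := by abel
        rw [e1]
        have n1 := norm_sub_le ((L (k + 1) - D) - (L k - D)) (L (k + 1) - L k - (1/8 : ℝ) • (bet (ρ k) (Nk k) (L k) ∘L A))
        have n2 := norm_sub_le (L (k + 1) - D) (L k - D)
        have n3 := hk0 k (by omega)
        have n4 := hk0 (k + 1) (by omega)
        have n5 : (1/2 : ℝ) ^ k ≤ ε :=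
          (pow_le_pow_of_le_one (by norm_num) (by norm_num) (by omega : k1 ≤ k)).trans hk1.le
        have hA2' : ‖L (k + 1) - L k - (1/8 : ℝ) • (bet (ρ k) (Nk k) (L k) ∘L A)‖ ≤ (1/2) ^ k := hA2
        linarith
      have := ContinuousLinearMap.le_of_opNorm_le _ h1 e
      rwa [he1, mul_one] at this
    rw [smul_apply, norm_smul, Real.norm_of_nonneg (by norm_num), ContinuousLinearMap.comp_apply] at hfin
    have e1 : cc n / 2 / n = 64 * (cc n / (128 * n)) := by field_simp; norm_num
    rw [e1] at he2
    linarith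

theorem chart_lim {X : Type*} [MetricSpace X] {S : Set X} {n : ℕ}
    {φ : X → EuclideanSpace ℝ (Fin n)} {f : X → ℝ} {x : X} {df : EuclideanSpace ℝ (Fin n)} :
    HasChartDerivAt S φ f x df ↔ ∀ ε : ℝ, 0 < ε → ∃ r : ℝ, 0 < r ∧ ∀ y ∈ S, dist y x < r →
      |f y - f x - ⟪df, φ y - φ x⟫| ≤ ε * dist y x := by
  unfold HasChartDerivAt
  constructor
  · intro h ε hε
    have h1 := h.eventually (gt_mem_nhds hε)
    obtain ⟨r, hr, hb⟩ := Metric.mem_nhdsWithin_iff.1 h1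
    refine ⟨r, hr, fun y hy hyr => ?_⟩
    by_cases hyx : y = x
    · subst hyx; simp
    · have h2 : |f y - f x - ⟪df, φ y - φ x⟫| / dist y x < ε := hb ⟨hyr, hy, hyx⟩
      rw [div_lt_iff₀ (dist_pos.2 hyx)] at h2
      exact h2.le
  · intro h
    rw [Metric.tendsto_nhds]
    intro ε hε
    obtain ⟨r, hr, hb⟩ := h (ε / 2) (by positivity)
    refine Metric.mem_nhdsWithin_iff.2 ⟨r, hr, ?_⟩
    rintro y ⟨hyr, hy, hyx⟩
    have hd : 0 < dist y x := dist_pos.2 hyx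
    have h1 := hb y hy hyr
    have h2 : |f y - f x - ⟪df, φ y - φ x⟫| / dist y x ≤ ε / 2 := by rw [div_le_iff₀ hd]; exact h1
    have h3 : 0 ≤ |f y - f x - ⟪df, φ y - φ x⟫| / dist y x := by positivity
    change dist _ _ < ε
    rw [Real.dist_eq, sub_zero, abs_of_nonneg h3]
    linarith

theorem lip_infDist {X : Type*} [MetricSpace X] (W : Set X) : IsLipschitzOn (fun y => infDist y W) Set.univ :=
  ⟨1, (lipschitz_infDist_pt W).lipschitzOnWith⟩

theorem no_diff_point {X : Type*} [MetricSpace X] (n : ℕ) (hn : 0 < n) (φ : X → EuclideanSpace ℝ (Fin n)) (x : X)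
    (h : ∀ f : X → ℝ, IsLipschitzOn f Set.univ → ∃! df, HasChartDerivAt Set.univ φ f x df) : False := by
  by_cases hiso : ∃ r : ℝ, 0 < r ∧ ∀ y, dist y x < r → y = x
  · obtain ⟨r, hr, hiso⟩ := hiso
    obtain ⟨df, hdf, huniq⟩ := h (fun _ => 0) ⟨0, LipschitzOnWith.of_dist_le_mul (by simp)⟩
    have hall : ∀ d, HasChartDerivAt Set.univ φ (fun _ => 0) x d := by
      intro d
      rw [chart_lim]
      intro ε hε
      refine ⟨r, hr, fun y _ hy => ?_⟩
      rw [hiso y hy]; simp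
    have h1 := huniq _ (hall 0)
    have h2 := huniq _ (hall (EuclideanSpace.single ⟨0, hn⟩ 1))
    have h3 : (0 : EuclideanSpace ℝ (Fin n)) = EuclideanSpace.single ⟨0, hn⟩ 1 := by rw [h1, h2]
    have := congrArg norm h3
    simp at this
  · push Not at hiso
    -- a rapidly converging sequence
    have hex : ∀ r : ℝ, 0 < r → ∃ y, 0 < dist y x ∧ dist y x < r := by
      intro r hr
      obtain ⟨y, hy, hne⟩ := hiso r hr
      exact ⟨y, dist_pos.2 hne, hy⟩
    obtain ⟨y0, hy0, -⟩ := hex 1 one_pos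
    obtain ⟨z, -, hz⟩ : ∃ z : ℕ → X, z 0 = y0 ∧ ∀ k, 0 < dist (z k) x ∧ dist (z (k + 1)) x ≤ dist (z k) x / 4 := by
      have hs : ∀ a : X, 0 < dist a x → ∃ a', 0 < dist a' x ∧ dist a' x ≤ dist a x / 4 := by
        intro a ha
        obtain ⟨y, hy1, hy2⟩ := hex (dist a x / 4) (by positivity)
        exact ⟨y, hy1, hy2.le⟩
      choose! nx h1 h2 using hs
      have hP : ∀ k, 0 < dist (nx^[k] y0) x := by
        intro k
        induction k with
        | zero => exact hy0
        | succ k ih => rw [Function.iterate_succ_apply']; exact h1 _ ih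
      refine ⟨fun k => nx^[k] y0, rfl, fun k => ⟨hP k, ?_⟩⟩
      change dist (nx^[k+1] y0) x ≤ dist (nx^[k] y0) x / 4
      rw [Function.iterate_succ_apply']
      exact h2 _ (hP k)
    have hdec : ∀ i j, i < j → dist (z j) x ≤ dist (z i) x / 4 := by
      intro i j hij
      obtain ⟨m, rfl⟩ := Nat.exists_eq_add_of_lt hij
      induction m with
      | zero => exact (hz i).2
      | succ m ih =>
        have h1 := ih (by omega)
        have h2 := (hz (i + m + 1)).2
        have h3 := (hz (i + m + 1)).1
        have e : i + (m + 1) + 1 = i + m + 1 + 1 := by ring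
        rw [e]
        linarith
    have hgeo : ∀ k, dist (z k) x ≤ dist (z 0) x * (1/2) ^ k := by
      intro k
      induction k with
      | zero => simp
      | succ k ih => rw [pow_succ]; have := hz k; linarith
    set W : Fin (n + 1) → Set X := fun c => {x} ∪ {y | ∃ j, j % (n + 1) ≠ c ∧ y = z j} with hW
    choose df hdf using fun c => (h _ (lip_infDist (W c))).exists
    have hxW : ∀ c, infDist x (W c) = 0 := fun c => infDist_zero_of_mem (Or.inl rfl)
    have hzW : ∀ c : Fin (n + 1), ∀ j, j % (n + 1) ≠ c → infDist (z j) (W c) = 0 := fun c j hj =>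
      infDist_zero_of_mem (Or.inr ⟨j, hj, rfl⟩)
    have hzW' : ∀ c : Fin (n + 1), ∀ j, j % (n + 1) = c → dist (z j) x / 2 ≤ infDist (z j) (W c) := by
      intro c j hj
      refine (le_infDist ⟨x, Or.inl rfl⟩).2 ?_
      rintro y (hy | ⟨i, hi, rfl⟩)
      · rw [mem_singleton_iff.1 hy]; linarith [(hz j).1]
      · have hij : i ≠ j := by rintro rfl; exact hi hj
        rcases lt_or_gt_of_ne hij with hlt | hlt
        · have h1 := hdec i j hlt
          have h2 := dist_triangle (z i) (z j) x
          rw [dist_comm (z i) (z j)] at h2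
          linarith [(hz j).1, (hz i).1]
        · have h1 := hdec j i hlt
          have h2 := dist_triangle (z j) (z i) x
          linarith [(hz j).1, (hz i).1]
    have hdep : ¬ LinearIndependent ℝ df := by
      intro hli
      have := hli.fintype_card_le_finrank
      simp at this
    obtain ⟨l, hl0, c0, hlc⟩ := Fintype.not_linearIndependent_iff.1 hdep
    have hlpos : 0 < |l c0| := abs_pos.2 hlc
    set S : ℝ := ∑ c, |l c| with hS
    have hSpos : 0 < S := hlpos.trans_le (Finset.single_le_sum (f := fun c => |l c|) (fun i _ => abs_nonneg _) (Finset.mem_univ c0))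
    have hε : 0 < |l c0| / (4 * S) := by positivity
    choose r hr hrb using fun c => chart_lim.1 (hdf c) _ hε
    obtain ⟨k, hk⟩ : ∃ k : ℕ, ∀ c, dist (z 0) x * (1/2) ^ k < r c := by
      have : Tendsto (fun k : ℕ => dist (z 0) x * (1/2 : ℝ) ^ k) atTop (𝓝 0) := by
        have := (tendsto_pow_atTop_nhds_zero_of_lt_one (by norm_num : (0:ℝ) ≤ 1/2) (by norm_num)).const_mul (dist (z 0) x)
        simpa using this
      have h2 : ∀ᶠ k : ℕ in atTop, ∀ c, dist (z 0) x * (1/2 : ℝ) ^ k < r c :=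
        eventually_all.2 fun c => this.eventually (gt_mem_nhds (hr c))
      exact h2.exists
    set j := (n + 1) * k + c0 with hj
    have hjm : j % (n + 1) = c0 := by rw [hj, Nat.mul_add_mod]; exact Nat.mod_eq_of_lt c0.2
    have hjk : k ≤ j := by
      have := Nat.le_mul_of_pos_left k (Nat.succ_pos n)
      simp only [Nat.succ_eq_add_one] at this
      omega
    have hjd : ∀ c, dist (z j) x < r c := by
      intro c
      refine lt_of_le_of_lt (hgeo j) (lt_of_le_of_lt ?_ (hk c))
      refine mul_le_mul_of_nonneg_left (pow_le_pow_of_le_one (by norm_num) (by norm_num) hjk) dist_nonneg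
    have hb := fun c => hrb c (z j) (mem_univ _) (hjd c)
    set p := φ (z j) - φ x with hp
    have hsum0 : ∑ c, l c * ⟪df c, p⟫ = 0 := by
      have : ⟪∑ c, l c • df c, p⟫ = 0 := by rw [hl0, inner_zero_left]
      simpa [sum_inner, real_inner_smul_left] using this
    have hsum1 : ∑ c, l c * (infDist (z j) (W c) - infDist x (W c) - ⟪df c, p⟫) = l c0 * infDist (z j) (W c0) := by
      simp only [mul_sub, Finset.sum_sub_distrib, hsum0, hxW, mul_zero, Finset.sum_const_zero, sub_zero]
      refine Finset.sum_eq_single c0 (fun c _ hc => ?_) (by simp)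
      rw [hzW c j, mul_zero]
      intro h'
      exact hc (Fin.ext (by rw [← h', hjm]))
    have hsum2 : |∑ c, l c * (infDist (z j) (W c) - infDist x (W c) - ⟪df c, p⟫)| ≤ S * (|l c0| / (4 * S) * dist (z j) x) := by
      refine (Finset.abs_sum_le_sum_abs _ _).trans ?_
      rw [hS, Finset.sum_mul]
      refine Finset.sum_le_sum fun c _ => ?_
      rw [abs_mul]
      exact mul_le_mul_of_nonneg_left (hb c) (abs_nonneg _)
    rw [hsum1, abs_mul, abs_of_nonneg infDist_nonneg] at hsum2
    have e : S * (|l c0| / (4 * S) * dist (z j) x) = |l c0| * (dist (z j) x / 4) := by field_simp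
    rw [e] at hsum2
    have h5 := le_of_mul_le_mul_left hsum2 hlpos
    have h6 := hzW' c0 j hjm
    linarith [(hz j).1]

theorem singleton_null {X : Type*} [MetricSpace X] [MeasurableSpace X] [BorelSpace X]
    (m : Measure X) (hLDS : IsLDS m Set.univ) (x : X) : m {x} = 0 := by
  by_contra hx
  obtain ⟨n, U, φ, h⟩ := hLDS
  have hxU : ∃ i, x ∈ U i := by
    by_contra hno
    push Not at hno
    refine hx (measure_mono_null ?_ h.cover)
    rintro y rfl
    simpa using hno
  obtain ⟨i, hi⟩ := hxU
  refine no_diff_point (n i) (h.dimpos i) (φ i) x fun f hf => ?_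
  have h1 := h.diff f hf i
  rw [ae_restrict_iff' (h.borel i), ae_iff] at h1
  by_contra hno
  refine hx (measure_mono_null ?_ h1)
  rintro y rfl
  simp only [Set.mem_ofPred_eq, Classical.not_imp]
  exact ⟨hi, hno⟩

theorem cover_small {X : Type*} [MetricSpace X] [MeasurableSpace X] [BorelSpace X] {N : ℕ}
    {F : X → EuclideanSpace ℝ (Fin N)} {A : Set X} (hF : BiLipschitzOn F A) (δ : ℝ) (hδ : 0 < δ) :
    ∃ B : ℕ → Set X, (∀ j, MeasurableSet (B j)) ∧ A ⊆ ⋃ j, B j ∧ ∀ j, ∀ x ∈ B j, ∀ y ∈ B j, dist x y < δ := by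
  obtain ⟨L, hL, hF⟩ := hF
  have hL0 : 0 < L := by linarith
  set q := TopologicalSpace.denseSeq (EuclideanSpace ℝ (Fin N)) with hq
  have hρ : 0 < δ / (8 * L) := by positivity
  have hB : ∀ j, ∃ B : Set X, MeasurableSet B ∧ (∀ x ∈ B, ∀ y ∈ B, dist x y < δ) ∧
      ∀ x ∈ A, dist (F x) (q j) < δ / (8 * L) → x ∈ B := by
    intro j
    by_cases h : ∃ a ∈ A, dist (F a) (q j) < δ / (8 * L)
    · obtain ⟨a, ha, haj⟩ := h
      refine ⟨ball a (δ / 2), measurableSet_ball, ?_, ?_⟩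
      · intro x hx y hy
        have := dist_triangle_right x y a
        have h1 := mem_ball.1 hx
        have h2 := mem_ball.1 hy
        linarith
      · intro x hx hxj
        have h1 := dist_triangle_right (F x) (F a) (q j)
        have h2 := (hF x hx a ha).1
        have h3 : L⁻¹ * dist x a < L⁻¹ * (δ / 4) := by
          have : L⁻¹ * (δ / 4) = δ / (8 * L) + δ / (8 * L) := by field_simp; norm_num
          linarith
        have h4 := lt_of_mul_lt_mul_left h3 (by positivity)
        rw [mem_ball]; linarith
    · push Not at h
      refine ⟨∅, MeasurableSet.empty, by simp, fun x hx hxj => ?_⟩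
      exact absurd hxj (not_lt.2 (h x hx))
  choose B h1 h2 h3 using hB
  refine ⟨B, h1, ?_, h2⟩
  intro x hx
  obtain ⟨j, hj⟩ := (TopologicalSpace.denseRange_denseSeq (EuclideanSpace ℝ (Fin N))).exists_dist_lt (F x) hρ
  exact mem_iUnion.2 ⟨j, h3 j x hx hj⟩

theorem rel_closed_meas {X : Type*} [MetricSpace X] [MeasurableSpace X] [BorelSpace X] {A B : Set X}
    (hA : MeasurableSet A) (hBA : B ⊆ A) (h : ∀ x ∈ A, x ∈ closure B → x ∈ B) : MeasurableSet B := by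
  have : B = A ∩ closure B := Subset.antisymm (fun x hx => ⟨hBA hx, subset_closure hx⟩) (fun x hx => h x hx.1 hx.2)
  rw [this]
  exact hA.inter isClosed_closure.measurableSet

theorem pieces {X : Type*} [MetricSpace X] [MeasurableSpace X] [BorelSpace X] (m : Measure X) {N k : ℕ}
    {F : X → EuclideanSpace ℝ (Fin N)} {A : Set X} (hA : MeasurableSet A) (hF : BiLipschitzOn F A)
    {ψ : X → EuclideanSpace ℝ (Fin k)} (hψ : IsLipschitzOn ψ A)
    (Z : Set X) (hZ : m Z = 0)
    (h : ∀ x ∈ A, x ∉ Z → ∃ q : ℝ, ∃ r : ℝ, 0 < r ∧ ∀ y ∈ A, dist y x < r → dist y x ≤ q * ‖ψ y - ψ x‖) :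
    ∃ P : ℕ → Set X, (∀ j, MeasurableSet (P j)) ∧ (∀ j, P j ⊆ A) ∧ m (A \ ⋃ j, P j) = 0 ∧
      ∀ j, BiLipschitzOn ψ (P j) := by
  obtain ⟨K, hK⟩ := hψ
  set Q : ℕ → Set X := fun q => {x | x ∈ A ∧ ∀ y ∈ A, dist y x < 1 / ((q:ℝ) + 1) → dist y x ≤ ((q:ℝ) + 1) * ‖ψ y - ψ x‖} with hQ
  have hQA : ∀ q, Q q ⊆ A := fun q x hx => hx.1
  have hQm : ∀ q, MeasurableSet (Q q) := by
    intro q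
    refine rel_closed_meas hA (hQA q) ?_
    intro x hx hxc
    refine ⟨hx, fun y hy hyx => ?_⟩
    have hne : (𝓝[Q q] x).NeBot := mem_closure_iff_nhdsWithin_neBot.1 hxc
    have hc : Tendsto ψ (𝓝[Q q] x) (𝓝 (ψ x)) :=
      (hK.continuousOn x hx).mono_left (nhdsWithin_mono _ (hQA q))
    have hid : Tendsto (fun z : X => z) (𝓝[Q q] x) (𝓝 x) := tendsto_id.mono_left nhdsWithin_le_nhds
    have hd : Tendsto (fun z => dist y z) (𝓝[Q q] x) (𝓝 (dist y x)) := tendsto_const_nhds.dist hid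
    have hr : Tendsto (fun z => ((q:ℝ) + 1) * ‖ψ y - ψ z‖) (𝓝[Q q] x) (𝓝 (((q:ℝ) + 1) * ‖ψ y - ψ x‖)) :=
      ((tendsto_const_nhds.sub hc).norm).const_mul _
    refine le_of_tendsto_of_tendsto hd hr ?_
    filter_upwards [hd.eventually (gt_mem_nhds hyx), self_mem_nhdsWithin] with z hz hzQ
    exact hzQ.2 y hy hz
  have hcov := fun q : ℕ => cover_small hF (1 / ((q:ℝ) + 1)) (by positivity)
  choose B hB1 hB2 hB3 using hcov
  refine ⟨fun j => Q j.unpair.1 ∩ B j.unpair.1 j.unpair.2, fun j => (hQm _).inter (hB1 _ _),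
    fun j => inter_subset_left.trans (hQA _), measure_mono_null ?_ hZ, ?_⟩
  · rintro x ⟨hxA, hxn⟩
    by_contra hxZ
    apply hxn
    obtain ⟨q, r, hr, hb⟩ := h x hxA hxZ
    obtain ⟨p, hp⟩ := exists_nat_gt (max q (1 / r))
    have hp1 : q < p := lt_of_le_of_lt (le_max_left _ _) hp
    have hp2 : 1 / r < p := lt_of_le_of_lt (le_max_right _ _) hp
    have hxQ : x ∈ Q p := by
      refine ⟨hxA, fun y hy hyx => ?_⟩
      have hlt : 1 / ((p:ℝ) + 1) < r := by
        rw [div_lt_iff₀ (by positivity)]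
        rw [div_lt_iff₀ hr] at hp2
        nlinarith
      refine (hb y hy (hyx.trans hlt)).trans ?_
      exact mul_le_mul_of_nonneg_right (by linarith) (norm_nonneg _)
    obtain ⟨j, hj⟩ := mem_iUnion.1 (hB2 p hxA)
    refine mem_iUnion.2 ⟨Nat.pair p j, ?_⟩
    simp only [Nat.unpair_pair]
    exact ⟨hxQ, hj⟩
  · intro j
    set q := j.unpair.1
    have hq0 : (0:ℝ) ≤ q := Nat.cast_nonneg _
    have hK0 : (0:ℝ) ≤ K := K.2
    refine ⟨K + q + 1, by linarith, ?_⟩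
    intro x hx y hy
    constructor
    · rw [inv_mul_le_iff₀ (by linarith)]
      have h1 := hy.1.2 x hx.1.1 (hB3 q _ x hx.2 y hy.2)
      rw [dist_eq_norm (ψ x)]
      refine h1.trans (mul_le_mul_of_nonneg_right (by linarith) (norm_nonneg _))
    · refine (hK.dist_le_mul x hx.1.1 y hy.1.1).trans (mul_le_mul_of_nonneg_right (by linarith) dist_nonneg)

def Good {X : Type*} [MetricSpace X] [MeasurableSpace X] [BorelSpace X] (m : Measure X) (A : Set X) : Prop :=
  ∃ (R : ℕ → Set X) (n : ℕ → ℕ),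
      (∀ j, MeasurableSet (R j)) ∧ m (A \ ⋃ j, R j) = 0 ∧
      ∀ j, 0 < n j ∧
        (∃ Φ : X → EuclideanSpace ℝ (Fin (n j)), BiLipschitzOn Φ (R j)) ∧
        m.restrict (R j) ≪ μH[(n j : ℝ)]

theorem good_null {X : Type*} [MetricSpace X] [MeasurableSpace X] [BorelSpace X] (m : Measure X) (A : Set X)
    (h : m A = 0) : Good m A := by
  refine ⟨fun _ => ∅, fun _ => 1, fun _ => MeasurableSet.empty, measure_mono_null sdiff_subset h, fun j => ⟨one_pos, ⟨fun _ => 0, 1, le_rfl, by simp⟩, ?_⟩⟩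
  simp [Measure.AbsolutelyContinuous.zero]

theorem good_single {X : Type*} [MetricSpace X] [MeasurableSpace X] [BorelSpace X] (m : Measure X) (A : Set X)
    (hA : MeasurableSet A) (n : ℕ) (hn : 0 < n) (Φ : X → EuclideanSpace ℝ (Fin n)) (hΦ : BiLipschitzOn Φ A)
    (hac : m.restrict A ≪ μH[(n : ℝ)]) : Good m A :=
  ⟨fun _ => A, fun _ => n, fun _ => hA, by rw [iUnion_const]; simp, fun _ => ⟨hn, ⟨Φ, hΦ⟩, hac⟩⟩

theorem good_union {X : Type*} [MetricSpace X] [MeasurableSpace X] [BorelSpace X] (m : Measure X) (A : Set X)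
    (P : ℕ → Set X) (hP : ∀ j, Good m (P j)) (h : m (A \ ⋃ j, P j) = 0) : Good m A := by
  choose R n h1 h2 h3 using hP
  refine ⟨fun j => R j.unpair.1 j.unpair.2, fun j => n j.unpair.1 j.unpair.2, fun j => h1 _ _, ?_, fun j => h3 _ _⟩
  have h4 : m (⋃ i, (P i \ ⋃ j, R i j)) = 0 := measure_iUnion_null h2
  refine measure_mono_null ?_ (measure_union_null h h4)
  rintro x ⟨hxA, hx⟩
  by_cases hxP : x ∈ ⋃ j, P j
  · right
    obtain ⟨i, hi⟩ := mem_iUnion.1 hxP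
    refine mem_iUnion.2 ⟨i, hi, fun hx' => ?_⟩
    obtain ⟨j, hj⟩ := mem_iUnion.1 hx'
    refine hx (mem_iUnion.2 ⟨Nat.pair i j, ?_⟩)
    simpa only [Nat.unpair_pair] using hj
  · exact Or.inl ⟨hxA, hxP⟩

def OKset {k : ℕ} (R K : Set (EuclideanSpace ℝ (Fin k))) (γ r : ℝ) : Set (EuclideanSpace ℝ (Fin k)) :=
  {v | ∀ a ∈ K, ∃ y ∈ R, ‖y - v‖ < r ∧ γ * ‖y - v‖ < |⟪a, y - v⟫|}

theorem isOpen_OKset {k : ℕ} (R K : Set (EuclideanSpace ℝ (Fin k))) (hK : IsCompact K) (γ r : ℝ) :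
    IsOpen (OKset R K γ r) := by
  rw [isOpen_iff_mem_nhds]
  intro v hv
  refine hK.eventually_forall_of_forall_eventually
    (P := fun v a => ∃ y ∈ R, ‖y - v‖ < r ∧ γ * ‖y - v‖ < |⟪a, y - v⟫|) ?_
  intro a ha
  obtain ⟨y, hy, h1, h2⟩ := hv a ha
  have c1 : IsOpen {z : EuclideanSpace ℝ (Fin k) × EuclideanSpace ℝ (Fin k) | ‖y - z.1‖ < r} :=
    isOpen_lt (by fun_prop) (by fun_prop)
  have c2 : IsOpen {z : EuclideanSpace ℝ (Fin k) × EuclideanSpace ℝ (Fin k) | γ * ‖y - z.1‖ < |⟪z.2, y - z.1⟫|} :=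
    isOpen_lt (by fun_prop) (by fun_prop)
  filter_upwards [c1.mem_nhds (x := (v, a)) h1, c2.mem_nhds (x := (v, a)) h2] with z hz1 hz2
  exact ⟨y, hy, hz1, hz2⟩

theorem exists_annihilator {k : ℕ} (R K : Set (EuclideanSpace ℝ (Fin k))) (hK : IsCompact K) (v : EuclideanSpace ℝ (Fin k))
    (h : ∀ p : ℕ, ∃ j : ℕ, v ∉ OKset R K (1 / ((p:ℝ) + 1)) (1 / ((j:ℝ) + 1))) :
    ∃ a ∈ K, ∀ ε : ℝ, 0 < ε → ∃ r : ℝ, 0 < r ∧ ∀ y ∈ R, ‖y - v‖ < r → |⟪a, y - v⟫| ≤ ε * ‖y - v‖ := by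
  have h1 : ∀ p : ℕ, ∃ a ∈ K, ∃ r : ℝ, 0 < r ∧ ∀ y ∈ R, ‖y - v‖ < r → |⟪a, y - v⟫| ≤ 1 / ((p:ℝ) + 1) * ‖y - v‖ := by
    intro p
    obtain ⟨j, hj⟩ := h p
    simp only [OKset, Set.mem_ofPred_eq] at hj
    push Not at hj
    obtain ⟨a, ha, hb⟩ := hj
    exact ⟨a, ha, 1 / ((j:ℝ) + 1), by positivity, hb⟩
  choose a ha r hr hb using h1
  obtain ⟨b, hbK, φ, hφ, hlim⟩ := hK.tendsto_subseq ha
  refine ⟨b, hbK, fun ε hε => ?_⟩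
  have e1 : ∀ᶠ i in atTop, ‖a (φ i) - b‖ < ε / 2 := by
    have := (Metric.tendsto_nhds.1 hlim) (ε / 2) (by positivity)
    filter_upwards [this] with i hi
    rwa [dist_eq_norm] at hi
  have e2 : ∀ᶠ i in atTop, 1 / ((φ i : ℝ) + 1) < ε / 2 :=
    ((tendsto_one_div_add_atTop_nhds_zero_nat (𝕜 := ℝ)).comp hφ.tendsto_atTop).eventually (gt_mem_nhds (by positivity))
  obtain ⟨i, hi1, hi2⟩ := (e1.and e2).exists
  refine ⟨r (φ i), hr _, fun y hy hyr => ?_⟩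
  have h3 := hb _ y hy hyr
  have h4 : ⟪b, y - v⟫ = ⟪a (φ i), y - v⟫ - ⟪a (φ i) - b, y - v⟫ := by rw [inner_sub_left]; ring
  have h5 := abs_real_inner_le_norm (a (φ i) - b) (y - v)
  rw [h4]
  have h6 := abs_sub (⟪a (φ i), y - v⟫) (⟪a (φ i) - b, y - v⟫)
  have h7 : ‖a (φ i) - b‖ * ‖y - v‖ ≤ ε / 2 * ‖y - v‖ := mul_le_mul_of_nonneg_right hi1.le (norm_nonneg _)
  have h8 : 1 / ((φ i : ℝ) + 1) * ‖y - v‖ ≤ ε / 2 * ‖y - v‖ := mul_le_mul_of_nonneg_right hi2.le (norm_nonneg _)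
  linarith

theorem spanning_of_OK {k : ℕ} (hk : 0 < k) (R : Set (EuclideanSpace ℝ (Fin k))) (γ : ℝ) (hγ : 0 < γ) (v : EuclideanSpace ℝ (Fin k))
    (h : ∀ j : ℕ, v ∈ OKset R (sphere 0 1) γ (1 / ((j:ℝ) + 1))) : Spanning R γ v := by
  intro r hr a
  obtain ⟨j, hj⟩ := exists_nat_one_div_lt hr
  by_cases ha : a = 0
  · obtain ⟨y, hy, h1, h2⟩ := h j (EuclideanSpace.single ⟨0, hk⟩ 1) (by simp)
    refine ⟨y, hy, ?_, h1.trans hj, ?_⟩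
    · rw [norm_pos_iff]
      intro h0
      rw [h0] at h2; simp at h2
    · rw [ha]; simp
  · have hn : 0 < ‖a‖ := norm_pos_iff.2 ha
    obtain ⟨y, hy, h1, h2⟩ := h j (‖a‖⁻¹ • a) (by simp [norm_smul, hn.ne'])
    refine ⟨y, hy, ?_, h1.trans hj, ?_⟩
    · rw [norm_pos_iff]
      intro h0
      rw [h0] at h2; simp at h2
    · rw [real_inner_smul_left, abs_mul, abs_of_pos (inv_pos.2 hn), lt_inv_mul_iff₀ hn] at h2
      linarith

def dropc {k : ℕ} (i : Fin (k + 1)) (v : EuclideanSpace ℝ (Fin (k + 1))) : EuclideanSpace ℝ (Fin k) :=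
  WithLp.toLp 2 (fun j => v (i.succAbove j))

theorem dropc_sub {k : ℕ} (i : Fin (k + 1)) (u v : EuclideanSpace ℝ (Fin (k + 1))) :
    dropc i u - dropc i v = dropc i (u - v) := by
  ext j; simp [dropc]

theorem inner_dropc {k : ℕ} (i : Fin (k + 1)) (u v : EuclideanSpace ℝ (Fin (k + 1))) :
    ⟪u, v⟫ = u i * v i + ⟪dropc i u, dropc i v⟫ := by
  simp only [PiLp.inner_apply, Fin.sum_univ_succAbove _ i, dropc]
  simp [mul_comm]

theorem norm_sq_dropc {k : ℕ} (i : Fin (k + 1)) (v : EuclideanSpace ℝ (Fin (k + 1))) :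
    ‖v‖ ^ 2 = v i ^ 2 + ‖dropc i v‖ ^ 2 := by
  rw [← real_inner_self_eq_norm_sq, ← real_inner_self_eq_norm_sq, inner_dropc i]; ring

theorem norm_dropc_le {k : ℕ} (i : Fin (k + 1)) (v : EuclideanSpace ℝ (Fin (k + 1))) : ‖dropc i v‖ ≤ ‖v‖ := by
  have := norm_sq_dropc i v
  refine le_of_sq_le_sq ?_ (norm_nonneg _)
  nlinarith [sq_nonneg (v i)]

theorem norm_le_dropc {k : ℕ} (i : Fin (k + 1)) (v : EuclideanSpace ℝ (Fin (k + 1))) : ‖v‖ ≤ |v i| + ‖dropc i v‖ := by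
  have := norm_sq_dropc i v
  refine le_of_sq_le_sq ?_ (by positivity)
  rw [this, ← sq_abs (v i)]
  nlinarith [mul_nonneg (abs_nonneg (v i)) (norm_nonneg (dropc i v))]

theorem drop_bound {k : ℕ} (i : Fin (k + 1)) (a v : EuclideanSpace ℝ (Fin (k + 1))) (ha : ‖a‖ = 1) (δ : ℝ) (hδ : 0 < δ)
    (hai : δ ≤ |a i|) (h : |⟪a, v⟫| ≤ δ / 2 * ‖v‖) : ‖v‖ ≤ 2 * (1 / δ + 1) * ‖dropc i v‖ := by
  have h1 := inner_dropc i a v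
  have h2 := abs_real_inner_le_norm (dropc i a) (dropc i v)
  have h3 : ‖dropc i a‖ * ‖dropc i v‖ ≤ 1 * ‖dropc i v‖ :=
    mul_le_mul_of_nonneg_right ((norm_dropc_le i a).trans ha.le) (norm_nonneg _)
  have h4 : |a i * v i| ≤ δ / 2 * ‖v‖ + ‖dropc i v‖ := by
    have : a i * v i = ⟪a, v⟫ - ⟪dropc i a, dropc i v⟫ := by rw [h1]; ring
    rw [this]
    have := abs_sub (⟪a, v⟫) (⟪dropc i a, dropc i v⟫)
    linarith
  rw [abs_mul] at h4
  have h5 : δ * |v i| ≤ |a i| * |v i| := mul_le_mul_of_nonneg_right hai (abs_nonneg _)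
  have h6 := norm_le_dropc i v
  have h7 : |v i| ≤ ‖v‖ / 2 + 1 / δ * ‖dropc i v‖ := by
    have : δ * |v i| ≤ δ * (‖v‖ / 2 + 1 / δ * ‖dropc i v‖) := by
      have e : δ * (‖v‖ / 2 + 1 / δ * ‖dropc i v‖) = δ / 2 * ‖v‖ + ‖dropc i v‖ := by field_simp
      linarith
    exact le_of_mul_le_mul_left this hδ
  linarith

theorem bilip_lip {X : Type*} [MetricSpace X] {k : ℕ} {ψ : X → EuclideanSpace ℝ (Fin k)} {A : Set X}
    (h : BiLipschitzOn ψ A) : IsLipschitzOn ψ A := by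
  obtain ⟨L, hL, h⟩ := h
  refine ⟨⟨L, by linarith⟩, LipschitzOnWith.of_dist_le_mul fun x hx y hy => (h x hx y hy).2⟩

theorem bilip_mono {X Y : Type*} [MetricSpace X] [MetricSpace Y] {ψ : X → Y} {A B : Set X}
    (h : BiLipschitzOn ψ A) (hBA : B ⊆ A) : BiLipschitzOn ψ B := by
  obtain ⟨L, hL, h⟩ := h
  exact ⟨L, hL, fun x hx y hy => h x (hBA hx) y (hBA hy)⟩

theorem chart_mono {X : Type*} [MetricSpace X] {S S' : Set X} {n : ℕ}
    {φ : X → EuclideanSpace ℝ (Fin n)} {f : X → ℝ} {x : X} {df : EuclideanSpace ℝ (Fin n)}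
    (h : HasChartDerivAt S φ f x df) (hS : S' ⊆ S) : HasChartDerivAt S' φ f x df := by
  rw [chart_lim] at h ⊢
  intro ε hε
  obtain ⟨r, hr, hb⟩ := h ε hε
  exact ⟨r, hr, fun y hy => hb y (hS hy)⟩

theorem vol_image_null {X : Type*} [MetricSpace X] [MeasurableSpace X] [BorelSpace X] {k : ℕ}
    {ψ : X → EuclideanSpace ℝ (Fin k)} {A s : Set X} (h : IsLipschitzOn ψ A) (hs : s ⊆ A)
    (h0 : μH[(k : ℝ)] s = 0) : volume (ψ '' s) = 0 := by
  obtain ⟨K, hK⟩ := h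
  have h1 := (hK.mono hs).hausdorffMeasure_image_le (d := (k : ℝ)) (Nat.cast_nonneg _)
  rw [h0, mul_zero] at h1
  have h2 : μH[(k : ℝ)] (ψ '' s) = 0 := le_antisymm h1 zero_le
  have hfr : Module.finrank ℝ (EuclideanSpace ℝ (Fin k)) = k := by simp
  have hH : (μH[(k : ℝ)] : Measure (EuclideanSpace ℝ (Fin k))).IsAddHaarMeasure := by
    have := isAddHaarMeasure_hausdorffMeasure (E := EuclideanSpace ℝ (Fin k))
    rwa [hfr] at this
  exact (Measure.absolutelyContinuous_isAddHaarMeasure volume (μH[(k : ℝ)] : Measure (EuclideanSpace ℝ (Fin k)))) h2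

theorem ac_piece {X : Type*} [MetricSpace X] [MeasurableSpace X] [BorelSpace X] (m : Measure X) {k : ℕ} (hk : 0 < k)
    {ψ : X → EuclideanSpace ℝ (Fin k)} {A R : Set X} (hA : MeasurableSet A) (hψ : BiLipschitzOn ψ A) (hRA : R ⊆ A)
    (hR : MeasurableSet R)
    (H : ∀ f : X → ℝ, IsLipschitzOn f Set.univ → ∀ᵐ x ∂(m.restrict A), ∃ df, HasChartDerivAt A ψ f x df)
    (γ : ℝ) (hγ : 0 < γ) (hγ1 : γ ≤ 1) (hspan : ∀ x ∈ R, Spanning (ψ '' A) γ (ψ x)) :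
    m.restrict R ≪ μH[(k : ℝ)] := by
  refine Measure.AbsolutelyContinuous.mk fun s hs h0 => ?_
  rw [Measure.restrict_apply hs]
  have hT := vol_image_null (bilip_lip hψ) (inter_subset_right.trans hRA : s ∩ R ⊆ A)
    (measure_mono_null inter_subset_left h0)
  have gl := thmN hk (ψ '' (s ∩ R)) (ψ '' A) hT γ hγ hγ1
    (by rintro _ ⟨x, hx, rfl⟩; exact hspan x hx.2)
  obtain ⟨f, hf, hnd⟩ := gl
  obtain ⟨L, hL, hLb⟩ := hψ
  have hL0 : 0 < L := by linarith
  have hg : ∀ c, ∃ g : X → ℝ, IsLipschitzOn g Set.univ ∧ ∀ x ∈ A, g x = f (ψ x) c := by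
    intro c
    have hl : LipschitzOnWith (⟨2 * L, by positivity⟩ : NNReal) (fun x => f (ψ x) c) A := by
      refine LipschitzOnWith.of_dist_le_mul fun x hx y hy => ?_
      have h1 : ‖f (ψ x) c - f (ψ y) c‖ ≤ ‖f (ψ x) - f (ψ y)‖ := PiLp.norm_apply_le (f (ψ x) - f (ψ y)) c
      have h2 := hf (ψ y) (ψ x)
      have h3 := (hLb x hx y hy).2
      rw [dist_eq_norm (ψ x)] at h3
      rw [dist_eq_norm]
      change _ ≤ 2 * L * dist x y
      linarith
    obtain ⟨g, hg1, hg2⟩ := hl.extend_real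
    exact ⟨g, ⟨_, hg1.lipschitzOnWith⟩, fun x hx => (hg2 hx).symm⟩
  choose g hg1 hg2 using hg
  have hae : ∀ᵐ x ∂(m.restrict A), ∀ c, ∃ df, HasChartDerivAt A ψ (g c) x df :=
    ae_all_iff.2 fun c => H _ (hg1 c)
  rw [ae_restrict_iff' hA, ae_iff] at hae
  refine measure_mono_null ?_ hae
  intro x hx
  simp only [Set.mem_ofPred_eq, Classical.not_imp]
  have hxA := hRA hx.2
  refine ⟨hxA, fun hall => ?_⟩
  choose df hdf using hall
  refine hnd (ψ x) ⟨x, hx, rfl⟩ ?_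
  have hcoord : ∀ c, HasFDerivWithinAt (fun v => f v c) (innerSL ℝ (df c)) (ψ '' A) (ψ x) := by
    intro c
    rw [hasFDerivWithinAt_iff_isLittleO, Asymptotics.isLittleO_iff]
    intro ε hε
    obtain ⟨r, hr, hb⟩ := chart_lim.1 (hdf c) (ε / L) (by positivity)
    refine Metric.mem_nhdsWithin_iff.2 ⟨r / L, by positivity, ?_⟩
    rintro _ ⟨hw, y, hy, rfl⟩
    have h1 := (hLb y hy x hxA).1
    rw [inv_mul_le_iff₀ hL0] at h1
    have h2 : dist (ψ y) (ψ x) < r / L := hw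
    rw [lt_div_iff₀ hL0] at h2
    have h3 := hb y hy (by linarith)
    rw [hg2 c y hy, hg2 c x hxA] at h3
    change ‖f (ψ y) c - f (ψ x) c - ⟪df c, ψ y - ψ x⟫‖ ≤ ε * ‖ψ y - ψ x‖
    rw [Real.norm_eq_abs]
    refine h3.trans ?_
    rw [← dist_eq_norm]
    have e : ε * dist (ψ y) (ψ x) = ε / L * (L * dist (ψ y) (ψ x)) := by field_simp
    rw [e]
    exact mul_le_mul_of_nonneg_left h1 (by positivity)
  have hd : DifferentiableWithinAt ℝ f (ψ '' A) (ψ x) :=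
    differentiableWithinAt_euclidean.2 fun c => (hcoord c).differentiableWithinAt
  exact ⟨_, hd.hasFDerivWithinAt⟩

theorem drop_step {X : Type*} [MetricSpace X] [MeasurableSpace X] [BorelSpace X] (m : Measure X) {k : ℕ}
    {ψ : X → EuclideanSpace ℝ (Fin (k + 1))} {A B : Set X} (hA : MeasurableSet A) (hψ : BiLipschitzOn ψ A) (hBA : B ⊆ A)
    (hB : MeasurableSet B) (i : Fin (k + 1)) (δ : ℝ) (hδ : 0 < δ)
    (H : ∀ f : X → ℝ, IsLipschitzOn f Set.univ → ∀ᵐ x ∂(m.restrict A), ∃ df, HasChartDerivAt A ψ f x df)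
    (hann : ∀ x ∈ B, ∃ a : EuclideanSpace ℝ (Fin (k + 1)), ‖a‖ = 1 ∧ δ ≤ |a i| ∧ ∀ ε : ℝ, 0 < ε → ∃ r : ℝ, 0 < r ∧
      ∀ y ∈ ψ '' A, ‖y - ψ x‖ < r → |⟪a, y - ψ x⟫| ≤ ε * ‖y - ψ x‖) :
    ∃ P : ℕ → Set X, (∀ j, MeasurableSet (P j)) ∧ (∀ j, P j ⊆ B) ∧ m (B \ ⋃ j, P j) = 0 ∧
      (∀ j, BiLipschitzOn (fun x => dropc i (ψ x)) (P j)) ∧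
      ∀ j, ∀ f : X → ℝ, IsLipschitzOn f Set.univ → ∀ᵐ x ∂(m.restrict (P j)), ∃ df,
        HasChartDerivAt (P j) (fun x => dropc i (ψ x)) f x df := by
  have hψ0 := hψ
  obtain ⟨L, hL, hLb⟩ := hψ
  have hL0 : 0 < L := by linarith
  have hann' : ∀ x ∈ B, ∃ a : EuclideanSpace ℝ (Fin (k + 1)), ‖a‖ = 1 ∧ δ ≤ |a i| ∧ ∀ ε : ℝ, 0 < ε → ∃ r : ℝ, 0 < r ∧
      ∀ y ∈ A, dist y x < r → |⟪a, ψ y - ψ x⟫| ≤ ε * ‖ψ y - ψ x‖ := by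
    intro x hx
    obtain ⟨a, ha, hai, hb⟩ := hann x hx
    refine ⟨a, ha, hai, fun ε hε => ?_⟩
    obtain ⟨r, hr, hb⟩ := hb ε hε
    refine ⟨r / L, by positivity, fun y hy hyx => hb _ ⟨y, hy, rfl⟩ ?_⟩
    have h1 := (hLb y hy x (hBA hx)).2
    rw [lt_div_iff₀ hL0] at hyx
    rw [← dist_eq_norm]
    linarith
  have hlip : IsLipschitzOn (fun x => dropc i (ψ x)) B := by
    refine ⟨⟨L, hL0.le⟩, LipschitzOnWith.of_dist_le_mul fun x hx y hy => ?_⟩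
    rw [dist_eq_norm, dropc_sub]
    refine (norm_dropc_le _ _).trans ?_
    rw [← dist_eq_norm]
    exact (hLb x (hBA hx) y (hBA hy)).2
  have gl := pieces m hB (bilip_mono hψ0 hBA) hlip ∅ measure_empty ?_
  · obtain ⟨P, hP1, hP2, hP3, hP4⟩ := gl
    refine ⟨P, hP1, hP2, hP3, hP4, fun j f hf => ?_⟩
    have h1 := ae_restrict_of_ae_restrict_of_subset ((hP2 j).trans hBA) (H f hf)
    filter_upwards [h1, ae_restrict_mem (hP1 j)] with x hx hxP
    obtain ⟨df, hdf⟩ := hx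
    obtain ⟨a, ha, hai, hb⟩ := hann' x (hP2 j hxP)
    have ha0 : a i ≠ 0 := abs_pos.1 (hδ.trans_le hai)
    refine ⟨dropc i df - (df i / a i) • dropc i a, ?_⟩
    rw [chart_lim] at hdf ⊢
    intro ε hε
    set C := |df i / a i| with hC
    have hC0 : 0 ≤ C := abs_nonneg _
    obtain ⟨r1, hr1, hb1⟩ := hdf (ε / 2) (by positivity)
    obtain ⟨r2, hr2, hb2⟩ := hb (ε / (2 * (C + 1) * L)) (by positivity)
    refine ⟨min r1 r2, lt_min hr1 hr2, fun y hy hyx => ?_⟩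
    have hyA := hBA (hP2 j hy)
    have hxA := hBA (hP2 j hxP)
    have q1 := hb1 y hyA (hyx.trans_le (min_le_left _ _))
    have q2 := hb2 y hyA (hyx.trans_le (min_le_right _ _))
    have q3 := (hLb y hyA x hxA).2
    rw [dropc_sub]
    set v := ψ y - ψ x with hv
    rw [dist_eq_norm (ψ y)] at q3
    have e1 : ⟪dropc i df - (df i / a i) • dropc i a, dropc i v⟫ = ⟪df, v⟫ - (df i / a i) * ⟪a, v⟫ := by
      rw [inner_dropc i df v, inner_dropc i a v, inner_sub_left, real_inner_smul_left]
      field_simp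
      ring
    rw [e1]
    have e2 : f y - f x - (⟪df, v⟫ - (df i / a i) * ⟪a, v⟫) = (f y - f x - ⟪df, v⟫) + (df i / a i) * ⟪a, v⟫ := by ring
    rw [e2]
    refine (abs_add_le _ _).trans ?_
    rw [abs_mul, ← hC]
    have e3 : C * |⟪a, v⟫| ≤ ε / 2 * dist y x := by
      calc C * |⟪a, v⟫| ≤ (C + 1) * |⟪a, v⟫| := mul_le_mul_of_nonneg_right (by linarith) (abs_nonneg _)
        _ ≤ (C + 1) * (ε / (2 * (C + 1) * L) * (L * dist y x)) := by
          refine mul_le_mul_of_nonneg_left (q2.trans ?_) (by positivity)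
          exact mul_le_mul_of_nonneg_left q3 (by positivity)
        _ = ε / 2 * dist y x := by field_simp
    linarith
  · intro x hx _
    obtain ⟨a, ha, hai, hb⟩ := hann' x hx
    obtain ⟨r, hr, hb⟩ := hb (δ / 2) (by positivity)
    refine ⟨L * (2 * (1 / δ + 1)), r, hr, fun y hy hyx => ?_⟩
    have h1 := drop_bound i a _ ha δ hδ hai (hb y (hBA hy) hyx)
    rw [dropc_sub]
    have h2 := (hLb y (hBA hy) x (hBA hx)).1
    rw [inv_mul_le_iff₀ hL0, dist_eq_norm (ψ y)] at h2
    refine h2.trans ?_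
    rw [mul_assoc]
    exact mul_le_mul_of_nonneg_left h1 hL0.le

theorem meas_preimage {X : Type*} [MetricSpace X] [MeasurableSpace X] [BorelSpace X] {k : ℕ}
    {ψ : X → EuclideanSpace ℝ (Fin k)} {A : Set X} (hA : MeasurableSet A) (hψ : IsLipschitzOn ψ A)
    {W : Set (EuclideanSpace ℝ (Fin k))} (hW : MeasurableSet W) : MeasurableSet (A ∩ ψ ⁻¹' W) := by
  obtain ⟨K, hK⟩ := hψ
  have hc := (continuousOn_iff_continuous_domRestrict.1 hK.continuousOn).measurable hW
  have := hA.subtype_image hc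
  convert this using 1
  ext x
  simp [and_comm]

theorem induct {X : Type*} [MetricSpace X] [MeasurableSpace X] [BorelSpace X] (m : Measure X)
    (hLDS : IsLDS m Set.univ) (k : ℕ) : ∀ (ψ : X → EuclideanSpace ℝ (Fin k)) (A : Set X) (_ : MeasurableSet A)
    (_ : BiLipschitzOn ψ A)
    (_ : ∀ f : X → ℝ, IsLipschitzOn f Set.univ → ∀ᵐ x ∂(m.restrict A), ∃ df, HasChartDerivAt A ψ f x df),
    Good m A := by
  induction k with
  | zero =>
    intro ψ A hA hψ H
    refine good_null m A ?_
    obtain ⟨L, hL, hLb⟩ := hψ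
    have hsub : A.Subsingleton := by
      intro x hx y hy
      have h1 := (hLb x hx y hy).1
      rw [inv_mul_le_iff₀ (by linarith), Subsingleton.elim (ψ x) (ψ y), dist_self, mul_zero] at h1
      exact dist_le_zero.1 h1
    rcases hsub.eq_empty_or_singleton with h | ⟨x, h⟩
    · rw [h]; exact measure_empty
    · rw [h]; exact singleton_null m hLDS x
  | succ k ih =>
    intro ψ A hA hψ H
    set R := ψ '' A with hR
    -- spanning pieces
    set S : ℕ → Set X := fun p => A ∩ ψ ⁻¹' (⋂ j : ℕ, OKset R (sphere 0 1) (1 / ((p:ℝ) + 1)) (1 / ((j:ℝ) + 1))) with hS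
    have hSm : ∀ p, MeasurableSet (S p) := fun p => meas_preimage hA (bilip_lip hψ)
      (MeasurableSet.iInter fun j => (isOpen_OKset _ _ (isCompact_sphere _ _) _ _).measurableSet)
    have hSg : ∀ p, Good m (S p) := by
      intro p
      refine good_single m (S p) (hSm p) (k + 1) (Nat.succ_pos k) ψ (bilip_mono hψ inter_subset_left) ?_
      refine ac_piece m (Nat.succ_pos k) hA hψ inter_subset_left (hSm p) H (1 / ((p:ℝ) + 1)) (by positivity) ?_ ?_
      · rw [div_le_one (by positivity)]; linarith [Nat.cast_nonneg (α := ℝ) p]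
      · intro x hx
        exact spanning_of_OK (Nat.succ_pos k) _ _ (by positivity) _ (mem_iInter.1 hx.2)
    set K : Fin (k + 1) → ℕ → Set (EuclideanSpace ℝ (Fin (k + 1))) :=
      fun i c => sphere 0 1 ∩ {a | 1 / ((c:ℝ) + 1) ≤ |a i|} with hK
    have hKc : ∀ i c, IsCompact (K i c) := fun i c =>
      (isCompact_sphere _ _).inter_right (isClosed_le continuous_const (by fun_prop))
    set B : Fin (k + 1) → ℕ → Set X := fun i c => A ∩ ψ ⁻¹' (⋂ p : ℕ, ⋃ j : ℕ, (OKset R (K i c) (1 / ((p:ℝ) + 1)) (1 / ((j:ℝ) + 1)))ᶜ) with hB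
    have hBm : ∀ i c, MeasurableSet (B i c) := fun i c => meas_preimage hA (bilip_lip hψ)
      (MeasurableSet.iInter fun p => MeasurableSet.iUnion fun j => (isOpen_OKset _ _ (hKc i c) _ _).measurableSet.compl)
    have hBg : ∀ i c, Good m (B i c) := by
      intro i c
      have gl := drop_step m hA hψ (inter_subset_left : B i c ⊆ A) (hBm i c) i (1 / ((c:ℝ) + 1)) (by positivity) H ?_
      · obtain ⟨P, hP1, hP2, hP3, hP4, hP5⟩ := gl
        exact good_union m _ P (fun j => ih _ _ (hP1 j) (hP4 j) (hP5 j)) hP3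
      · intro x hx
        have h2 : ∀ p : ℕ, ∃ j : ℕ, ψ x ∉ OKset R (K i c) (1 / ((p:ℝ) + 1)) (1 / ((j:ℝ) + 1)) := by
          intro p
          exact mem_iUnion.1 (mem_iInter.1 hx.2 p)
        obtain ⟨a, ha, hb⟩ := exists_annihilator _ _ (hKc i c) _ h2
        exact ⟨a, by simpa using ha.1, ha.2, hb⟩
    have hBi : ∀ i, Good m (⋃ c, B i c) := fun i => good_union m _ (B i) (hBg i) (by simp)
    have hSall : Good m (⋃ p, S p) := good_union m _ S hSg (by simp)
    refine good_union m A (fun j => if h : j < k + 1 then ⋃ c, B ⟨j, h⟩ c else ⋃ p, S p) ?_ ?_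
    · intro j
      by_cases h : j < k + 1
      · simp only [h, dif_pos]; exact hBi _
      · simp only [h, dif_neg, not_false_eq_true]; exact hSall
    · refine measure_mono_null ?_ (measure_empty (μ := m))
      rintro x ⟨hxA, hx⟩
      refine hx ?_
      by_cases hxS : x ∈ ⋃ p, S p
      · exact mem_iUnion.2 ⟨k + 1, by simpa using hxS⟩
      · have h2 : ∀ p : ℕ, ∃ j : ℕ, ψ x ∉ OKset R (sphere 0 1) (1 / ((p:ℝ) + 1)) (1 / ((j:ℝ) + 1)) := by
          intro p
          by_contra hno
          push Not at hno
          exact hxS (mem_iUnion.2 ⟨p, hxA, mem_iInter.2 hno⟩)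
        obtain ⟨a, ha, hb⟩ := exists_annihilator _ _ (isCompact_sphere _ _) _ h2
        have ha1 : ‖a‖ = 1 := by simpa using ha
        obtain ⟨i, hi⟩ : ∃ i, a i ≠ 0 := by
          by_contra hno
          push Not at hno
          have : a = 0 := by ext i; simpa using hno i
          rw [this] at ha1; simp at ha1
        obtain ⟨c, hc⟩ := exists_nat_one_div_lt (abs_pos.2 hi)
        refine mem_iUnion.2 ⟨i, ?_⟩
        simp only [i.2, dif_pos]
        refine mem_iUnion.2 ⟨c, hxA, mem_iInter.2 fun p => ?_⟩
        obtain ⟨r, hr, hb⟩ := hb (1 / ((p:ℝ) + 1)) (by positivity)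
        obtain ⟨j, hj⟩ := exists_nat_one_div_lt hr
        refine mem_iUnion.2 ⟨j, fun hmem => ?_⟩
        obtain ⟨y, hy, h3, h4⟩ := hmem a ⟨ha, hc.le⟩
        exact absurd (hb y hy (h3.trans hj)) (not_le.2 h4)

theorem chart_piece {X : Type*} [MetricSpace X] [MeasurableSpace X] [BorelSpace X] (m : Measure X)
    (hLDS : IsLDS m Set.univ) {n N : ℕ} {U E : Set X} (hU : MeasurableSet U) (hE : MeasurableSet E)
    {φ : X → EuclideanSpace ℝ (Fin n)} (hφ : IsLipschitzOn φ U) {F : X → EuclideanSpace ℝ (Fin N)}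
    (hF : BiLipschitzOn F E)
    (H : ∀ f : X → ℝ, IsLipschitzOn f Set.univ → ∀ᵐ x ∂(m.restrict U), ∃! df, HasChartDerivAt Set.univ φ f x df) :
    Good m (U ∩ E) := by
  have hA := hU.inter hE
  set A := U ∩ E with hAdef
  have hFA : BiLipschitzOn F A := bilip_mono hF inter_subset_right
  have hφA : IsLipschitzOn φ A := by
    obtain ⟨K, hK⟩ := hφ
    exact ⟨K, hK.mono inter_subset_left⟩
  have HA : ∀ f : X → ℝ, IsLipschitzOn f Set.univ → ∀ᵐ x ∂(m.restrict A), ∃ df, HasChartDerivAt A φ f x df := by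
    intro f hf
    filter_upwards [ae_restrict_of_ae_restrict_of_subset (inter_subset_left : A ⊆ U) (H f hf)] with x hx
    obtain ⟨df, hdf⟩ := hx.exists
    exact ⟨df, chart_mono hdf (subset_univ _)⟩
  obtain ⟨L, hL, hLb⟩ := id hFA
  have hL0 : 0 < L := by linarith
  have hg : ∀ c, ∃ g : X → ℝ, IsLipschitzOn g Set.univ ∧ ∀ x ∈ A, g x = F x c := by
    intro c
    have hl : LipschitzOnWith (⟨L, by positivity⟩ : NNReal) (fun x => F x c) A := by
      refine LipschitzOnWith.of_dist_le_mul fun x hx y hy => ?_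
      have h1 : ‖F x c - F y c‖ ≤ ‖F x - F y‖ := PiLp.norm_apply_le (F x - F y) c
      have h3 := (hLb x hx y hy).2
      rw [dist_eq_norm (F x)] at h3
      rw [dist_eq_norm]
      exact h1.trans h3
    obtain ⟨g, hg1, hg2⟩ := hl.extend_real
    exact ⟨g, ⟨_, hg1.lipschitzOnWith⟩, fun x hx => (hg2 hx).symm⟩
  choose g hg1 hg2 using hg
  have hae : ∀ᵐ x ∂(m.restrict A), ∀ c, ∃ df, HasChartDerivAt A φ (g c) x df :=
    ae_all_iff.2 fun c => HA _ (hg1 c)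
  rw [ae_restrict_iff' hA, ae_iff] at hae
  have gl := pieces m hA hFA hφA _ hae ?_
  · obtain ⟨P, hP1, hP2, hP3, hP4⟩ := gl
    refine good_union m A P (fun j => induct m hLDS n φ (P j) (hP1 j) (hP4 j) fun f hf => ?_) hP3
    filter_upwards [ae_restrict_of_ae_restrict_of_subset (hP2 j) (HA f hf)] with x hx
    obtain ⟨df, hdf⟩ := hx
    exact ⟨df, chart_mono hdf (hP2 j)⟩
  · intro x hxA hx
    simp only [Set.mem_ofPred_eq, not_not] at hx
    choose df hdf using hx hxA
    -- small constant
    have hε : 0 < 1 / (2 * L * (N + 1)) := by positivity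
    choose r hr hrb using fun c => chart_lim.1 (hdf c) _ hε
    obtain ⟨ρ, hρ, hρr⟩ : ∃ ρ : ℝ, 0 < ρ ∧ ∀ c, ρ ≤ r c := by
      rcases isEmpty_or_nonempty (Fin N) with h | h
      · exact ⟨1, one_pos, fun c => (h.false c).elim⟩
      · obtain ⟨c0, hc0⟩ := Finite.exists_min r
        exact ⟨r c0, hr c0, hc0⟩
    set M := ∑ c, ‖df c‖ with hM
    refine ⟨2 * L * M, ρ, hρ, fun y hy hyx => ?_⟩
    have h1 := (hLb y hy x hxA).1
    rw [inv_mul_le_iff₀ hL0] at h1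
    have h2 : dist (F y) (F x) ≤ ∑ c, |F y c - F x c| := by
      rw [dist_eq_norm]
      have := (EuclideanSpace.basisFun (Fin N) ℝ).sum_repr (F y - F x)
      rw [← this]
      refine (norm_sum_le _ _).trans (le_of_eq ?_)
      refine Finset.sum_congr rfl fun c _ => ?_
      simp [norm_smul]
    have h3 : ∑ c, |F y c - F x c| ≤ ∑ c : Fin N, (1 / (2 * L * (N + 1)) * dist y x + ‖df c‖ * ‖φ y - φ x‖) := by
      refine Finset.sum_le_sum fun c _ => ?_
      have q := hrb c y hy (hyx.trans_le (hρr c))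
      rw [hg2 c y hy, hg2 c x hxA] at q
      have q2 := abs_real_inner_le_norm (df c) (φ y - φ x)
      have q3 := abs_add_le (F y c - F x c - ⟪df c, φ y - φ x⟫) (⟪df c, φ y - φ x⟫)
      rw [sub_add_cancel] at q3
      linarith
    have hMs : ∑ c, ‖df c‖ * ‖φ y - φ x‖ = M * ‖φ y - φ x‖ := (Finset.sum_mul _ _ _).symm
    rw [Finset.sum_add_distrib, hMs] at h3
    simp only [Finset.sum_const, Finset.card_univ, Fintype.card_fin, nsmul_eq_mul] at h3
    have h4 : (N:ℝ) * (1 / (2 * L * (N + 1)) * dist y x) ≤ 1 / (2 * L) * dist y x := by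
      have e : (N:ℝ) * (1 / (2 * L * (N + 1)) * dist y x) = (N / (N + 1)) * (1 / (2 * L) * dist y x) := by field_simp
      rw [e]
      refine mul_le_of_le_one_left (by positivity) ?_
      rw [div_le_one (by positivity)]; linarith
    have h5 : L * (1 / (2 * L) * dist y x) = dist y x / 2 := by field_simp
    have h6 : L * dist (F y) (F x) ≤ L * (1 / (2 * L) * dist y x + M * ‖φ y - φ x‖) :=
      mul_le_mul_of_nonneg_left (by linarith) hL0.le
    rw [mul_add, h5] at h6
    linarith

theorem main_good {X : Type*} [MetricSpace X] [MeasurableSpace X] [BorelSpace X]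
    (m : Measure X) (hLDS : IsLDS m Set.univ) (hemb : LocEuclEmbeddable m) : Good m Set.univ := by
  obtain ⟨n, U, φ, h⟩ := id hLDS
  obtain ⟨N, E, F, hE1, hE2, hE3⟩ := hemb
  refine good_union m _ (fun j => U j.unpair.1 ∩ E j.unpair.2) (fun j => ?_) ?_
  · exact chart_piece m hLDS (h.borel _) (hE1 _) (h.lip _) (hE3 _) (fun f hf => h.diff f hf _)
  · refine measure_mono_null ?_ (measure_union_null h.cover hE2)
    rintro x ⟨-, hx⟩
    by_contra hno
    have hno1 : x ∈ ⋃ i, U i := by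
      by_contra h1
      exact hno (Or.inl ⟨Set.mem_univ x, h1⟩)
    have hno2 : x ∈ ⋃ i, E i := by
      by_contra h1
      exact hno (Or.inr ⟨Set.mem_univ x, h1⟩)
    obtain ⟨i, hi⟩ := mem_iUnion.1 hno1
    obtain ⟨l, hl⟩ := mem_iUnion.1 hno2
    refine hx (mem_iUnion.2 ⟨Nat.pair i l, ?_⟩)
    simp only [Nat.unpair_pair]
    exact ⟨hi, hl⟩

/-- A Lipschitz differentiability space which is locally bi-Lipschitz
embeddable into Euclidean spaces is rectifiable as a metric measure space: it can be covered,
up to an `m`-null set, by countably many Borel pieces `R j`, each bi-Lipschitz embeddable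
into some `ℝ^{n j}` and with `m ⌞ R j ≪ H^{n j}`. -/
theorem stmt0 {X : Type*} [MetricSpace X] [MeasurableSpace X] [BorelSpace X]
    (m : Measure X) (hLDS : IsLDS m Set.univ) (hemb : LocEuclEmbeddable m) :
    ∃ (R : ℕ → Set X) (n : ℕ → ℕ),
      (∀ j, MeasurableSet (R j)) ∧ m (Set.univ \ ⋃ j, R j) = 0 ∧
      ∀ j, 0 < n j ∧
        (∃ Φ : X → EuclideanSpace ℝ (Fin (n j)), BiLipschitzOn Φ (R j)) ∧
        m.restrict (R j) ≪ μH[(n j : ℝ)] := by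
  exact main_good m hLDS hemb
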